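/- arXiv:2212.00324 — 3 statements merged into one kernel-verified Lean document; each statement's English description precedes it below -/
import Mathlib

section
/- Fix a positive integer n. Then the set {x ∈ ℝ : there exists a number field K of degree n with x = (1/2)(r₁(K)·π/2 + n·(log(8π)+γ) − log|d_K|)} contains at most one algebraic number; that is, the subset of its elements that are algebraic over ℚ is a subsingleton. (This is the first part of Corollary 7, since (1/2)(r₁(K)·π/2 + n·(log(8π)+γ) − log|d_K|) = ζ_K'(1/2)/ζ_K(1/2) whenever ζ_K(1/2) ≠ 0.) -/
/-- For a number field `K`, the quantity
`(1/2)(r₁(K)·π/2 + n·(log(8π)+γ) − log|d_K|)` where `n = [K:ℚ]`; this equals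
`ζ_K'(1/2)/ζ_K(1/2)` whenever `ζ_K(1/2) ≠ 0`. -/
noncomputable def zetaLogDerivHalf (K : Type) [Field K] [NumberField K] : ℝ :=
  (1 / 2) * ((NumberField.InfinitePlace.nrRealPlaces K : ℝ) * (Real.pi / 2) +
    (Module.finrank ℚ K : ℝ) * (Real.log (8 * Real.pi) + Real.eulerMascheroniConstant) -
    Real.log |(NumberField.discr K : ℝ)|)

/-- The degree of a number field over `ℚ`. -/
noncomputable def degreeOverQ (K : Type) [Field K] [NumberField K] : ℕ :=
  Module.finrank ℚ K

namespace BakerPi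

/-- Values of the `m`-th derivative of `z ^ a * exp (b z)`, divided by `exp (b z)`. -/
def PP {R : Type*} [CommRing R] (b z : R) : ℕ → ℕ → R
  | 0, a => z ^ a
  | m + 1, a => (a : R) * PP b z m (a - 1) + b * PP b z m a

theorem map_PP {R S : Type*} [CommRing R] [CommRing S] (f : R →+* S) (b z : R) (m a : ℕ) :
    f (PP b z m a) = PP (f b) (f z) m a := by
  induction m generalizing a with
  | zero => simp [PP]
  | succ m ih => simp [PP, ih]

theorem norm_PP_le (b z : ℂ) (B ρ : ℝ) (hb : ‖b‖ ≤ B) (hz : ‖z‖ ≤ ρ) (hρ : 1 ≤ ρ) (m a : ℕ) :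
    ‖PP b z m a‖ ≤ ρ ^ a * ((a : ℝ) + B) ^ m := by
  have hB : 0 ≤ B := (norm_nonneg _).trans hb
  induction m generalizing a with
  | zero =>
    simp only [PP, norm_pow, pow_zero, mul_one]
    gcongr
  | succ m ih =>
    simp only [PP]
    calc ‖(a : ℂ) * PP b z m (a - 1) + b * PP b z m a‖
        ≤ a * ‖PP b z m (a - 1)‖ + ‖b‖ * ‖PP b z m a‖ := by
          refine (norm_add_le _ _).trans ?_
          simp
      _ ≤ a * (ρ ^ a * ((a : ℝ) + B) ^ m) + B * (ρ ^ a * ((a : ℝ) + B) ^ m) := by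
          gcongr
          · refine (ih (a - 1)).trans ?_
            gcongr
            · exact Nat.sub_le _ _
            · exact Nat.sub_le _ _
          · exact ih a
      _ = _ := by ring

theorem hasDerivAt_PP (b z : ℂ) (m a : ℕ) :
    HasDerivAt (fun z => PP b z m a) ((a : ℂ) * PP b z m (a - 1)) z := by
  induction m generalizing a with
  | zero => simpa [PP] using hasDerivAt_pow a z
  | succ m ih =>
    simp only [PP]
    refine (((ih (a - 1)).const_mul (a : ℂ)).add ((ih a).const_mul b)).congr_deriv ?_
    ring

theorem hasDerivAt_PP_exp (b w z : ℂ) (m a : ℕ) :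
    HasDerivAt (fun z => PP b z m a * Complex.exp (w * z))
      ((PP b z (m + 1) a + (w - b) * PP b z m a) * Complex.exp (w * z)) z := by
  have h1 : HasDerivAt (fun z => Complex.exp (w * z)) (Complex.exp (w * z) * w) z := by
    simpa using ((hasDerivAt_id z).const_mul w).cexp
  refine ((hasDerivAt_PP b z m a).mul h1).congr_deriv ?_
  simp only [PP]
  ring

theorem iteratedDeriv_family (F : ℕ → ℕ → ℂ → ℂ) (c : ℂ)
    (hF : ∀ a b z, HasDerivAt (F a b) (F (a + 1) b z + c * F a (b + 1) z) z)
    (l : ℂ) (A B : ℕ) (h0 : ∀ a < A, ∀ b < B, F a b l = 0) (n a b : ℕ)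
    (ha : a + n < A) (hb : b + n < B) : iteratedDeriv n (F a b) l = 0 := by
  have hdiff : ∀ a b, Differentiable ℂ (F a b) := fun a b z => (hF a b z).differentiableAt
  induction n generalizing a b with
  | zero => simpa using h0 a (by omega) b (by omega)
  | succ n ih =>
    rw [iteratedDeriv_succ']
    have : deriv (F a b) = (F (a + 1) b) + fun z => c * F a (b + 1) z := by
      ext z
      exact (hF a b z).deriv
    rw [this, iteratedDeriv_add (hdiff _ _).contDiff.contDiffAt
      ((hdiff _ _).const_mul c).contDiff.contDiffAt,
      iteratedDeriv_const_mul_field, ih _ _ (by omega) (by omega), ih _ _ (by omega) (by omega)]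
    simp

theorem exists_factor_one (f : ℂ → ℂ) (hf : Differentiable ℂ f) (a : ℂ) (n : ℕ)
    (h : (n : ℕ∞) ≤ analyticOrderAt f a) :
    ∃ g : ℂ → ℂ, Differentiable ℂ g ∧ ∀ z, f z = (z - a) ^ n * g z := by
  induction n with
  | zero => exact ⟨f, hf, by simp⟩
  | succ n ih =>
    obtain ⟨g, hg, hfg⟩ := ih (le_trans (by exact_mod_cast Nat.le_succ n) h)
    have hfg' : f = (fun z => z - a) ^ n * g := by
      ext z; simp [hfg]
    have hA : AnalyticAt ℂ (fun z : ℂ => z - a) a := by fun_prop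
    have hgA : AnalyticAt ℂ g a := hg.analyticAt a
    have hga : g a = 0 := by
      by_contra hne
      have h2 : analyticOrderAt g a = 0 := analyticOrderAt_eq_zero.2 (Or.inr hne)
      have h3 : analyticOrderAt (fun z : ℂ => z - a) a = 1 := analyticOrderAt_id_sub_const_self
      rw [hfg', analyticOrderAt_mul (hA.pow n) hgA, analyticOrderAt_pow hA, h2, h3] at h
      simp at h
      norm_cast at h
      omega
    refine ⟨dslope g a, ?_, ?_⟩
    · have : DifferentiableOn ℂ (dslope g a) Set.univ :=
        (Complex.differentiableOn_dslope (by simp)).2 hg.differentiableOn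
      exact differentiableOn_univ.1 this
    · intro z
      have := sub_smul_dslope g a z
      rw [hfg, pow_succ, mul_assoc]
      simp only [smul_eq_mul, hga, sub_zero] at this
      rw [this]

theorem exists_factor (s : Finset ℂ) (f : ℂ → ℂ) (hf : Differentiable ℂ f) (n : ℕ)
    (h : ∀ a ∈ s, (n : ℕ∞) ≤ analyticOrderAt f a) :
    ∃ g : ℂ → ℂ, Differentiable ℂ g ∧ ∀ z, f z = (∏ a ∈ s, (z - a) ^ n) * g z := by
  classical
  induction s using Finset.induction_on with
  | empty => exact ⟨f, hf, by simp⟩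
  | insert a s ha ih =>
    obtain ⟨g, hg, hfg⟩ := ih (fun b hb => h b (Finset.mem_insert_of_mem hb))
    have key : (n : ℕ∞) ≤ analyticOrderAt g a := by
      have h1 := h a (Finset.mem_insert_self a s)
      have hfg' : f = (fun z => ∏ a ∈ s, (z - a) ^ n) * g := by
        ext z; simp [hfg]
      have hA : AnalyticAt ℂ (fun z : ℂ => ∏ a ∈ s, (z - a) ^ n) a := by fun_prop
      have h2 : analyticOrderAt (fun z : ℂ => ∏ a ∈ s, (z - a) ^ n) a = 0 := by
        refine analyticOrderAt_eq_zero.2 (Or.inr ?_)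
        refine Finset.prod_ne_zero_iff.2 fun b hb => pow_ne_zero _ (sub_ne_zero.2 ?_)
        rintro rfl; exact ha hb
      rw [hfg', analyticOrderAt_mul hA (hg.analyticAt a), h2, zero_add] at h1
      exact h1
    obtain ⟨g', hg', hgg'⟩ := exists_factor_one g hg a n key
    refine ⟨g', hg', fun z => ?_⟩
    rw [hfg, hgg', Finset.prod_insert ha]
    ring

theorem schwarz (f : ℂ → ℂ) (hf : Differentiable ℂ f) (Y S : ℕ) (R M : ℝ) (hR : 0 < R)
    (hSR : (S : ℝ) ≤ R)
    (h0 : ∀ l : ℕ, 1 ≤ l → l ≤ S → ∀ n < Y, iteratedDeriv n f l = 0)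
    (hM : ∀ z : ℂ, ‖z‖ ≤ 5 * R → ‖f z‖ ≤ M) (z : ℂ) (hz : ‖z‖ ≤ R) :
    2 ^ (Y * S) * ‖f z‖ ≤ M := by
  classical
  set s : Finset ℂ := (Finset.Icc 1 S).image (fun l : ℕ => (l : ℂ)) with hs
  have hcard : s.card = S := by
    rw [hs, Finset.card_image_of_injective _ Nat.cast_injective]; simp
  have hmem : ∀ a ∈ s, ‖a‖ ≤ R := by
    intro a ha
    simp only [hs, Finset.mem_image, Finset.mem_Icc] at ha
    obtain ⟨l, hl, rfl⟩ := ha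
    simp only [Complex.norm_natCast]
    exact le_trans (by exact_mod_cast hl.2) hSR
  obtain ⟨g, hg, hfg⟩ := exists_factor s f hf Y (by
    intro a ha
    simp only [hs, Finset.mem_image, Finset.mem_Icc] at ha
    obtain ⟨l, hl, rfl⟩ := ha
    exact (natCast_le_analyticOrderAt_iff_iteratedDeriv_eq_zero (hf.analyticAt _)).2
      (fun i hi => h0 l hl.1 hl.2 i hi))
  have hM0 : 0 ≤ M := (norm_nonneg _).trans (hM 0 (by simp; positivity))
  have hgb : ∀ w : ℂ, ‖w‖ = 5 * R → ‖g w‖ ≤ M / (4 * R) ^ (Y * S) := by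
    intro w hw
    rw [le_div_iff₀ (by positivity)]
    calc ‖g w‖ * (4 * R) ^ (Y * S) ≤ ‖g w‖ * ‖∏ a ∈ s, (w - a) ^ Y‖ := by
          gcongr
          rw [norm_prod, pow_mul, ← hcard, ← Finset.prod_const]
          refine Finset.prod_le_prod (fun _ _ => by positivity) fun a ha => ?_
          rw [norm_pow]
          gcongr
          have := norm_sub_norm_le w a
          have := hmem a ha
          linarith
      _ = ‖f w‖ := by rw [hfg, norm_mul, mul_comm]
      _ ≤ M := hM w hw.le
  have hgz : ‖g z‖ ≤ M / (4 * R) ^ (Y * S) := by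
    refine Complex.norm_le_of_forall_mem_frontier_norm_le (U := Metric.ball 0 (5 * R))
      Metric.isBounded_ball hg.diffContOnCl ?_ (subset_closure ?_)
    · intro w hw
      rw [frontier_ball _ (by positivity)] at hw
      exact hgb w (by simpa using hw)
    · simp; linarith
  have h2 : ‖∏ a ∈ s, (z - a) ^ Y‖ ≤ (2 * R) ^ (Y * S) := by
    rw [norm_prod, pow_mul, ← hcard, ← Finset.prod_const]
    refine Finset.prod_le_prod (fun _ _ => by positivity) fun a ha => ?_
    rw [norm_pow]
    gcongr
    have := norm_sub_le z a
    have := hmem a ha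
    linarith
  calc 2 ^ (Y * S) * ‖f z‖ = 2 ^ (Y * S) * (‖∏ a ∈ s, (z - a) ^ Y‖ * ‖g z‖) := by
        rw [hfg, norm_mul]
    _ ≤ 2 ^ (Y * S) * ((2 * R) ^ (Y * S) * (M / (4 * R) ^ (Y * S))) := by gcongr
    _ = M := by
        rw [← mul_assoc, ← mul_pow, show 2 * (2 * R) = 4 * R by ring]
        field_simp



open Polynomial in
/-- The shift operator on sequences. -/
noncomputable def shift : Module.End ℂ (ℕ → ℂ) where
  toFun a := fun j => a (j + 1)
  map_add' _ _ := rfl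
  map_smul' _ _ := rfl

theorem shift_apply (a : ℕ → ℂ) (j : ℕ) : shift a j = a (j + 1) := rfl

open Polynomial in
/-- Growth control of a polynomial in the shift operator. -/
def QQ (N V : ℝ) (W : ℂ[X]) (d : ℕ) : Prop :=
  ∀ (M : ℝ) (n : ℕ) (a : ℕ → ℂ), (∀ j ≤ n, ‖a j‖ ≤ M * N ^ j) →
    ∀ j, j + d ≤ n → ‖(aeval shift W a) j‖ ≤ M * (N + V) ^ d * N ^ j

open Polynomial in
theorem QQ_one (N V : ℝ) : QQ N V 1 0 := by
  intro M n a h j hj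
  simpa using h j (by omega)

open Polynomial in
theorem QQ_mul (N V : ℝ) (W₁ W₂ : ℂ[X]) (d₁ d₂ : ℕ) (h₁ : QQ N V W₁ d₁) (h₂ : QQ N V W₂ d₂) :
    QQ N V (W₁ * W₂) (d₁ + d₂) := by
  intro M n a h j hj
  rw [map_mul, Module.End.mul_apply]
  have := h₁ (M * (N + V) ^ d₂) (n - d₂) (aeval shift W₂ a)
    (fun j hj => h₂ M n a h j (by omega)) j (by omega)
  rw [pow_add]
  calc _ ≤ _ := this
    _ = _ := by ring

open Polynomial in
theorem QQ_pow (N V : ℝ) (W : ℂ[X]) (d k : ℕ) (h : QQ N V W d) : QQ N V (W ^ k) (d * k) := by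
  induction k with
  | zero => simpa using QQ_one N V
  | succ k ih => rw [pow_succ, Nat.mul_succ]; exact QQ_mul _ _ _ _ _ _ ih h

open Polynomial in
theorem QQ_prod {ι : Type*} (N V : ℝ) (s : Finset ι) (W : ι → ℂ[X]) (d : ℕ)
    (h : ∀ x ∈ s, QQ N V (W x) d) : QQ N V (∏ x ∈ s, W x) (d * s.card) := by
  classical
  induction s using Finset.induction_on with
  | empty => simpa using QQ_one N V
  | insert x s hx ih =>
    rw [Finset.prod_insert hx, Finset.card_insert_of_notMem hx, Nat.mul_succ, add_comm]
    exact QQ_mul _ _ _ _ _ _ (h x (Finset.mem_insert_self _ _))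
      (ih fun y hy => h y (Finset.mem_insert_of_mem hy))

open Polynomial in
theorem QQ_X_sub_C (N V : ℝ) (w : ℂ) (hw : ‖w‖ ≤ V) : QQ N V (X - C w) 1 := by
  intro M n a h j hj
  have e : (aeval shift (X - C w : ℂ[X]) a) j = a (j + 1) - w * a j := by
    simp [shift_apply, Module.algebraMap_end_apply]
  rw [e]
  have h1 := h (j + 1) hj
  have h2 := h j (by omega)
  calc ‖a (j + 1) - w * a j‖ ≤ ‖a (j + 1)‖ + ‖w‖ * ‖a j‖ := by
        simpa using norm_sub_le (a (j + 1)) (w * a j)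
    _ ≤ M * N ^ (j + 1) + V * (M * N ^ j) := by
        gcongr
        exact (norm_nonneg w).trans hw
    _ = _ := by ring

open Polynomial in
theorem aeval_shift_PP (w : ℂ) (n i : ℕ) :
    aeval shift ((X - C w : ℂ[X]) ^ n) (fun j => PP w 0 j i) =
      (i.descFactorial n : ℂ) • fun j => PP w 0 j (i - n) := by
  induction n with
  | zero => ext j; simp
  | succ n ih =>
    rw [pow_succ', map_mul, Module.End.mul_apply, ih, map_smul]
    ext j
    simp only [map_sub, aeval_X, aeval_C, LinearMap.sub_apply, Module.algebraMap_end_apply,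
      Pi.smul_apply, Pi.sub_apply, shift_apply, smul_eq_mul, PP, Nat.descFactorial_succ]
    rw [Nat.sub_sub]
    push_cast
    ring

theorem PP_zero_zero (w : ℂ) (j : ℕ) : PP w 0 j 0 = w ^ j := by
  induction j with
  | zero => simp [PP]
  | succ j ih => simp [PP, ih, pow_succ']

open Polynomial in
theorem aeval_shift_geom (w : ℂ) (V : ℂ[X]) :
    aeval shift V (fun j => PP w 0 j 0) = V.eval w • fun j => PP w 0 j 0 := by
  refine Module.End.aeval_apply_of_hasEigenvector (f := shift) (μ := w) ⟨?_, ?_⟩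
  · rw [Module.End.mem_eigenspace_iff]
    ext j
    simp [shift_apply, PP_zero_zero, pow_succ']
  · intro h
    have := congrFun h 0
    simp [PP] at this

open Polynomial in
theorem lower_bound {ι : Type*} [Fintype ι] (L N : ℕ) (w : ι → ℂ) (p : Fin L × ι → ℂ)
    (δ V M : ℝ) (hδ : 0 ≤ δ) (hδ1 : δ ≤ 1) (hw : ∀ x, ‖w x‖ ≤ V) (hsep : ∀ x y, x ≠ y → δ ≤ ‖w x - w y‖)
    (hN : L * Fintype.card ι ≤ N) (hN1 : 1 ≤ N) (hp : p ≠ 0)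
    (hM : ∀ z : ℂ, ‖z‖ ≤ 1 → ‖∑ x, p x * PP (w x.2) z 0 x.1 * Complex.exp (w x.2 * z)‖ ≤ M) :
    ∃ x, p x ≠ 0 ∧ δ ^ N * ‖p x‖ ≤ M * (N + V) ^ N := by
  classical
  obtain ⟨⟨i₀, x₀⟩, hx₀⟩ : ∃ x, p x ≠ 0 := by
    by_contra! h; exact hp (funext h)
  obtain ⟨i₁, hi₁, hmax⟩ := Finset.exists_max_image
    (Finset.univ.filter fun i : Fin L => p (i, x₀) ≠ 0) (fun i => i) ⟨i₀, by simpa using hx₀⟩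
  have hi₁' : p (i₁, x₀) ≠ 0 := by simpa using hi₁
  refine ⟨(i₁, x₀), hi₁', ?_⟩
  have hM0 : 0 ≤ M := (norm_nonneg _).trans (hM 0 (by simp))
  have hV0 : 0 ≤ V := (norm_nonneg _).trans (hw x₀)
  set f : ℂ → ℂ := fun z => ∑ x, p x * PP (w x.2) z 0 x.1 * Complex.exp (w x.2 * z) with hf
  have hder : ∀ j, iteratedDeriv j f =
      fun z => ∑ x, p x * (PP (w x.2) z j x.1 * Complex.exp (w x.2 * z)) := by
    intro j
    induction j with
    | zero => ext z; simp [hf, mul_assoc]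
    | succ j ih =>
      rw [iteratedDeriv_succ, ih]
      ext z
      refine HasDerivAt.deriv ?_
      refine HasDerivAt.fun_sum fun x _ => ?_
      refine ((hasDerivAt_PP_exp (w x.2) (w x.2) z j x.1).const_mul (p x)).congr_deriv ?_
      ring
  have hfd : Differentiable ℂ f := by
    intro z
    refine DifferentiableAt.fun_sum fun x _ => ?_
    have := ((hasDerivAt_PP_exp (w x.2) (w x.2) z 0 x.1).const_mul (p x)).differentiableAt
    simpa [mul_assoc] using this
  set a : ℕ → ℂ := fun j => iteratedDeriv j f 0 with ha
  have haeq : a = ∑ x, p x • fun j => PP (w x.2) 0 j x.1 := by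
    ext j
    simp [ha, hder]
  have hab : ∀ j ≤ N, ‖a j‖ ≤ M * (N : ℝ) ^ j := by
    intro j hj
    have h1 := Complex.norm_iteratedDeriv_le_of_forall_mem_sphere_norm_le (c := 0) (R := 1) j
      one_pos (hfd.diffContOnCl) (C := M) (fun z hz => hM z (by simpa using le_of_eq hz))
    have h2 : (j.factorial : ℝ) ≤ (N : ℝ) ^ j := by
      have : j.factorial ≤ N ^ j := (Nat.factorial_le_pow j).trans (Nat.pow_le_pow_left hj j)
      exact_mod_cast this
    calc ‖a j‖ ≤ j.factorial * M := by simpa using h1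
      _ ≤ (N : ℝ) ^ j * M := by gcongr
      _ = _ := mul_comm _ _
  set U : ℂ[X] := ∏ x ∈ Finset.univ.erase x₀, (X - C (w x)) ^ L with hU
  set W : ℂ[X] := U * (X - C (w x₀)) ^ (i₁ : ℕ) with hW
  have hQU : QQ N V U ((1 * L) * (Finset.univ.erase x₀).card) :=
    QQ_prod _ _ _ _ _ fun x _ => QQ_pow _ _ _ _ _ (QQ_X_sub_C _ _ _ (hw x))
  have hQW := QQ_mul _ _ _ _ _ _ hQU
    (QQ_pow _ _ _ _ (i₁ : ℕ) (QQ_X_sub_C N V _ (hw x₀)))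
  have hdeg : (1 * L) * (Finset.univ.erase x₀).card + 1 * (i₁ : ℕ) ≤ N := by
    rw [Finset.card_erase_of_mem (Finset.mem_univ _), Finset.card_univ]
    have h1 : 1 ≤ Fintype.card ι := Fintype.card_pos_iff.2 ⟨x₀⟩
    have h2 := i₁.2
    obtain ⟨t, ht⟩ : ∃ t, Fintype.card ι = t + 1 := ⟨Fintype.card ι - 1, by omega⟩
    rw [ht] at hN ⊢
    simp only [Nat.add_sub_cancel]
    nlinarith
  have hfin := hQW M N a hab 0 (by omega)
  have hval : aeval shift W a = (p (i₁, x₀) * ((i₁ : ℕ).factorial * U.eval (w x₀))) •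
      fun j => PP (w x₀) 0 j 0 := by
    rw [haeq, map_sum, Finset.sum_eq_single (i₁, x₀)]
    · rw [map_smul, hW, map_mul, Module.End.mul_apply, aeval_shift_PP, map_smul, Nat.sub_self,
        aeval_shift_geom, smul_smul, smul_smul, Nat.descFactorial_self, mul_assoc]
    · rintro ⟨i, x⟩ - hne
      rw [map_smul]
      by_cases hx : x = x₀
      · subst hx
        rcases lt_trichotomy i i₁ with h | h | h
        · rw [hW, map_mul, Module.End.mul_apply, aeval_shift_PP,
            Nat.descFactorial_of_lt (by exact_mod_cast h)]
          simp
        · exact absurd (by rw [h]) hne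
        · have : p (i, x) = 0 := by
            by_contra hc
            exact absurd (hmax i (by simpa using hc)) (not_le.2 h)
          rw [this, zero_smul]
      · have : W = ((∏ y ∈ (Finset.univ.erase x₀).erase x, (X - C (w y)) ^ L) *
            (X - C (w x₀)) ^ (i₁ : ℕ)) * (X - C (w x)) ^ L := by
          rw [hW, hU, ← Finset.mul_prod_erase (Finset.univ.erase x₀) _ (a := x) (by simp [hx])]
          ring
        rw [this, map_mul, Module.End.mul_apply, aeval_shift_PP,
          Nat.descFactorial_of_lt i.2]
        simp
    · simp
  rw [hW] at hval
  rw [hval] at hfin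
  simp only [Pi.smul_apply, PP_zero_zero, pow_zero, smul_eq_mul, mul_one, norm_mul,
    Complex.norm_natCast] at hfin
  have hUl : δ ^ N ≤ ‖U.eval (w x₀)‖ := by
    rw [hU, eval_prod, norm_prod]
    calc δ ^ N ≤ δ ^ (L * (Finset.univ.erase x₀).card) := by
          apply pow_le_pow_of_le_one hδ hδ1
          rw [one_mul, one_mul] at hdeg
          omega
      _ = ∏ x ∈ Finset.univ.erase x₀, δ ^ L := by rw [Finset.prod_const, pow_mul]
      _ ≤ _ := by
          refine Finset.prod_le_prod (fun _ _ => by positivity) fun x hx => ?_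
          simp only [eval_pow, eval_sub, eval_X, eval_C, norm_pow]
          gcongr
          exact hsep _ _ (by simpa [eq_comm] using hx)
  have hfac : (1 : ℝ) ≤ ((i₁ : ℕ).factorial : ℝ) := by exact_mod_cast Nat.factorial_pos _
  calc δ ^ N * ‖p (i₁, x₀)‖ ≤ ‖p (i₁, x₀)‖ * (((i₁ : ℕ).factorial : ℝ) * ‖U.eval (w x₀)‖) := by
        rw [mul_comm]
        gcongr
        calc δ ^ N ≤ 1 * ‖U.eval (w x₀)‖ := by simpa using hUl
          _ ≤ _ := by gcongr
    _ ≤ _ := hfin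
    _ ≤ M * (N + V) ^ N := by
        have h1 : (1 : ℝ) ≤ N := by exact_mod_cast hN1
        gcongr
        linarith

/-- A Siegel lemma wrapper. -/
theorem siegel (K : Type) [Field K] [NumberField K] :
    ∃ c : ℝ, 1 ≤ c ∧ ∀ (α β : Type) [Fintype α] [Fintype β]
      (a : Matrix α β (NumberField.RingOfIntegers K)) (A : ℝ), 0 < Fintype.card α →
      2 * Fintype.card α ≤ Fintype.card β → 1 ≤ A →
      (∀ k l, NumberField.house (algebraMap (NumberField.RingOfIntegers K) K (a k l)) ≤ A) →
      ∃ ξ : β → NumberField.RingOfIntegers K, ξ ≠ 0 ∧ a.mulVec ξ = 0 ∧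
        ∀ l, NumberField.house (algebraMap (NumberField.RingOfIntegers K) K (ξ l)) ≤
          c * (c * Fintype.card β * A) := by
  classical
  obtain ⟨c, hc⟩ : ∃ c : ℝ, ∀ (α β : Type) [Fintype α] [Fintype β]
      (a : Matrix α β (NumberField.RingOfIntegers K)) (A : ℝ), a ≠ 0 → 0 < Fintype.card α →
      Fintype.card α < Fintype.card β →
      (∀ k l, NumberField.house (algebraMap (NumberField.RingOfIntegers K) K (a k l)) ≤ A) →
      ∃ ξ : β → NumberField.RingOfIntegers K, ξ ≠ 0 ∧ a.mulVec ξ = 0 ∧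
        ∀ l, NumberField.house (ξ l).1 ≤
          c * (c * (Fintype.card β : ℕ) * A) ^
            (((Fintype.card α : ℕ) : ℝ) / ((Fintype.card β : ℕ) - (Fintype.card α : ℕ))) :=
    ⟨_, fun α β _ _ a A ha h0 h1 h2 =>
      NumberField.house.exists_ne_zero_int_vec_house_le K a ha h0 h1 rfl h2 rfl⟩
  refine ⟨max 1 |c|, le_max_left _ _, fun α β _ _ a A h0 h1 hA h2 => ?_⟩
  set c' := max 1 |c| with hc'
  have hc1 : 1 ≤ c' := le_max_left _ _
  have hcc : |c| ≤ c' := le_max_right _ _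
  have hq : (1 : ℝ) ≤ Fintype.card β := by
    have : 1 ≤ Fintype.card β := by omega
    exact_mod_cast this
  have hbase : 1 ≤ c' * Fintype.card β * A := by
    have := one_le_mul_of_one_le_of_one_le hc1 hq
    exact one_le_mul_of_one_le_of_one_le this hA
  by_cases ha : a = 0
  · refine ⟨fun _ => 1, ?_, by simp [ha], fun l => ?_⟩
    · intro h
      obtain ⟨b⟩ := Fintype.card_pos_iff.1 (show 0 < Fintype.card β by omega)
      exact one_ne_zero (congrFun h b)
    · have : NumberField.house (1 : K) = 1 := by
        simpa using NumberField.house_intCast (K := K) 1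
      rw [map_one, this]
      exact one_le_mul_of_one_le_of_one_le hc1 hbase
  · obtain ⟨ξ, h3, h4, h5⟩ := hc α β a A ha h0 (by omega) h2
    refine ⟨ξ, h3, h4, fun l => (h5 l).trans ?_⟩
    set e : ℝ := ((Fintype.card α : ℕ) : ℝ) / ((Fintype.card β : ℕ) - (Fintype.card α : ℕ)) with he
    have hα : (0 : ℝ) < Fintype.card α := by exact_mod_cast h0
    have hαβ : 2 * (Fintype.card α : ℝ) ≤ Fintype.card β := by exact_mod_cast h1
    have he0 : 0 ≤ e := div_nonneg hα.le (by linarith)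
    have he1 : e ≤ 1 := by
      rw [he, div_le_one (by linarith)]; linarith
    calc c * (c * (Fintype.card β : ℕ) * A) ^ e
        ≤ |c * (c * (Fintype.card β : ℕ) * A) ^ e| := le_abs_self _
      _ = |c| * |(c * (Fintype.card β : ℕ) * A) ^ e| := abs_mul _ _
      _ ≤ |c| * |c * (Fintype.card β : ℕ) * A| ^ e := by
          gcongr
          exact Real.abs_rpow_le_abs_rpow _ _
      _ ≤ c' * (c' * (Fintype.card β : ℕ) * A) ^ e := by
          gcongr
          rw [abs_mul, abs_mul, abs_of_nonneg (by linarith : 0 ≤ A), Nat.abs_cast]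
          gcongr
      _ ≤ c' * (c' * (Fintype.card β : ℕ) * A) ^ (1 : ℝ) := by
          gcongr
      _ = _ := by rw [Real.rpow_one]

/-- Liouville inequality. -/
theorem liouville (K : Type) [Field K] [NumberField K] (σ : K →+* ℂ)
    (ξ : NumberField.RingOfIntegers K) (hξ : ξ ≠ 0) (H : ℝ)
    (hH : NumberField.house (algebraMap (NumberField.RingOfIntegers K) K ξ) ≤ H) :
    1 ≤ ‖σ (algebraMap (NumberField.RingOfIntegers K) K ξ)‖ * H ^ (Module.finrank ℚ K) := by
  have h1 := NumberField.norm_norm_le_norm_mul_house_pow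
    (algebraMap (NumberField.RingOfIntegers K) K ξ) σ
  have hne : (algebraMap (NumberField.RingOfIntegers K) K ξ) ≠ 0 := by
    simpa using hξ
  have hhouse := NumberField.one_le_house_of_isIntegral (ξ.isIntegral_coe) hne
  have h2 : 1 ≤ ‖Algebra.norm ℚ (algebraMap (NumberField.RingOfIntegers K) K ξ)‖ := by
    have h3 := Algebra.coe_norm_int ξ
    have h4 : Algebra.norm ℤ ξ ≠ 0 := by
      rwa [Algebra.norm_ne_zero_iff]
    rw [← h3]
    have h5 : 1 ≤ |Algebra.norm ℤ ξ| := Int.one_le_abs h4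
    rw [← Rat.norm_cast_real]
    simp only [Rat.cast_intCast, Real.norm_eq_abs]
    exact_mod_cast h5
  refine h2.trans (h1.trans ?_)
  gcongr
  calc _ ≤ NumberField.house (algebraMap (NumberField.RingOfIntegers K) K ξ) ^ Module.finrank ℚ K :=
        pow_le_pow_right₀ hhouse (Nat.sub_le _ _)
    _ ≤ _ := by gcongr


/-- The algebraic coefficients of the auxiliary linear forms. -/
def coef {R : Type*} [CommRing R] (b0 b1 : R) (ε u v : ℤ) (L L1 m0 m1 l : ℕ)
    (x : Fin L × (Fin L1 × Fin L)) : R :=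
  PP (((x.2.2 : ℕ) : R) * b0) (l : R) m0 x.1 *
    (((x.2.1 : ℕ) : R) + ((x.2.2 : ℕ) : R) * b1) ^ m1 *
    ((ε : R) ^ ((x.2.1 : ℕ) * l) * ((u : R) ^ ((x.2.2 : ℕ) * l) *
    (v : R) ^ ((L - (x.2.2 : ℕ)) * l)))

theorem map_coef {R S : Type*} [CommRing R] [CommRing S] (f : R →+* S) (b0 b1 : R) (ε u v : ℤ)
    (L L1 m0 m1 l : ℕ) (x : Fin L × (Fin L1 × Fin L)) :
    f (coef b0 b1 ε u v L L1 m0 m1 l x) = coef (f b0) (f b1) ε u v L L1 m0 m1 l x := by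
  simp [coef, map_PP]

/-- The frequencies. -/
noncomputable def freq (l1 l2 : ℂ) {L1 L : ℕ} (y : Fin L1 × Fin L) : ℂ :=
  ((y.1 : ℕ) : ℂ) * l1 + ((y.2 : ℕ) : ℂ) * l2

/-- The auxiliary functions. -/
noncomputable def phi {L L1 : ℕ} (p : Fin L × (Fin L1 × Fin L) → ℂ) (b0 b1 l1 l2 : ℂ)
    (m0 m1 : ℕ) (z : ℂ) : ℂ :=
  ∑ x, p x * (((((x.2.1 : ℕ) : ℂ) + ((x.2.2 : ℕ) : ℂ) * b1) ^ m1) *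
    (PP (((x.2.2 : ℕ) : ℂ) * b0) z m0 x.1 * Complex.exp (freq l1 l2 x.2 * z)))

theorem hasDerivAt_phi {L L1 : ℕ} (p : Fin L × (Fin L1 × Fin L) → ℂ) (b0 b1 l1 l2 : ℂ)
    (hrel : l2 = b0 + b1 * l1) (m0 m1 : ℕ) (z : ℂ) :
    HasDerivAt (phi p b0 b1 l1 l2 m0 m1)
      (phi p b0 b1 l1 l2 (m0 + 1) m1 z + l1 * phi p b0 b1 l1 l2 m0 (m1 + 1) z) z := by
  unfold phi
  rw [Finset.mul_sum, ← Finset.sum_add_distrib]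
  refine HasDerivAt.fun_sum fun x _ => ?_
  refine (((hasDerivAt_PP_exp (((x.2.2 : ℕ) : ℂ) * b0) (freq l1 l2 x.2) z m0 x.1).const_mul
    _).const_mul _).congr_deriv ?_
  have : freq l1 l2 x.2 - ((x.2.2 : ℕ) : ℂ) * b0 =
      l1 * (((x.2.1 : ℕ) : ℂ) + ((x.2.2 : ℕ) : ℂ) * b1) := by
    rw [freq, hrel]; ring
  rw [this]
  ring

theorem norm_gamma_le (X : ℕ) (b : ℂ) (hb : ‖b‖ + 1 ≤ X) (j k : ℕ) (hj : j ≤ X ^ 6)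
    (hk : k ≤ X ^ 6) (m : ℕ) (hm : m ≤ 20 * X ^ 8) :
    ‖(j : ℂ) + (k : ℂ) * b‖ ^ m ≤ (X : ℝ) ^ (140 * X ^ 8) := by
  have hX1 : (1 : ℝ) ≤ X := by have := norm_nonneg b; linarith
  have hj' : (j : ℝ) ≤ (X : ℝ) ^ 6 := by exact_mod_cast hj
  have hk' : (k : ℝ) ≤ (X : ℝ) ^ 6 := by exact_mod_cast hk
  have h1 : ‖(j : ℂ) + (k : ℂ) * b‖ ≤ (X : ℝ) ^ 7 := by
    calc ‖(j : ℂ) + (k : ℂ) * b‖ ≤ j + k * ‖b‖ := by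
          refine (norm_add_le _ _).trans ?_
          simp
      _ ≤ (X : ℝ) ^ 6 + (X : ℝ) ^ 6 * ‖b‖ := by gcongr
      _ = (X : ℝ) ^ 6 * (‖b‖ + 1) := by ring
      _ ≤ (X : ℝ) ^ 6 * X := by gcongr
      _ = _ := by ring
  calc _ ≤ ((X : ℝ) ^ 7) ^ m := by gcongr
    _ = (X : ℝ) ^ (7 * m) := by rw [pow_mul]
    _ ≤ _ := pow_le_pow_right₀ hX1 (by omega)

theorem norm_PP_le' (X : ℕ) (b z : ℂ) (ρ : ℝ) (hb : ‖b‖ + 1 ≤ X) (hz : ‖z‖ ≤ ρ) (hρ : 1 ≤ ρ)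
    (i k : ℕ) (hi : i ≤ X ^ 6) (hk : k ≤ X ^ 6) (m : ℕ) (hm : m ≤ 20 * X ^ 8) :
    ‖PP ((k : ℂ) * b) z m i‖ ≤ ρ ^ (X ^ 6) * (X : ℝ) ^ (140 * X ^ 8) := by
  have hX1 : (1 : ℝ) ≤ X := by have := norm_nonneg b; linarith
  have hi' : (i : ℝ) ≤ (X : ℝ) ^ 6 := by exact_mod_cast hi
  have hk' : (k : ℝ) ≤ (X : ℝ) ^ 6 := by exact_mod_cast hk
  have h1 : (i : ℝ) + k * ‖b‖ ≤ (X : ℝ) ^ 7 := by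
    calc (i : ℝ) + k * ‖b‖ ≤ (X : ℝ) ^ 6 + (X : ℝ) ^ 6 * ‖b‖ := by gcongr
      _ = (X : ℝ) ^ 6 * (‖b‖ + 1) := by ring
      _ ≤ (X : ℝ) ^ 6 * X := by gcongr
      _ = _ := by ring
  have h2 := norm_PP_le ((k : ℂ) * b) z (k * ‖b‖) ρ (by simp) hz hρ m i
  refine h2.trans ?_
  gcongr
  calc _ ≤ ((X : ℝ) ^ 7) ^ m := by gcongr
    _ = (X : ℝ) ^ (7 * m) := by rw [pow_mul]
    _ ≤ _ := pow_le_pow_right₀ hX1 (by omega)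

theorem norm_coef_le (X : ℕ) (b0 b1 : ℂ) (ε u v : ℤ) (L1 m0 m1 l r : ℕ)
    (hb0 : ‖b0‖ + 1 ≤ X) (hb1 : ‖b1‖ + 1 ≤ X) (hε : |ε| = 1) (hu : |u| ≤ X) (hv : |v| ≤ X)
    (hL1 : L1 ≤ X ^ 6) (hm0 : m0 ≤ 20 * X ^ 8) (hm1 : m1 ≤ 20 * X ^ 8) (hl : 1 ≤ l)
    (hlr : l ≤ X ^ r) (x : Fin (X ^ 6) × (Fin L1 × Fin (X ^ 6))) :
    ‖coef b0 b1 ε u v (X ^ 6) L1 m0 m1 l x‖ ≤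
      (X : ℝ) ^ (r * X ^ 6 + 280 * X ^ 8 + X ^ (6 + r)) := by
  obtain ⟨i, j, k⟩ := x
  have hX1 : (1 : ℝ) ≤ X := by have := norm_nonneg b0; linarith
  have hu' : ‖(u : ℂ)‖ ≤ X := by
    rw [Complex.norm_intCast]; exact_mod_cast hu
  have hv' : ‖(v : ℂ)‖ ≤ X := by
    rw [Complex.norm_intCast]; exact_mod_cast hv
  have hε' : ‖(ε : ℂ)‖ = 1 := by
    rw [Complex.norm_intCast]; exact_mod_cast hε
  have hl' : (l : ℝ) ≤ (X : ℝ) ^ r := by exact_mod_cast hlr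
  have h1 := norm_PP_le' X b0 (l : ℂ) ((X : ℝ) ^ r) hb0 (by simpa using hl') (one_le_pow₀ hX1)
    i k i.2.le k.2.le m0 hm0
  have h2 := norm_gamma_le X b1 hb1 j k (j.2.le.trans hL1) k.2.le m1 hm1
  have h3 : ‖(u : ℂ)‖ ^ ((k : ℕ) * l) * ‖(v : ℂ)‖ ^ ((X ^ 6 - (k : ℕ)) * l) ≤
      (X : ℝ) ^ (X ^ (6 + r)) := by
    calc _ ≤ (X : ℝ) ^ ((k : ℕ) * l) * (X : ℝ) ^ ((X ^ 6 - (k : ℕ)) * l) := by gcongr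
      _ = (X : ℝ) ^ (X ^ 6 * l) := by
        rw [← pow_add, ← add_mul, Nat.add_sub_cancel' k.2.le]
      _ ≤ _ := by
        refine pow_le_pow_right₀ hX1 ?_
        rw [pow_add]; gcongr
  simp only [coef, norm_mul, norm_pow, hε', one_pow, one_mul]
  calc _ ≤ (((X : ℝ) ^ r) ^ (X ^ 6) * (X : ℝ) ^ (140 * X ^ 8)) * (X : ℝ) ^ (140 * X ^ 8) *
        (X : ℝ) ^ (X ^ (6 + r)) := by gcongr
    _ = _ := by
      rw [← pow_mul, ← pow_add, ← pow_add, ← pow_add]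
      congr 1
      ring

theorem norm_freq_le (X : ℕ) (l1 l2 : ℂ) (L1 : ℕ) (hL1 : L1 ≤ X ^ 6) (y : Fin L1 × Fin (X ^ 6)) :
    ‖freq l1 l2 y‖ ≤ X ^ 6 * (‖l1‖ + ‖l2‖) := by
  obtain ⟨j, k⟩ := y
  have hj' : ((j : ℕ) : ℝ) ≤ (X : ℝ) ^ 6 := by exact_mod_cast j.2.le.trans hL1
  have hk' : ((k : ℕ) : ℝ) ≤ (X : ℝ) ^ 6 := by exact_mod_cast k.2.le
  calc ‖freq l1 l2 (j, k)‖ ≤ (j : ℕ) * ‖l1‖ + (k : ℕ) * ‖l2‖ := by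
        refine (norm_add_le _ _).trans ?_
        simp
    _ ≤ (X : ℝ) ^ 6 * ‖l1‖ + (X : ℝ) ^ 6 * ‖l2‖ := by gcongr
    _ = _ := by ring

theorem norm_phi_le (X L1 : ℕ) (p : Fin (X ^ 6) × (Fin L1 × Fin (X ^ 6)) → ℂ)
    (b0 b1 l1 l2 : ℂ) (m0 m1 ρ e : ℕ)
    (hb0 : ‖b0‖ + 1 ≤ X) (hb1 : ‖b1‖ + 1 ≤ X) (hl : Real.exp (‖l1‖ + ‖l2‖) ≤ X)
    (hL1 : L1 ≤ X ^ 6) (hm0 : m0 ≤ 20 * X ^ 8) (hm1 : m1 ≤ 20 * X ^ 8) (hρ : 1 ≤ ρ)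
    (hρX : ρ ≤ X ^ 13) (hp : ∀ x, ‖p x‖ ≤ (X : ℝ) ^ e) (z : ℂ) (hz : ‖z‖ ≤ ρ) :
    ‖phi p b0 b1 l1 l2 m0 m1 z‖ ≤
      (X : ℝ) ^ (18 + e + 13 * X ^ 6 + 280 * X ^ 8 + X ^ 6 * ρ) := by
  have hX1 : (1 : ℝ) ≤ X := by have := norm_nonneg b0; linarith
  have hρ' : (1 : ℝ) ≤ ρ := by exact_mod_cast hρ
  have hρX' : (ρ : ℝ) ≤ (X : ℝ) ^ 13 := by exact_mod_cast hρX
  have hterm : ∀ x : Fin (X ^ 6) × (Fin L1 × Fin (X ^ 6)),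
      ‖p x * (((((x.2.1 : ℕ) : ℂ) + ((x.2.2 : ℕ) : ℂ) * b1) ^ m1) *
      (PP (((x.2.2 : ℕ) : ℂ) * b0) z m0 x.1 * Complex.exp (freq l1 l2 x.2 * z)))‖ ≤
      (X : ℝ) ^ (e + 13 * X ^ 6 + 280 * X ^ 8 + X ^ 6 * ρ) := by
    rintro ⟨i, j, k⟩
    have h1 := norm_PP_le' X b0 z ρ hb0 hz hρ' i k i.2.le k.2.le m0 hm0
    have h2 := norm_gamma_le X b1 hb1 j k (j.2.le.trans hL1) k.2.le m1 hm1
    have h3 : ‖Complex.exp (freq l1 l2 (j, k) * z)‖ ≤ (X : ℝ) ^ (X ^ 6 * ρ) := by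
      calc _ ≤ Real.exp ‖freq l1 l2 (j, k) * z‖ := Complex.norm_exp_le_exp_norm _
        _ ≤ Real.exp (((X ^ 6 * ρ : ℕ) : ℝ) * (‖l1‖ + ‖l2‖)) := by
          gcongr
          rw [norm_mul]
          calc _ ≤ (X ^ 6 * (‖l1‖ + ‖l2‖)) * ρ := by
                gcongr
                exact norm_freq_le X l1 l2 L1 hL1 (j, k)
            _ = _ := by push_cast; ring
        _ = Real.exp (‖l1‖ + ‖l2‖) ^ (X ^ 6 * ρ) := by rw [Real.exp_nat_mul]
        _ ≤ _ := by gcongr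
    simp only [norm_mul, norm_pow]
    calc _ ≤ (X : ℝ) ^ e * ((X : ℝ) ^ (140 * X ^ 8) *
          ((((X : ℝ) ^ 13) ^ (X ^ 6) * (X : ℝ) ^ (140 * X ^ 8)) * (X : ℝ) ^ (X ^ 6 * ρ))) := by
          gcongr
          · exact hp _
          · refine h1.trans ?_
            gcongr
      _ = _ := by
        rw [← pow_mul, ← pow_add, ← pow_add, ← pow_add, ← pow_add]
        congr 1
        ring
  unfold phi
  refine (norm_sum_le_of_le _ fun x _ => hterm x).trans ?_
  rw [Finset.sum_const, nsmul_eq_mul, Finset.card_univ]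
  have hc : ((Fintype.card (Fin (X ^ 6) × (Fin L1 × Fin (X ^ 6))) : ℕ) : ℝ) ≤ (X : ℝ) ^ 18 := by
    simp only [Fintype.card_prod, Fintype.card_fin]
    have : X ^ 6 * (L1 * X ^ 6) ≤ X ^ 18 := by
      calc X ^ 6 * (L1 * X ^ 6) ≤ X ^ 6 * (X ^ 6 * X ^ 6) := by gcongr
        _ = _ := by ring
    exact_mod_cast this
  calc _ ≤ (X : ℝ) ^ 18 * (X : ℝ) ^ (e + 13 * X ^ 6 + 280 * X ^ 8 + X ^ 6 * ρ) := by gcongr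
    _ = _ := by
      rw [← pow_add]
      congr 1
      ring

open NumberField in
/-- The data of a (hypothetical) linear relation. -/
structure Setup (K : Type) [Field K] [NumberField K] where
  σ : K →+* ℂ
  b0 : 𝓞 K
  b1 : 𝓞 K
  ε : ℤ
  u : ℤ
  v : ℤ
  l1 : ℂ
  l2 : ℂ
  hε : |ε| = 1
  hv : v ≠ 0
  e1 : Complex.exp l1 = ε
  e2 : Complex.exp l2 * v = u
  rel : l2 = σ (algebraMap (𝓞 K) K b0) + σ (algebraMap (𝓞 K) K b1) * l1

open NumberField in
/-- Largeness conditions for the parameter. -/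
structure Big {K : Type} [Field K] [NumberField K] (s : Setup K) (c δ : ℝ) (X : ℕ) : Prop where
  hb0 : ∀ τ : K →+* ℂ, ‖τ (algebraMap (𝓞 K) K s.b0)‖ + 1 ≤ X
  hb1 : ∀ τ : K →+* ℂ, ‖τ (algebraMap (𝓞 K) K s.b1)‖ + 1 ≤ X
  hu : |s.u| ≤ X
  hv : |s.v| ≤ X
  hl : Real.exp (‖s.l1‖ + ‖s.l2‖) ≤ X
  hc : c ≤ X
  hδ : 1 ≤ δ * X
  h800 : 800 ≤ X
  hexp : X ^ (2000 * (Module.finrank ℚ K + 1)) < 2 ^ X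

theorem eventually_big {K : Type} [Field K] [NumberField K] (s : Setup K) (c δ : ℝ) (hδ : 0 < δ) :
    ∃ X, Big s c δ X := by
  have hlim : Filter.Tendsto (fun X : ℕ => (X : ℝ)) Filter.atTop Filter.atTop :=
    tendsto_natCast_atTop_atTop
  have hge : ∀ r : ℝ, ∀ᶠ X : ℕ in Filter.atTop, r ≤ (X : ℝ) := fun r =>
    hlim.eventually_ge_atTop r
  have hge' : ∀ r : ℤ, ∀ᶠ X : ℕ in Filter.atTop, r ≤ (X : ℤ) := fun r =>
    tendsto_natCast_atTop_atTop.eventually_ge_atTop r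
  have hexp : ∀ᶠ X : ℕ in Filter.atTop, X ^ (2000 * (Module.finrank ℚ K + 1)) < 2 ^ X := by
    have h := isLittleO_pow_const_const_pow_of_one_lt (R := ℝ)
      (2000 * (Module.finrank ℚ K + 1)) (r := 2) one_lt_two
    have h2 := h.def (c := 1 / 2) (by norm_num)
    filter_upwards [h2] with X hX
    simp only [norm_pow, Real.norm_natCast, Real.norm_ofNat] at hX
    have h3 : (0 : ℝ) < 2 ^ X := by positivity
    have : (X : ℝ) ^ (2000 * (Module.finrank ℚ K + 1)) < 2 ^ X := by linarith
    exact_mod_cast this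
  have hb0 := Filter.eventually_all.2 fun τ : K →+* ℂ =>
    hge (‖τ (algebraMap (NumberField.RingOfIntegers K) K s.b0)‖ + 1)
  have hb1 := Filter.eventually_all.2 fun τ : K →+* ℂ =>
    hge (‖τ (algebraMap (NumberField.RingOfIntegers K) K s.b1)‖ + 1)
  have hall := hb0.and (hb1.and ((hge' |s.u|).and ((hge' |s.v|).and
    ((hge (Real.exp (‖s.l1‖ + ‖s.l2‖))).and ((hge c).and ((hge (1 / δ)).and
    ((Filter.eventually_ge_atTop 800).and hexp)))))))
  obtain ⟨X, h1, h2, h3, h4, h5, h6, h7, h8, h9⟩ := hall.exists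
  refine ⟨X, h1, h2, h3, h4, h5, h6, ?_, h8, h9⟩
  rw [div_le_iff₀ hδ] at h7
  linarith

theorem contra_pow (X e n k : ℕ) (hX : 1 ≤ X) (h : X ^ e < 2 ^ X) (hn : n ≤ e) :
    (X : ℝ) ^ (n * X ^ k) < 2 ^ (X ^ (k + 1)) := by
  have h1 : (X : ℝ) ^ n < 2 ^ X := by
    have : X ^ n < 2 ^ X := (Nat.pow_le_pow_right hX hn).trans_lt h
    exact_mod_cast this
  have hpos : X ^ k ≠ 0 := pow_ne_zero _ (by omega)
  rw [pow_mul, pow_succ', pow_mul]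
  exact pow_lt_pow_left₀ h1 (by positivity) hpos


open NumberField in
theorem phi_eval {K : Type} [Field K] [NumberField K] (s : Setup K) (L L1 m0 m1 l : ℕ)
    (p : Fin L × (Fin L1 × Fin L) → 𝓞 K) :
    (s.v : ℂ) ^ (L * l) * phi (fun x => s.σ (algebraMap (𝓞 K) K (p x)))
      (s.σ (algebraMap (𝓞 K) K s.b0)) (s.σ (algebraMap (𝓞 K) K s.b1)) s.l1 s.l2 m0 m1 l =
    s.σ (algebraMap (𝓞 K) K (∑ x, p x * coef s.b0 s.b1 s.ε s.u s.v L L1 m0 m1 l x)) := by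
  rw [phi, Finset.mul_sum, map_sum, map_sum]
  refine Finset.sum_congr rfl fun x _ => ?_
  obtain ⟨i, j, k⟩ := x
  rw [map_mul, map_mul, map_coef, map_coef, coef]
  have h1 : (s.v : ℂ) ^ (L * l) * Complex.exp (freq s.l1 s.l2 (j, k) * l) =
      (s.ε : ℂ) ^ ((j : ℕ) * l) * ((s.u : ℂ) ^ ((k : ℕ) * l) *
        (s.v : ℂ) ^ ((L - (k : ℕ)) * l)) := by
    have h2 : Complex.exp (freq s.l1 s.l2 (j, k) * l) =
        Complex.exp s.l1 ^ ((j : ℕ) * l) * Complex.exp s.l2 ^ ((k : ℕ) * l) := by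
      rw [← Complex.exp_nat_mul, ← Complex.exp_nat_mul, ← Complex.exp_add]
      congr 1
      simp only [freq]
      push_cast
      ring
    have h3 : (s.v : ℂ) ^ (L * l) =
        (s.v : ℂ) ^ ((k : ℕ) * l) * (s.v : ℂ) ^ ((L - (k : ℕ)) * l) := by
      rw [← pow_add, ← add_mul, Nat.add_sub_cancel' k.2.le]
    rw [h2, h3, ← s.e1, ← s.e2, mul_pow]
    ring
  rw [← h1]
  simp only
  ring

open NumberField in
theorem house_le_of_forall {K : Type} [Field K] [NumberField K] (a : K) (H : ℝ)
    (h : ∀ τ : K →+* ℂ, ‖τ a‖ ≤ H) : house a ≤ H := by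
  rw [house_eq_sup']
  have h0 : 0 ≤ H := (norm_nonneg _).trans (h (Classical.arbitrary _))
  have : Finset.univ.sup' Finset.univ_nonempty (fun φ : K →+* ℂ ↦ ‖φ a‖₊) ≤ ⟨H, h0⟩ :=
    Finset.sup'_le _ _ fun τ _ => h τ
  exact this

open NumberField in
theorem step_bound {K : Type} [Field K] [NumberField K] (s : Setup K) (c δ : ℝ) (X : ℕ)
    (hbig : Big s c δ X) (L1 : ℕ) (hL1 : L1 ≤ X ^ 6)
    (p : Fin (X ^ 6) × (Fin L1 × Fin (X ^ 6)) → 𝓞 K)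
    (hp : ∀ x, house (algebraMap (𝓞 K) K (p x)) ≤ (X : ℝ) ^ (302 * X ^ 8)) (J : ℕ) (hJ : J ≤ 10)
    (hvan : ∀ m0 < (20 - J) * X ^ 8, ∀ m1 < (20 - J) * X ^ 8, ∀ l : ℕ, 1 ≤ l → l ≤ X ^ (J + 1) →
      phi (fun x => s.σ (algebraMap (𝓞 K) K (p x))) (s.σ (algebraMap (𝓞 K) K s.b0))
        (s.σ (algebraMap (𝓞 K) K s.b1)) s.l1 s.l2 m0 m1 l = 0)
    (m0 m1 : ℕ) (hm0 : m0 < (19 - J) * X ^ 8) (hm1 : m1 < (19 - J) * X ^ 8) (z : ℂ)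
    (hz : ‖z‖ ≤ (X : ℝ) ^ (J + 2)) :
    2 ^ (X ^ (J + 9)) * ‖phi (fun x => s.σ (algebraMap (𝓞 K) K (p x)))
      (s.σ (algebraMap (𝓞 K) K s.b0))
        (s.σ (algebraMap (𝓞 K) K s.b1)) s.l1 s.l2 m0 m1 z‖ ≤ (X : ℝ) ^ (618 * X ^ (J + 8)) := by
  have hX800 := hbig.h800
  have hX1 : (1 : ℝ) ≤ X := by exact_mod_cast (by omega : 1 ≤ X)
  have hm : ∀ m, m < (19 - J) * X ^ 8 → m + X ^ 8 ≤ (20 - J) * X ^ 8 := by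
    intro m hm
    have : 20 - J = (19 - J) + 1 := by omega
    rw [this, add_mul, one_mul]
    omega
  have hm' : ∀ m, m < (19 - J) * X ^ 8 → m ≤ 20 * X ^ 8 := by
    intro m hm
    refine hm.le.trans ?_
    gcongr
    omega
  set F := phi (fun x => s.σ (algebraMap (𝓞 K) K (p x))) (s.σ (algebraMap (𝓞 K) K s.b0))
        (s.σ (algebraMap (𝓞 K) K s.b1)) s.l1 s.l2 with hF
  have hder : ∀ a b z, HasDerivAt (F a b) (F (a + 1) b z + s.l1 * F a (b + 1) z) z :=
    fun a b z => hasDerivAt_phi _ _ _ _ _ s.rel a b z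
  have hsch := schwarz (F m0 m1) (fun z => (hder m0 m1 z).differentiableAt) (X ^ 8) (X ^ (J + 1))
    ((X : ℝ) ^ (J + 2)) ((X : ℝ) ^ (618 * X ^ (J + 8))) (by positivity)
    (by push_cast; exact pow_le_pow_right₀ hX1 (by omega))
    (fun l hl1 hl2 n hn => iteratedDeriv_family F s.l1 hder l _ _
      (fun a ha b hb => hvan a ha b hb l hl1 hl2) n m0 m1
      (by have := hm m0 hm0; omega) (by have := hm m1 hm1; omega))
    (by
      intro w hw
      refine (norm_phi_le X L1 _ _ _ _ _ m0 m1 (5 * X ^ (J + 2)) (302 * X ^ 8) (hbig.hb0 s.σ)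
        (hbig.hb1 s.σ) hbig.hl hL1 (hm' m0 hm0) (hm' m1 hm1) ?_ ?_ ?_ w ?_).trans ?_
      · have : 0 < X ^ (J + 2) := pow_pos (by omega) _
        omega
      · calc 5 * X ^ (J + 2) ≤ X * X ^ (J + 2) := by gcongr; omega
          _ = X ^ (J + 3) := by ring
          _ ≤ X ^ 13 := Nat.pow_le_pow_right (by omega) (by omega)
      · intro x
        exact (norm_embedding_le_house _ s.σ).trans (hp x)
      · push_cast
        exact hw
      · refine pow_le_pow_right₀ hX1 ?_
        have e1 : X ^ 6 * (5 * X ^ (J + 2)) = 5 * X ^ (J + 8) := by ring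
        have e2 : X ^ 8 ≤ X ^ (J + 8) := Nat.pow_le_pow_right (by omega) (by omega)
        have e3 : X ^ 6 ≤ X ^ (J + 8) := Nat.pow_le_pow_right (by omega) (by omega)
        have e4 : 1 ≤ X ^ (J + 8) := Nat.one_le_pow _ _ (by omega)
        rw [e1]
        omega)
    z hz
  have e5 : X ^ 8 * X ^ (J + 1) = X ^ (J + 9) := by ring
  rwa [e5] at hsch

open NumberField in
theorem step_arith {K : Type} [Field K] [NumberField K] (s : Setup K) (c δ : ℝ) (X : ℕ)
    (hbig : Big s c δ X) (L1 : ℕ) (hL1 : L1 ≤ X ^ 6)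
    (p : Fin (X ^ 6) × (Fin L1 × Fin (X ^ 6)) → 𝓞 K)
    (hp : ∀ x, house (algebraMap (𝓞 K) K (p x)) ≤ (X : ℝ) ^ (302 * X ^ 8)) (J : ℕ) (hJ : J ≤ 10)
    (hvan : ∀ m0 < (20 - J) * X ^ 8, ∀ m1 < (20 - J) * X ^ 8, ∀ l : ℕ, 1 ≤ l → l ≤ X ^ (J + 1) →
      phi (fun x => s.σ (algebraMap (𝓞 K) K (p x))) (s.σ (algebraMap (𝓞 K) K s.b0))
        (s.σ (algebraMap (𝓞 K) K s.b1)) s.l1 s.l2 m0 m1 l = 0)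
    (m0 m1 : ℕ) (hm0 : m0 < (19 - J) * X ^ 8) (hm1 : m1 < (19 - J) * X ^ 8) (l : ℕ)
    (hl1 : 1 ≤ l) (hl2 : l ≤ X ^ (J + 2)) :
    phi (fun x => s.σ (algebraMap (𝓞 K) K (p x)))
      (s.σ (algebraMap (𝓞 K) K s.b0))
        (s.σ (algebraMap (𝓞 K) K s.b1)) s.l1 s.l2 m0 m1 l = 0 := by
  have hX800 := hbig.h800
  have hX1 : (1 : ℝ) ≤ X := by exact_mod_cast (by omega : 1 ≤ X)
  have hm' : ∀ m, m < (19 - J) * X ^ 8 → m ≤ 20 * X ^ 8 := by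
    intro m hm
    refine hm.le.trans ?_
    gcongr
    omega
  have hb := step_bound s c δ X hbig L1 hL1 p hp J hJ hvan m0 m1 hm0 hm1 (l : ℂ) (by
    rw [Complex.norm_natCast]; exact_mod_cast hl2)
  have hev := phi_eval s (X ^ 6) L1 m0 m1 l p
  set φ := phi (fun x => s.σ (algebraMap (𝓞 K) K (p x)))
      (s.σ (algebraMap (𝓞 K) K s.b0))
        (s.σ (algebraMap (𝓞 K) K s.b1)) s.l1 s.l2 m0 m1 l with hφ
  set ξ : 𝓞 K := ∑ x, p x * coef s.b0 s.b1 s.ε s.u s.v (X ^ 6) L1 m0 m1 l x with hξ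
  by_contra hne
  have hv0 : (s.v : ℂ) ≠ 0 := by exact_mod_cast s.hv
  have hξ0 : ξ ≠ 0 := by
    intro h
    rw [h, map_zero, map_zero] at hev
    exact (mul_ne_zero (pow_ne_zero _ hv0) hne) hev
  have e1 : 1 ≤ X ^ (J + 8) := Nat.one_le_pow _ _ (by omega)
  have e2 : X ^ 8 ≤ X ^ (J + 8) := Nat.pow_le_pow_right (by omega) (by omega)
  have e3 : X ^ 6 ≤ X ^ (J + 8) := Nat.pow_le_pow_right (by omega) (by omega)
  have hhouse : house (algebraMap (𝓞 K) K ξ) ≤ (X : ℝ) ^ (613 * X ^ (J + 8)) := by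
    refine house_le_of_forall _ _ fun τ => ?_
    rw [hξ, map_sum, map_sum]
    have hterm : ∀ x, ‖τ (algebraMap (𝓞 K) K
        (p x * coef s.b0 s.b1 s.ε s.u s.v (X ^ 6) L1 m0 m1 l x))‖ ≤
        (X : ℝ) ^ (302 * X ^ 8) *
          (X : ℝ) ^ ((J + 2) * X ^ 6 + 280 * X ^ 8 + X ^ (6 + (J + 2))) := by
      intro x
      rw [map_mul, map_mul, map_coef, map_coef, norm_mul]
      gcongr
      · exact (norm_embedding_le_house _ τ).trans (hp x)
      · exact norm_coef_le X _ _ s.ε s.u s.v L1 m0 m1 l (J + 2) (hbig.hb0 τ) (hbig.hb1 τ) s.hε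
          hbig.hu hbig.hv hL1 (hm' m0 hm0) (hm' m1 hm1) hl1 hl2 x
    refine (norm_sum_le_of_le _ fun x _ => hterm x).trans ?_
    rw [Finset.sum_const, nsmul_eq_mul, Finset.card_univ]
    have hc : ((Fintype.card (Fin (X ^ 6) × (Fin L1 × Fin (X ^ 6))) : ℕ) : ℝ) ≤ (X : ℝ) ^ 18 := by
      simp only [Fintype.card_prod, Fintype.card_fin]
      have : X ^ 6 * (L1 * X ^ 6) ≤ X ^ 18 := by
        calc X ^ 6 * (L1 * X ^ 6) ≤ X ^ 6 * (X ^ 6 * X ^ 6) := by gcongr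
          _ = _ := by ring
      exact_mod_cast this
    calc _ ≤ (X : ℝ) ^ 18 * ((X : ℝ) ^ (302 * X ^ 8) *
          (X : ℝ) ^ ((J + 2) * X ^ 6 + 280 * X ^ 8 + X ^ (6 + (J + 2)))) := by gcongr
      _ = (X : ℝ) ^ (18 + (302 * X ^ 8 + ((J + 2) * X ^ 6 + 280 * X ^ 8 + X ^ (6 + (J + 2))))) := by
        rw [← pow_add, ← pow_add]
      _ ≤ _ := by
        refine pow_le_pow_right₀ hX1 ?_
        have e4 : X ^ (6 + (J + 2)) = X ^ (J + 8) := by congr 1; ring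
        have e5 : (J + 2) * X ^ 6 ≤ 12 * X ^ 6 := by gcongr; omega
        rw [e4]
        omega
  have hL := liouville K s.σ ξ hξ0 _ hhouse
  rw [← hev, norm_mul, norm_pow] at hL
  set d := Module.finrank ℚ K with hd
  have hv' : ‖(s.v : ℂ)‖ ≤ X := by
    rw [Complex.norm_intCast]; exact_mod_cast hbig.hv
  have hvp : ‖(s.v : ℂ)‖ ^ (X ^ 6 * l) ≤ (X : ℝ) ^ (X ^ (J + 8)) := by
    calc _ ≤ (X : ℝ) ^ (X ^ 6 * l) := by gcongr
      _ ≤ _ := by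
        refine pow_le_pow_right₀ hX1 ?_
        calc X ^ 6 * l ≤ X ^ 6 * X ^ (J + 2) := by gcongr
          _ = _ := by ring
  have h2pos : (0 : ℝ) < 2 ^ (X ^ (J + 9)) := by positivity
  have hfinal : (2 : ℝ) ^ (X ^ (J + 9)) ≤ (X : ℝ) ^ ((619 + 613 * d) * X ^ (J + 8)) := by
    calc (2 : ℝ) ^ (X ^ (J + 9)) = 2 ^ (X ^ (J + 9)) * 1 := by ring
      _ ≤ 2 ^ (X ^ (J + 9)) * (‖(s.v : ℂ)‖ ^ (X ^ 6 * l) * ‖φ‖ *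
          ((X : ℝ) ^ (613 * X ^ (J + 8))) ^ d) := by gcongr
      _ = ‖(s.v : ℂ)‖ ^ (X ^ 6 * l) * (2 ^ (X ^ (J + 9)) * ‖φ‖) *
          ((X : ℝ) ^ (613 * X ^ (J + 8))) ^ d := by ring
      _ ≤ (X : ℝ) ^ (X ^ (J + 8)) * (X : ℝ) ^ (618 * X ^ (J + 8)) *
          ((X : ℝ) ^ (613 * X ^ (J + 8))) ^ d := by gcongr
      _ = _ := by
        rw [← pow_mul, ← pow_add, ← pow_add]
        congr 1
        ring
  have := contra_pow X _ (619 + 613 * d) (J + 8) (by omega) hbig.hexp (by omega)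
  exact absurd hfinal (not_le.2 this)

open NumberField in
theorem machine {K : Type} [Field K] [NumberField K] (s : Setup K) (c δ : ℝ) (X : ℕ)
    (hbig : Big s c δ X) (hδ0 : 0 < δ) (hδ1 : δ ≤ 1) (L1 : ℕ) (hL1 : L1 ≤ X ^ 6)
    (p : Fin (X ^ 6) × (Fin L1 × Fin (X ^ 6)) → 𝓞 K) (hp0 : p ≠ 0)
    (hp : ∀ x, house (algebraMap (𝓞 K) K (p x)) ≤ (X : ℝ) ^ (302 * X ^ 8))
    (hsep : ∀ x y : Fin L1 × Fin (X ^ 6), x ≠ y → δ ≤ ‖freq s.l1 s.l2 x - freq s.l1 s.l2 y‖)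
    (hvan : ∀ m0 < 20 * X ^ 8, ∀ m1 < 20 * X ^ 8, ∀ l : ℕ, 1 ≤ l → l ≤ X →
      phi (fun x => s.σ (algebraMap (𝓞 K) K (p x))) (s.σ (algebraMap (𝓞 K) K s.b0))
        (s.σ (algebraMap (𝓞 K) K s.b1)) s.l1 s.l2 m0 m1 l = 0) : False := by
  have hX800 := hbig.h800
  have hX1 : (1 : ℝ) ≤ X := by exact_mod_cast (by omega : 1 ≤ X)
  have hall : ∀ J ≤ 10, ∀ m0 < (20 - J) * X ^ 8, ∀ m1 < (20 - J) * X ^ 8, ∀ l : ℕ, 1 ≤ l →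
      l ≤ X ^ (J + 1) →
      phi (fun x => s.σ (algebraMap (𝓞 K) K (p x))) (s.σ (algebraMap (𝓞 K) K s.b0))
        (s.σ (algebraMap (𝓞 K) K s.b1)) s.l1 s.l2 m0 m1 l = 0 := by
    intro J
    induction J with
    | zero => intro _; simpa using hvan
    | succ J ih =>
      intro hJ m0 hm0 m1 hm1 l hl1 hl2
      have e : 20 - (J + 1) = 19 - J := by omega
      rw [e] at hm0 hm1
      exact step_arith s c δ X hbig L1 hL1 p hp J (by omega) (ih (by omega)) m0 m1 hm0 hm1 l hl1 hl2
  have h8 : 0 < X ^ 8 := pow_pos (by omega) _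
  have hb := fun (z : ℂ) (hz : ‖z‖ ≤ 1) =>
    step_bound s c δ X hbig L1 hL1 p hp 10 le_rfl (hall 10 le_rfl) 0 0 (by omega) (by omega) z
    (hz.trans (one_le_pow₀ hX1))
  have h2pos : (0 : ℝ) < 2 ^ (X ^ 19) := by positivity
  set M : ℝ := (X : ℝ) ^ (618 * X ^ 18) / 2 ^ (X ^ 19) with hM
  set d := Module.finrank ℚ K with hd
  obtain ⟨x, hx0, hx⟩ := lower_bound (X ^ 6) (X ^ 18) (fun y => freq s.l1 s.l2 y)
    (fun x => s.σ (algebraMap (𝓞 K) K (p x))) δ ((X : ℝ) ^ 7) M hδ0.le hδ1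
    (fun y => (norm_freq_le X s.l1 s.l2 L1 hL1 y).trans (by
      have h1 : ‖s.l1‖ + ‖s.l2‖ ≤ X := by
        have := Real.add_one_le_exp (‖s.l1‖ + ‖s.l2‖)
        have := hbig.hl
        linarith
      calc (X : ℝ) ^ 6 * (‖s.l1‖ + ‖s.l2‖) ≤ (X : ℝ) ^ 6 * X := by gcongr
        _ = _ := by ring))
    hsep
    (by
      simp only [Fintype.card_prod, Fintype.card_fin]
      calc X ^ 6 * (L1 * X ^ 6) ≤ X ^ 6 * (X ^ 6 * X ^ 6) := by gcongr
        _ = _ := by ring)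
    (Nat.one_le_pow _ _ (by omega))
    (by
      intro h
      apply hp0
      ext x
      have := congrFun h x
      simpa using this)
    (by
      intro z hz
      have h1 := hb z hz
      rw [hM, le_div_iff₀ h2pos, mul_comm]
      refine le_trans (le_of_eq ?_) h1
      congr 2
      rw [phi]
      refine Finset.sum_congr rfl fun x _ => ?_
      simp only [pow_zero, one_mul, PP]
      ring)
  have hpx : p x ≠ 0 := by
    intro h; apply hx0; simp [h]
  have hL := liouville K s.σ (p x) hpx _ (hp x)
  rw [← hd] at hL
  have hδX : 1 ≤ (δ * X) ^ (X ^ 18) := one_le_pow₀ hbig.hδ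
  have hNV : ((X ^ 18 : ℕ) : ℝ) + (X : ℝ) ^ 7 ≤ (X : ℝ) ^ 19 := by
    have h2 : (2 : ℝ) ≤ X := by exact_mod_cast (by omega : 2 ≤ X)
    have h3 : (X : ℝ) ^ 7 ≤ (X : ℝ) ^ 18 := pow_le_pow_right₀ hX1 (by norm_num)
    push_cast
    calc (X : ℝ) ^ 18 + (X : ℝ) ^ 7 ≤ 2 * (X : ℝ) ^ 18 := by linarith
      _ ≤ X * (X : ℝ) ^ 18 := by gcongr
      _ = _ := by ring
  have e2 : X ^ 8 ≤ X ^ 18 := Nat.pow_le_pow_right (by omega) (by omega)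
  have hM0 : 0 ≤ M := by positivity
  have h1 : (1 : ℝ) ≤ M * (X : ℝ) ^ ((20 + 302 * d) * X ^ 18) := by
    calc (1 : ℝ) ≤ (δ * X) ^ (X ^ 18) * (‖s.σ (algebraMap (𝓞 K) K (p x))‖ *
          ((X : ℝ) ^ (302 * X ^ 8)) ^ d) := one_le_mul_of_one_le_of_one_le hδX hL
      _ = (δ ^ (X ^ 18) * ‖s.σ (algebraMap (𝓞 K) K (p x))‖) * ((X : ℝ) ^ (X ^ 18) *
          ((X : ℝ) ^ (302 * X ^ 8)) ^ d) := by rw [mul_pow]; ring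
      _ ≤ (M * (((X ^ 18 : ℕ) : ℝ) + (X : ℝ) ^ 7) ^ (X ^ 18)) * ((X : ℝ) ^ (X ^ 18) *
          ((X : ℝ) ^ (302 * X ^ 8)) ^ d) := by gcongr
      _ ≤ (M * ((X : ℝ) ^ 19) ^ (X ^ 18)) * ((X : ℝ) ^ (X ^ 18) *
          ((X : ℝ) ^ (302 * X ^ 18)) ^ d) := by
        gcongr
      _ = _ := by
        rw [mul_assoc, ← pow_mul, ← pow_mul, ← pow_add, ← pow_add]
        congr 2
        ring
  have h2 : (2 : ℝ) ^ (X ^ 19) ≤ (X : ℝ) ^ ((638 + 302 * d) * X ^ 18) := by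
    rw [hM, div_mul_eq_mul_div, le_div_iff₀ h2pos, one_mul, ← pow_add] at h1
    refine h1.trans (le_of_eq ?_)
    congr 1
    ring
  have := contra_pow X _ (638 + 302 * d) 18 (by omega) hbig.hexp (by omega)
  exact absurd h2 (not_le.2 this)


open NumberField in
theorem exists_aux {K : Type} [Field K] [NumberField K] (s : Setup K) (δ : ℝ) (hδ : 0 < δ) :
    ∃ c X, Big s c δ X ∧ ∀ L1 M1 : ℕ, L1 ≤ X ^ 6 → 1 ≤ M1 → M1 ≤ 20 * X ^ 8 →
      2 * (20 * X ^ 8 * (M1 * X)) ≤ X ^ 6 * (L1 * X ^ 6) →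
      ∃ p : Fin (X ^ 6) × (Fin L1 × Fin (X ^ 6)) → 𝓞 K, p ≠ 0 ∧
        (∀ x, house (algebraMap (𝓞 K) K (p x)) ≤ (X : ℝ) ^ (302 * X ^ 8)) ∧
        ∀ m0 < 20 * X ^ 8, ∀ m1 < M1, ∀ l : ℕ, 1 ≤ l → l ≤ X →
          phi (fun x => s.σ (algebraMap (𝓞 K) K (p x))) (s.σ (algebraMap (𝓞 K) K s.b0))
            (s.σ (algebraMap (𝓞 K) K s.b1)) s.l1 s.l2 m0 m1 l = 0 := by
  obtain ⟨c, hc1, hc⟩ := siegel K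
  obtain ⟨X, hbig⟩ := eventually_big s c δ hδ
  refine ⟨c, X, hbig, ?_⟩
  intro L1 M1 hL1 hM1 hM1' hcount
  have hX800 := hbig.h800
  have hX1 : (1 : ℝ) ≤ X := by exact_mod_cast (by omega : 1 ≤ X)
  have hXpos : 0 < X := by omega
  have hle : X ^ 6 + 280 * X ^ 8 + X ^ 7 ≤ 282 * X ^ 8 := by
    have h6 : X ^ 6 ≤ X ^ 8 := Nat.pow_le_pow_right hXpos (by norm_num)
    have h7 : X ^ 7 ≤ X ^ 8 := Nat.pow_le_pow_right hXpos (by norm_num)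
    omega
  obtain ⟨p, hp0, hp, hpb⟩ := hc (Fin (20 * X ^ 8) × (Fin M1 × Fin X))
    (Fin (X ^ 6) × (Fin L1 × Fin (X ^ 6)))
    (fun r x => coef s.b0 s.b1 s.ε s.u s.v (X ^ 6) L1 r.1 r.2.1 ((r.2.2 : ℕ) + 1) x)
    ((X : ℝ) ^ (282 * X ^ 8))
    (by simp only [Fintype.card_prod, Fintype.card_fin]; positivity)
    (by simpa only [Fintype.card_prod, Fintype.card_fin] using hcount)
    (one_le_pow₀ hX1)
    (by
      intro r x
      refine house_le_of_forall _ _ fun τ => ?_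
      rw [map_coef, map_coef]
      refine (norm_coef_le X _ _ s.ε s.u s.v L1 _ _ _ 1 (hbig.hb0 τ) (hbig.hb1 τ) s.hε hbig.hu
        hbig.hv hL1 r.1.2.le (r.2.1.2.le.trans hM1') (by omega) (by have := r.2.2.2; rw [pow_one]; omega)
        x).trans ?_
      refine pow_le_pow_right₀ hX1 ?_
      simpa using hle)
  refine ⟨p, hp0, fun x => (hpb x).trans ?_, ?_⟩
  · have hcX := hbig.hc
    have hcard : (Fintype.card (Fin (X ^ 6) × (Fin L1 × Fin (X ^ 6))) : ℝ) ≤ (X : ℝ) ^ 18 := by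
      simp only [Fintype.card_prod, Fintype.card_fin]
      have : X ^ 6 * (L1 * X ^ 6) ≤ X ^ 6 * (X ^ 6 * X ^ 6) := by gcongr
      calc ((X ^ 6 * (L1 * X ^ 6) : ℕ) : ℝ) ≤ ((X ^ 6 * (X ^ 6 * X ^ 6) : ℕ) : ℝ) := by
            exact_mod_cast this
        _ = _ := by push_cast; ring
    have hc0 : 0 ≤ c := by linarith
    have h8 : 1 ≤ X ^ 8 := Nat.one_le_pow _ _ hXpos
    calc _ ≤ (X : ℝ) * (X * (X : ℝ) ^ 18 * (X : ℝ) ^ (282 * X ^ 8)) := by gcongr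
      _ = (X : ℝ) ^ (20 + 282 * X ^ 8) := by ring
      _ ≤ _ := pow_le_pow_right₀ hX1 (by omega)
  · intro m0 hm0 m1 hm1 l hl1 hl2
    have h := congrFun hp (⟨m0, hm0⟩, (⟨m1, hm1⟩, ⟨l - 1, by omega⟩))
    have hl : l - 1 + 1 = l := by omega
    simp only [Matrix.mulVec, dotProduct, hl, Pi.zero_apply] at h
    have h2 := phi_eval s (X ^ 6) L1 m0 m1 l p
    simp only [mul_comm (p _)] at h2
    rw [h, map_zero, map_zero] at h2
    refine (mul_eq_zero.mp h2).resolve_left (pow_ne_zero _ ?_)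
    exact_mod_cast s.hv

/-- The main contradiction when the two logarithms are independent. -/
theorem no_main {K : Type} [Field K] [NumberField K] (s : Setup K) (δ : ℝ) (hδ : 0 < δ)
    (hδ1 : δ ≤ 1) (hsep : ∀ j k j' k' : ℕ, (j, k) ≠ (j', k') →
      δ ≤ ‖((j : ℂ) * s.l1 + (k : ℂ) * s.l2) - ((j' : ℂ) * s.l1 + (k' : ℂ) * s.l2)‖) : False := by
  obtain ⟨c, X, hbig, h⟩ := exists_aux s δ hδ
  have hX800 := hbig.h800
  obtain ⟨p, hp0, hp, hv⟩ := h (X ^ 6) (20 * X ^ 8) le_rfl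
    (by have := Nat.one_le_pow 8 X (by omega); omega) le_rfl
    (by
      calc 2 * (20 * X ^ 8 * (20 * X ^ 8 * X)) = 800 * X ^ 17 := by ring
        _ ≤ X * X ^ 17 := by gcongr
        _ = _ := by ring)
  refine machine s c δ X hbig hδ hδ1 (X ^ 6) le_rfl p hp0 hp ?_ hv
  intro x y hxy
  refine hsep _ _ _ _ fun h => hxy ?_
  rw [Prod.mk.injEq] at h
  exact Prod.ext (Fin.ext h.1) (Fin.ext h.2)

/-- The contradiction in the one-logarithm case. -/
theorem no_single {K : Type} [Field K] [NumberField K] (s : Setup K) (hb1 : s.b1 = 0)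
    (hl2 : s.l2 ≠ 0) : False := by
  have hn : 0 < ‖s.l2‖ := norm_pos_iff.mpr hl2
  have hδ : 0 < min 1 ‖s.l2‖ := lt_min one_pos hn
  obtain ⟨c, X, hbig, h⟩ := exists_aux s (min 1 ‖s.l2‖) hδ
  have hX800 := hbig.h800
  have hX6 : 1 ≤ X ^ 6 := Nat.one_le_pow 6 X (by omega)
  obtain ⟨p, hp0, hp, hv⟩ := h 1 1 hX6 le_rfl
    (by have := Nat.one_le_pow 8 X (by omega); omega)
    (by
      calc 2 * (20 * X ^ 8 * (1 * X)) = 40 * X ^ 9 := by ring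
        _ ≤ X * X ^ 9 := by gcongr; omega
        _ = X ^ 10 := by ring
        _ ≤ X ^ 12 := Nat.pow_le_pow_right (by omega) (by norm_num)
        _ = _ := by ring)
  refine machine s c _ X hbig hδ (min_le_left _ _) 1 hX6 p hp0 hp ?_ ?_
  · intro x y hxy
    obtain ⟨x1, x2⟩ := x
    obtain ⟨y1, y2⟩ := y
    have h1 : x1 = y1 := Subsingleton.elim _ _
    subst h1
    have h2 : ((x2 : ℕ) : ℤ) - ((y2 : ℕ) : ℤ) ≠ 0 := by
      intro h
      apply hxy
      have : x2 = y2 := Fin.ext (by omega)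
      rw [this]
    have h3 : (1 : ℝ) ≤ |(((x2 : ℕ) : ℤ) - ((y2 : ℕ) : ℤ) : ℤ)| := by
      exact_mod_cast Int.one_le_abs h2
    have h4 : freq s.l1 s.l2 (x1, x2) - freq s.l1 s.l2 (x1, y2) =
        ((((x2 : ℕ) : ℤ) - ((y2 : ℕ) : ℤ) : ℤ) : ℂ) * s.l2 := by
      simp only [freq]; push_cast; ring
    rw [h4, norm_mul, Complex.norm_intCast]
    refine (min_le_right _ _).trans ?_
    push_cast at h3 ⊢
    nlinarith
  · intro m0 hm0 m1 hm1 l hl1 hl2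
    rcases Nat.eq_zero_or_pos m1 with rfl | hpos
    · exact hv m0 hm0 0 one_pos l hl1 hl2
    · rw [phi]
      refine Finset.sum_eq_zero fun x _ => ?_
      have : (x.2.1 : ℕ) = 0 := by have := x.2.1.2; omega
      rw [this, hb1]
      simp [hpos.ne']

open NumberField in
theorem exists_setup (B0 B1 l1 l2 : ℂ) (ε u v : ℤ) (h0 : IsIntegral ℤ B0) (h1 : IsIntegral ℤ B1)
    (hε : |ε| = 1) (hv : v ≠ 0) (e1 : Complex.exp l1 = ε) (e2 : Complex.exp l2 * v = u)
    (rel : l2 = B0 + B1 * l1) :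
    ∃ (K : Type) (_ : Field K) (_ : NumberField K) (s : Setup K),
      s.l1 = l1 ∧ s.l2 = l2 ∧ (B1 = 0 → s.b1 = 0) := by
  let E := IntermediateField.adjoin ℚ ({B0, B1} : Set ℂ)
  have hfin : FiniteDimensional ℚ E := by
    refine IntermediateField.finiteDimensional_adjoin fun x hx => ?_
    rcases hx with rfl | hx
    · exact h0.tower_top
    · rw [Set.mem_singleton_iff] at hx
      rw [hx]
      exact h1.tower_top
  have hN : NumberField E := { to_charZero := inferInstance, to_finiteDimensional := hfin }
  have m0 : B0 ∈ E := IntermediateField.subset_adjoin _ _ (by simp)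
  have m1 : B1 ∈ E := IntermediateField.subset_adjoin _ _ (by simp)
  have hi : Function.Injective (algebraMap E ℂ) := (algebraMap E ℂ).injective
  have i0 : IsIntegral ℤ (⟨B0, m0⟩ : E) := (isIntegral_algebraMap_iff hi).mp h0
  have i1 : IsIntegral ℤ (⟨B1, m1⟩ : E) := (isIntegral_algebraMap_iff hi).mp h1
  refine ⟨E, inferInstance, hN,
    { σ := algebraMap E ℂ
      b0 := ⟨⟨B0, m0⟩, i0⟩
      b1 := ⟨⟨B1, m1⟩, i1⟩
      ε := ε, u := u, v := v, l1 := l1, l2 := l2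
      hε := hε, hv := hv, e1 := e1, e2 := e2, rel := rel }, rfl, rfl, ?_⟩
  rintro rfl
  rfl

/-- A special case of the Hermite-Lindemann theorem. -/
theorem hermite_lindemann (b : ℂ) (hb : IsAlgebraic ℚ b) (u v : ℤ) (hv : v ≠ 0)
    (he : Complex.exp b * v = u) : b = 0 := by
  by_contra hne
  have hb' : IsAlgebraic ℤ b := (IsFractionRing.isAlgebraic_iff ℤ ℚ ℂ).mpr hb
  obtain ⟨D, hD, hDint⟩ := hb'.exists_integral_multiple
  have hD2 : IsIntegral ℤ ((D.natAbs : ℂ) * b) := by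
    have h1 : IsIntegral ℤ ((D.sign • (D • b)) : ℂ) := hDint.smul _
    rw [smul_smul, Int.sign_mul_self_eq_abs, zsmul_eq_mul] at h1
    rw [Int.abs_eq_natAbs] at h1
    simpa using h1
  obtain ⟨K, _, _, s, hs1, hs2, hs3⟩ := exists_setup ((D.natAbs : ℂ) * b) 0 0
    ((D.natAbs : ℂ) * b) 1 (u ^ D.natAbs) (v ^ D.natAbs) hD2 isIntegral_zero (by simp)
    (pow_ne_zero _ hv) (by simp) (by
      rw [Complex.exp_nat_mul]; push_cast; rw [← mul_pow, he]) (by simp)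
  refine no_single s (hs3 rfl) ?_
  rw [hs2]
  refine mul_ne_zero ?_ hne
  exact_mod_cast Int.natAbs_ne_zero.mpr hD

theorem key_int (a : ℤ) (q : ℚ) (hq : 0 < q) (h : IsAlgebraic ℚ (a * Real.pi + Real.log q)) :
    a * Real.pi + Real.log q = 0 := by
  have hqR : (0 : ℝ) < q := by exact_mod_cast hq
  have hden : (q.den : ℤ) ≠ 0 := by exact_mod_cast q.den_nz
  have hqd : (q : ℂ) * (q.den : ℂ) = q.num := by exact_mod_cast Rat.mul_den_eq_num q
  have hexpq : Complex.exp (Real.log q : ℝ) = q := by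
    rw [← Complex.ofReal_exp, Real.exp_log hqR]; simp
  have hC : IsAlgebraic ℚ (((a * Real.pi + Real.log q : ℝ)) : ℂ) := h.algebraMap
  by_cases ha : a = 0
  · subst ha
    simp only [Int.cast_zero, zero_mul, zero_add] at hC ⊢
    have := hermite_lindemann _ hC q.num q.den hden (by rw [hexpq]; exact_mod_cast hqd)
    exact_mod_cast this
  by_cases hlq : Real.log q = 0
  · exfalso
    rw [hlq, add_zero] at hC
    have hI : IsAlgebraic ℚ (2 * Complex.I) := by
      refine IsIntegral.isAlgebraic ?_
      have h2 : IsIntegral ℚ (2 : ℂ) := by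
        exact_mod_cast (isIntegral_algebraMap (R := ℚ) (A := ℂ) (x := 2))
      exact h2.mul (Complex.isIntegral_rat_I)
    have := hermite_lindemann _ (hC.mul hI) 1 1 one_ne_zero (by
      have : (((a * Real.pi : ℝ)) : ℂ) * (2 * Complex.I) = a * (2 * Real.pi * Complex.I) := by
        push_cast; ring
      rw [this, Complex.exp_int_mul_two_pi_mul_I]; simp)
    simp [ha, Real.pi_ne_zero] at this
  exfalso
  have hb' : IsAlgebraic ℤ (((a * Real.pi + Real.log q : ℝ)) : ℂ) :=
    (IsFractionRing.isAlgebraic_iff ℤ ℚ ℂ).mpr hC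
  obtain ⟨D, hD, hDint⟩ := hb'.exists_integral_multiple
  set β : ℝ := a * Real.pi + Real.log q with hβ
  set n := D.natAbs with hn
  have hn0 : n ≠ 0 := Int.natAbs_ne_zero.mpr hD
  have hD2 : IsIntegral ℤ ((n : ℂ) * β) := by
    have h1 : IsIntegral ℤ ((D.sign • (D • (β : ℂ))) : ℂ) := hDint.smul _
    rw [smul_smul, Int.sign_mul_self_eq_abs, zsmul_eq_mul] at h1
    rw [Int.abs_eq_natAbs, ← hn] at h1
    simpa using h1
  have hII : IsIntegral ℤ Complex.I := Complex.isIntegral_int_I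
  have hB1 : IsIntegral ℤ (((n : ℤ) * a : ℤ) * Complex.I) := by
    have : IsIntegral ℤ ((((n : ℤ) * a : ℤ)) : ℂ) := isIntegral_algebraMap
    exact this.mul hII
  obtain ⟨K, _, _, s, hs1, hs2, hs3⟩ := exists_setup ((n : ℂ) * β)
    (((n : ℤ) * a : ℤ) * Complex.I) (Real.pi * Complex.I)
    ((n : ℂ) * (Real.log q : ℝ)) (-1) (q.num ^ n) ((q.den : ℤ) ^ n) hD2 hB1 (by simp)
    (pow_ne_zero _ hden) (by simp) (by
      rw [Complex.exp_nat_mul, hexpq]; push_cast; rw [← mul_pow, hqd]) (by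
      rw [hβ]; push_cast
      linear_combination (-(n : ℂ) * a * Real.pi) * Complex.I_mul_I)
  have hpos : 0 < |Real.log q| := abs_pos.mpr hlq
  refine no_main s (min 1 |Real.log q|) (lt_min one_pos hpos) (min_le_left _ _) ?_
  intro j k j' k' hne
  rw [hs1, hs2]
  have e : ((j : ℂ) * (Real.pi * Complex.I) + (k : ℂ) * ((n : ℂ) * (Real.log q : ℝ))) -
      ((j' : ℂ) * (Real.pi * Complex.I) + (k' : ℂ) * ((n : ℂ) * (Real.log q : ℝ))) =
      (((((k : ℤ) - k') * n : ℤ) * Real.log q : ℝ) : ℂ) +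
        (((((j : ℤ) - j' : ℤ) : ℝ) * Real.pi : ℝ) : ℂ) * Complex.I := by
    push_cast; ring
  rw [e]
  set x : ℝ := (((k : ℤ) - k') * n : ℤ) * Real.log q with hx
  set y : ℝ := (((j : ℤ) - j' : ℤ) : ℝ) * Real.pi with hy
  by_cases hk : k = k'
  · have hj : ((j : ℤ) - j') ≠ 0 := by
      intro hj
      apply hne
      rw [hk, show j = j' by omega]
    have h1 : (1 : ℝ) ≤ |(((j : ℤ) - j' : ℤ) : ℝ)| := by exact_mod_cast Int.one_le_abs hj
    have h2 := Complex.abs_im_le_norm ((x : ℂ) + (y : ℂ) * Complex.I)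
    have h3 : ((x : ℂ) + (y : ℂ) * Complex.I).im = y := by simp
    rw [h3] at h2
    refine (min_le_left _ _).trans (le_trans ?_ h2)
    rw [hy, abs_mul, abs_of_pos Real.pi_pos]
    nlinarith [Real.pi_gt_three]
  · have hj : (((k : ℤ) - k') * n) ≠ 0 := by
      refine mul_ne_zero (by omega) (by exact_mod_cast hn0)
    have h1 : (1 : ℝ) ≤ |((((k : ℤ) - k') * n : ℤ) : ℝ)| := by exact_mod_cast Int.one_le_abs hj
    have h2 := Complex.abs_re_le_norm ((x : ℂ) + (y : ℂ) * Complex.I)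
    have h3 : ((x : ℂ) + (y : ℂ) * Complex.I).re = x := by simp
    rw [h3] at h2
    refine (min_le_right _ _).trans (le_trans ?_ h2)
    rw [hx, abs_mul]
    nlinarith

end BakerPi

/-- **First part of Corollary 7.** For a fixed positive integer `n`, the set of values
`(1/2)(r₁(K)·π/2 + n·(log(8π)+γ) − log|d_K|)` over number fields `K` of degree `n`
contains at most one algebraic number. -/
theorem subsingleton_algebraic_zeta_log_deriv (n : ℕ) (hn : 0 < n) :
    {x : ℝ | IsAlgebraic ℚ x ∧ ∃ (K : Type) (hF : Field K) (hN : @NumberField K hF),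
      @degreeOverQ K hF hN = n ∧ x = @zetaLogDerivHalf K hF hN}.Subsingleton := by
  rintro x ⟨hx, K, hF, hN, hdeg, hxe⟩ y ⟨hy, L, hF', hN', hdeg', hye⟩
  have hd : (NumberField.discr K : ℝ) ≠ 0 := by exact_mod_cast NumberField.discr_ne_zero K
  have hd' : (NumberField.discr L : ℝ) ≠ 0 := by exact_mod_cast NumberField.discr_ne_zero L
  have hdq : NumberField.discr K ≠ 0 := NumberField.discr_ne_zero K
  have hdq' : NumberField.discr L ≠ 0 := NumberField.discr_ne_zero L
  have hpos : (0 : ℚ) < ((NumberField.discr L : ℚ) / NumberField.discr K) ^ 2 := by positivity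
  have hlog : Real.log ((((NumberField.discr L : ℚ) / NumberField.discr K) ^ 2 : ℚ) : ℝ) =
      2 * (Real.log |(NumberField.discr L : ℝ)| - Real.log |(NumberField.discr K : ℝ)|) := by
    push_cast
    rw [Real.log_pow, Real.log_div hd' hd, Real.log_abs, Real.log_abs]
    norm_num
  have e : 4 * (x - y) = (((NumberField.InfinitePlace.nrRealPlaces K : ℤ) -
      (NumberField.InfinitePlace.nrRealPlaces L : ℤ) : ℤ) : ℝ) * Real.pi +
      Real.log ((((NumberField.discr L : ℚ) / NumberField.discr K) ^ 2 : ℚ) : ℝ) := by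
    rw [hlog, hxe, hye]
    unfold degreeOverQ at hdeg hdeg'
    unfold zetaLogDerivHalf
    rw [hdeg, hdeg']
    push_cast
    ring
  have h4 : IsAlgebraic ℚ (4 * (x - y)) := by
    have : IsAlgebraic ℚ (4 : ℝ) := by exact_mod_cast isAlgebraic_natCast (R := ℚ) (A := ℝ) 4
    exact this.mul (hx.sub hy)
  rw [e] at h4
  have := BakerPi.key_int _ _ hpos h4
  rw [← e] at this
  linarith
end

section
/- For every number field K, the real number r₁(K)·π/4 − (1/2)·log|d_K| is transcendental. (This is the key step of the second part of Corollary 7: it equals ζ_K'(1/2)/ζ_K(1/2) − (n/2)(log(8π)+γ) whenever ζ_K(1/2) ≠ 0, where n = [K:ℚ].) -/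
/-- `bA c x m n` is the value at `x` of `(D + c)^m X^n`. -/
def bA {R : Type*} [CommRing R] (c x : R) : ℕ → ℕ → R
  | 0, n => x ^ n
  | m + 1, n => (n : R) * bA c x m (n - 1) + c * bA c x m n

theorem bA_map {R S : Type*} [CommRing R] [CommRing S] (f : R →+* S) (c x : R) (m n : ℕ) :
    f (bA c x m n) = bA (f c) (f x) m n := by
  induction m generalizing n with
  | zero => simp [bA]
  | succ m ih => simp [bA, ih]

theorem bA_norm (c x : ℂ) (R B : ℝ) (hR : 1 ≤ R) (hx : ‖x‖ ≤ R) (hB : ‖c‖ ≤ B) (m n : ℕ) :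
    ‖bA c x m n‖ ≤ R ^ n * (n + B) ^ m := by
  have hB0 : 0 ≤ B := (norm_nonneg _).trans hB
  induction m generalizing n with
  | zero => simpa [bA] using pow_le_pow_left₀ (norm_nonneg x) hx n
  | succ m ih =>
    have h1 : ‖bA c x m (n - 1)‖ ≤ R ^ n * (n + B) ^ m := by
      refine (ih (n - 1)).trans ?_
      have : ((n - 1 : ℕ) : ℝ) ≤ n := by exact_mod_cast Nat.sub_le n 1
      gcongr
      omega
    have h2 := ih n
    calc ‖bA c x (m + 1) n‖ ≤ n * ‖bA c x m (n - 1)‖ + ‖c‖ * ‖bA c x m n‖ := by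
          simp only [bA]
          refine (norm_add_le _ _).trans ?_
          simp
      _ ≤ n * (R ^ n * (n + B) ^ m) + B * (R ^ n * (n + B) ^ m) := by gcongr
      _ = _ := by ring

theorem bA_hasDerivAt (c z : ℂ) (m n : ℕ) :
    HasDerivAt (fun x => bA c x m n) ((n : ℂ) * bA c z m (n - 1)) z := by
  induction m generalizing n with
  | zero => simpa [bA] using hasDerivAt_pow n z
  | succ m ih =>
    simp only [bA]
    have := ((ih (n - 1)).const_mul (n : ℂ)).add ((ih n).const_mul c)
    refine HasDerivAt.congr_deriv this ?_
    ring

open Polynomial in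
theorem bA_poly {R : Type*} [CommRing R] (c : R) (m n : ℕ) :
    (bA (C c) (X : R[X]) m n).natDegree ≤ n ∧ (bA (C c) (X : R[X]) m n).coeff n = c ^ m := by
  induction m generalizing n with
  | zero => simp [bA, natDegree_X_pow_le]
  | succ m ih =>
    obtain ⟨h1, h2⟩ := ih n
    obtain ⟨h3, h4⟩ := ih (n - 1)
    constructor
    · simp only [bA]
      refine (natDegree_add_le _ _).trans (max_le ?_ ?_)
      · rw [← map_natCast (C : R →+* R[X]) n]
        exact (natDegree_C_mul_le _ _).trans (h3.trans (by omega))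
      · exact (natDegree_C_mul_le _ _).trans h1
    · simp only [bA]
      rw [← map_natCast (C : R →+* R[X]) n, coeff_add, coeff_C_mul, coeff_C_mul, h2]
      rcases Nat.eq_zero_or_pos n with rfl | hn
      · simp [pow_succ, mul_comm]
      · rw [coeff_eq_zero_of_natDegree_lt (lt_of_le_of_lt h3 (by omega))]
        simp [pow_succ, mul_comm]

open Polynomial in
/-- Zero estimate for exponential polynomials at consecutive integers. -/
theorem exp_poly_zero {F ι : Type*} [Field F] [CharZero F] [Fintype ι] [DecidableEq ι]
    (a : ι → F) (ha : Function.Injective a) (ha0 : ∀ j, a j ≠ 0) :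
    ∀ (H : ℕ) (n : ι → ℕ) (P : ι → F[X]), ∑ j, n j = H → (∀ j, (P j).degree < (n j : WithBot ℕ)) →
      (∀ l < H, ∑ j, (P j).eval (l : F) * a j ^ l = 0) → ∀ j, P j = 0 := by
  intro H
  induction H with
  | zero =>
    intro n P hn hP _ j
    have : n j = 0 := by
      have := Finset.sum_eq_zero_iff.mp hn j (Finset.mem_univ j)
      exact this
    have h := hP j
    rw [this] at h
    by_contra h0
    exact absurd h (not_lt.mpr (zero_le_degree_iff.mpr h0))
  | succ H ih =>
    intro n P hn hP hz
    obtain ⟨j, hj⟩ : ∃ j, n j ≠ 0 := by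
      by_contra! h
      simp [h] at hn
    let Q : ι → F[X] := fun k => C (a k) * taylor 1 (P k) - C (a j) * P k
    have hQ : ∀ k, Q k = 0 := by
      apply ih (Function.update n j (n j - 1)) Q
      · have := Finset.sum_update_of_mem (Finset.mem_univ j) n (n j - 1)
        rw [this]
        have h2 := Finset.sum_eq_add_sum_sdiff_singleton_of_mem (Finset.mem_univ j) n
        omega
      · intro k
        by_cases hk : k = j
        · subst hk
          simp only [Function.update_self, Q]
          rw [← mul_sub]
          by_cases h0 : P k = 0
          · simp only [h0, map_zero, sub_self, mul_zero, degree_zero]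
            exact WithBot.bot_lt_coe _
          · refine lt_of_le_of_lt (degree_C_mul (ha0 _)).le ?_
            have h1 : (taylor 1 (P k) - P k).degree < (P k).degree := by
              have := degree_sub_lt_left (p := taylor 1 (P k)) (q := P k) (by simp) (by simpa using h0)
                (by simp)
              simpa using this
            have h2 := hP k
            rw [degree_eq_natDegree h0] at h1 h2
            have h3 : (P k).natDegree < n k := by exact_mod_cast h2
            exact lt_of_lt_of_le h1 (by exact_mod_cast Nat.le_sub_one_of_lt h3)
        · rw [Function.update_of_ne hk]
          refine lt_of_le_of_lt (degree_sub_le _ _) (max_lt ?_ ?_)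
          · exact lt_of_le_of_lt (degree_C_mul (ha0 _)).le (by simpa using hP k)
          · exact lt_of_le_of_lt (degree_C_mul (ha0 _)).le (hP k)
      · intro l hl
        have h1 := hz (l + 1) (by omega)
        have h2 := hz l (by omega)
        have : ∑ k, (Q k).eval (l : F) * a k ^ l =
            ∑ k, (P k).eval ((l + 1 : ℕ) : F) * a k ^ (l + 1)
              - a j * ∑ k, (P k).eval (l : F) * a k ^ l := by
          rw [Finset.mul_sum, ← Finset.sum_sub_distrib]
          refine Finset.sum_congr rfl fun k _ => ?_
          simp only [Q, eval_sub, eval_mul, eval_C, taylor_eval]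
          push_cast
          ring
        rw [this, h1, h2]
        simp
    have hne : ∀ k, k ≠ j → P k = 0 := by
      intro k hk
      by_contra h0
      have h1 := congrArg (fun q => q.coeff (P k).natDegree) (hQ k)
      simp only [Q, coeff_sub, coeff_C_mul, coeff_zero] at h1
      have h2 : (taylor 1 (P k)).coeff (P k).natDegree = (P k).leadingCoeff := by
        have := leadingCoeff_taylor (1 : F) (P k)
        rwa [leadingCoeff, natDegree_taylor] at this
      rw [h2, ← leadingCoeff, ← sub_mul] at h1
      rcases mul_eq_zero.mp h1 with h | h
      · exact hk (ha (sub_eq_zero.mp h))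
      · exact h0 (leadingCoeff_eq_zero.mp h)
    have hz' : ∀ l < H + 1, (P j).eval (l : F) * a j ^ l = 0 := by
      intro l hl
      have := hz l hl
      rwa [Finset.sum_eq_single j (fun k _ hk => by simp [hne k hk]) (by simp)] at this
    intro k
    by_cases hk : k = j
    · subst hk
      have h0 : (P k).eval 0 = 0 := by simpa using hz' 0 (by omega)
      · have hT : taylor 1 (P k) = P k := by
          have := hQ k
          simp only [Q] at this
          rw [← mul_sub] at this
          rcases mul_eq_zero.mp this with h | h
          · exact absurd (C_eq_zero.mp h) (ha0 k)
          · exact sub_eq_zero.mp h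
        have hev : ∀ l : ℕ, (P k).eval (l : F) = 0 := by
          intro l
          induction l with
          | zero => simpa using h0
          | succ l ih =>
            rw [← ih]
            conv_rhs => rw [← hT]
            rw [taylor_eval]
            push_cast
            rw [add_comm]
        refine eq_zero_of_infinite_isRoot _ (Set.Infinite.mono ?_ (Set.infinite_range_of_injective (Nat.cast_injective (R := F))))
        rintro _ ⟨l, rfl⟩
        exact hev l
    · exact hne k hk

theorem entire_div_one (f : ℂ → ℂ) (hf : Differentiable ℂ f) (a : ℂ) (S : ℕ)
    (h : (S : ℕ∞) ≤ analyticOrderAt f a) :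
    ∃ g : ℂ → ℂ, Differentiable ℂ g ∧ ∀ z, f z = (z - a) ^ S * g z := by
  induction S generalizing f with
  | zero => exact ⟨f, hf, fun z => by simp⟩
  | succ S ih =>
    have hfa : f a = 0 := by
      apply apply_eq_zero_of_analyticOrderAt_ne_zero
      intro h0
      rw [h0] at h
      simp at h
    have hg : Differentiable ℂ (dslope f a) := by
      have := (Complex.differentiableOn_dslope (f := f) (c := a) (s := Set.univ) Filter.univ_mem).mpr
        hf.differentiableOn
      exact differentiableOn_univ.mp this
    have hfg : f = (fun z => z - a) * dslope f a := by
      funext z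
      have := sub_smul_dslope f a z
      simp [hfa] at this
      simp [this]
    have hid : analyticOrderAt (fun z : ℂ => z - a) a = 1 := by
      refine AnalyticAt.analyticOrderAt_eq_one_of_zero_deriv_ne_zero (by fun_prop) (by simp) ?_
      simp
    have hord : (S : ℕ∞) ≤ analyticOrderAt (dslope f a) a := by
      rw [hfg, analyticOrderAt_mul (by fun_prop) (hg.analyticAt a), hid] at h
      push_cast at h
      rw [add_comm] at h
      exact (ENat.add_le_add_iff_left (by simp)).mp h
    obtain ⟨g, hg1, hg2⟩ := ih _ hg hord
    refine ⟨g, hg1, fun z => ?_⟩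
    rw [hfg, Pi.mul_apply, hg2]
    ring

theorem entire_div (f : ℂ → ℂ) (hf : Differentiable ℂ f) (S H : ℕ)
    (h : ∀ l < H, (S : ℕ∞) ≤ analyticOrderAt f (l : ℂ)) :
    ∃ g : ℂ → ℂ, Differentiable ℂ g ∧ ∀ z, f z = (∏ l ∈ Finset.range H, (z - l) ^ S) * g z := by
  induction H with
  | zero => exact ⟨f, hf, fun z => by simp⟩
  | succ H ih =>
    obtain ⟨g, hg1, hg2⟩ := ih (fun l hl => h l (by omega))
    have hord : (S : ℕ∞) ≤ analyticOrderAt g (H : ℂ) := by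
      have h1 := h H (by omega)
      have hfg : f = (fun z => ∏ l ∈ Finset.range H, (z - (l : ℂ)) ^ S) * g := by
        funext z
        exact hg2 z
      have hP : AnalyticAt ℂ (fun z : ℂ => ∏ l ∈ Finset.range H, (z - (l : ℂ)) ^ S) (H : ℂ) := by
        apply Differentiable.analyticAt
        fun_prop
      rw [hfg, analyticOrderAt_mul hP (hg1.analyticAt _), hP.analyticOrderAt_eq_zero.mpr,
        zero_add] at h1
      · exact h1
      · rw [Finset.prod_ne_zero_iff]
        intro l hl
        apply pow_ne_zero
        rw [sub_ne_zero]
        have := Finset.mem_range.mp hl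
        exact_mod_cast this.ne'
    obtain ⟨g', hg1', hg2'⟩ := entire_div_one g hg1 _ S hord
    refine ⟨g', hg1', fun z => ?_⟩
    rw [hg2, hg2', Finset.prod_range_succ]
    ring

theorem schwarz_multi (f : ℂ → ℂ) (hf : Differentiable ℂ f) (S H : ℕ)
    (h : ∀ l < H, (S : ℕ∞) ≤ analyticOrderAt f (l : ℂ)) (r R Mx : ℝ)
    (hR : 0 < R) (hH : (H : ℝ) ≤ R / 2) (hr : r ≤ R) (hHr : (H : ℝ) ≤ r)
    (hMx : ∀ z : ℂ, ‖z‖ ≤ R → ‖f z‖ ≤ Mx) (w : ℕ) (hw : (w : ℝ) ≤ r) :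
    ‖f w‖ ≤ Mx * (2 * r / R) ^ (S * H) := by
  obtain ⟨g, hg1, hg2⟩ := entire_div f hf S H h
  have hg : ‖g w‖ ≤ Mx / (R / 2) ^ (S * H) := by
    have hwm : (w : ℂ) ∈ closure (Metric.ball (0 : ℂ) R) := by
      rw [closure_ball _ hR.ne']
      simp
      linarith
    refine Complex.norm_le_of_forall_mem_frontier_norm_le (Metric.isBounded_ball)
      hg1.diffContOnCl ?_ hwm
    intro z hz
    rw [frontier_ball _ hR.ne'] at hz
    have hz' : ‖z‖ = R := by simpa using hz
    rw [le_div_iff₀ (by positivity)]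
    have h1 := hMx z hz'.le
    rw [hg2, norm_mul, mul_comm] at h1
    refine le_trans (mul_le_mul_of_nonneg_left ?_ (norm_nonneg _)) h1
    rw [norm_prod, pow_mul]
    calc ((R / 2) ^ S) ^ H = ∏ l ∈ Finset.range H, (R / 2) ^ S := by simp
      _ ≤ _ := by
        refine Finset.prod_le_prod (fun _ _ => by positivity) fun l hl => ?_
        rw [norm_pow]
        gcongr
        have h2 : (l : ℝ) < H := by exact_mod_cast Finset.mem_range.mp hl
        have h3 := norm_sub_norm_le z (l : ℂ)
        rw [Complex.norm_natCast] at h3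
        linarith
  rw [hg2, norm_mul]
  have hr0 : 0 ≤ r := (Nat.cast_nonneg H).trans hHr
  have hP : ‖∏ l ∈ Finset.range H, ((w : ℂ) - l) ^ S‖ ≤ r ^ (S * H) := by
    rw [norm_prod, pow_mul]
    calc _ ≤ ∏ l ∈ Finset.range H, r ^ S := by
          refine Finset.prod_le_prod (fun _ _ => by positivity) fun l hl => ?_
          rw [norm_pow]
          gcongr
          have h2 : (l : ℝ) < H := by exact_mod_cast Finset.mem_range.mp hl
          have h3 : ‖(w : ℂ) - l‖ = |(w : ℝ) - l| := by
            rw [← Real.norm_eq_abs, ← Complex.norm_real]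
            simp
          rw [h3, abs_le]
          constructor <;> linarith [Nat.cast_nonneg (α := ℝ) w, Nat.cast_nonneg (α := ℝ) l]
      _ = _ := by simp
  calc _ ≤ r ^ (S * H) * (Mx / (R / 2) ^ (S * H)) := by gcongr
    _ = _ := by
      rw [show 2 * r / R = r / (R / 2) by field_simp]
      generalize R / 2 = Q
      rw [div_pow]
      ring

/-- The auxiliary functions (with the derivative orders `m0`, `m1`). -/
noncomputable def bF (b0 b1 Lg u : ℂ) (N0 N1 : ℕ) (p : Fin N0 × Fin N1 × Fin N1 → ℂ)
    (m0 m1 : ℕ) (z : ℂ) : ℂ :=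
  ∑ q, p q * (bA ((q.2.2 : ℕ) * b0) z m0 (q.1 : ℕ) * ((q.2.1 : ℕ) + (q.2.2 : ℕ) * b1) ^ m1 *
    Complex.exp (((q.2.1 : ℕ) * Lg + (q.2.2 : ℕ) * u) * z))

theorem bF_hasDerivAt (b0 b1 Lg u : ℂ) (hu : u = b0 + b1 * Lg) (N0 N1 : ℕ)
    (p : Fin N0 × Fin N1 × Fin N1 → ℂ) (m0 m1 : ℕ) (z : ℂ) :
    HasDerivAt (bF b0 b1 Lg u N0 N1 p m0 m1)
      (bF b0 b1 Lg u N0 N1 p (m0 + 1) m1 z + Lg * bF b0 b1 Lg u N0 N1 p m0 (m1 + 1) z) z := by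
  have : ∀ q : Fin N0 × Fin N1 × Fin N1, HasDerivAt (fun z : ℂ => p q *
      (bA ((q.2.2 : ℕ) * b0) z m0 (q.1 : ℕ) * ((q.2.1 : ℕ) + (q.2.2 : ℕ) * b1) ^ m1 *
      Complex.exp (((q.2.1 : ℕ) * Lg + (q.2.2 : ℕ) * u) * z)))
      (p q * (bA ((q.2.2 : ℕ) * b0) z (m0 + 1) (q.1 : ℕ) *
        ((q.2.1 : ℕ) + (q.2.2 : ℕ) * b1) ^ m1 *
        Complex.exp (((q.2.1 : ℕ) * Lg + (q.2.2 : ℕ) * u) * z)) +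
      Lg * (p q * (bA ((q.2.2 : ℕ) * b0) z m0 (q.1 : ℕ) *
        ((q.2.1 : ℕ) + (q.2.2 : ℕ) * b1) ^ (m1 + 1) *
        Complex.exp (((q.2.1 : ℕ) * Lg + (q.2.2 : ℕ) * u) * z)))) z := by
    intro q
    have h1 := bA_hasDerivAt ((q.2.2 : ℕ) * b0) z m0 (q.1 : ℕ)
    have h2 : HasDerivAt (fun z : ℂ => Complex.exp (((q.2.1 : ℕ) * Lg + (q.2.2 : ℕ) * u) * z))
        (Complex.exp (((q.2.1 : ℕ) * Lg + (q.2.2 : ℕ) * u) * z) *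
          (((q.2.1 : ℕ) * Lg + (q.2.2 : ℕ) * u) * 1)) z :=
      ((hasDerivAt_id z).const_mul _).cexp
    have h3 := ((h1.mul_const (((q.2.1 : ℕ) + (q.2.2 : ℕ) * b1) ^ m1)).mul h2).const_mul (p q)
    refine HasDerivAt.congr_deriv h3 ?_
    simp only [bA]
    rw [hu]
    ring
  have h := HasDerivAt.fun_sum (u := Finset.univ) fun q _ => this q
  refine HasDerivAt.congr_deriv h ?_
  rw [Finset.sum_add_distrib, ← Finset.mul_sum]
  rfl

theorem bF_differentiable (b0 b1 Lg u : ℂ) (hu : u = b0 + b1 * Lg) (N0 N1 : ℕ)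
    (p : Fin N0 × Fin N1 × Fin N1 → ℂ) (m0 m1 : ℕ) :
    Differentiable ℂ (bF b0 b1 Lg u N0 N1 p m0 m1) :=
  fun z => (bF_hasDerivAt b0 b1 Lg u hu N0 N1 p m0 m1 z).differentiableAt

theorem bF_order (b0 b1 Lg u : ℂ) (hu : u = b0 + b1 * Lg) (N0 N1 : ℕ)
    (p : Fin N0 × Fin N1 × Fin N1 → ℂ) (a : ℂ) (M : ℕ)
    (h : ∀ m0 m1, m0 + m1 < M → bF b0 b1 Lg u N0 N1 p m0 m1 a = 0) (S : ℕ) :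
    ∀ m0 m1, m0 + m1 + S ≤ M → (S : ℕ∞) ≤ analyticOrderAt (bF b0 b1 Lg u N0 N1 p m0 m1) a := by
  induction S with
  | zero => intro m0 m1 _; simp
  | succ S ih =>
    intro m0 m1 hm
    have han := fun m0 m1 => (bF_differentiable b0 b1 Lg u hu N0 N1 p m0 m1).analyticAt a
    have h0 := h m0 m1 (by omega)
    have h1 := (han m0 m1).analyticOrderAt_deriv_add_one
    simp only [h0, sub_zero] at h1
    rw [← h1]
    push_cast
    gcongr
    have hd : deriv (bF b0 b1 Lg u N0 N1 p m0 m1) = bF b0 b1 Lg u N0 N1 p (m0 + 1) m1 +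
        (fun _ => Lg) * bF b0 b1 Lg u N0 N1 p m0 (m1 + 1) := by
      funext z
      exact (bF_hasDerivAt b0 b1 Lg u hu N0 N1 p m0 m1 z).deriv
    rw [hd]
    refine le_trans (le_min (ih (m0 + 1) m1 (by omega)) ?_) le_analyticOrderAt_add
    rw [analyticOrderAt_mul analyticAt_const (han _ _)]
    exact (ih m0 (m1 + 1) (by omega)).trans le_add_self

/-- Common bound for a single term. -/
theorem term_bound (c0 c1 x E : ℂ) (R B : ℝ) (hR : 1 ≤ R) (hB : 1 ≤ B) (hx : ‖x‖ ≤ R)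
    (h0 : ‖c0‖ ≤ B) (h1 : ‖c1‖ ≤ B) (N0 N1 M : ℕ) (n0 n1 n2 m0 m1 : ℕ) (hn0 : n0 ≤ N0)
    (hn1 : n1 ≤ N1) (hn2 : n2 ≤ N1) (hN : N1 ≤ N0) (hN0 : 1 ≤ N0) (hm0 : m0 ≤ M) (hm1 : m1 ≤ M)
    (hE : ‖E‖ ≤ Real.exp (2 * N1 * B * R)) :
    ‖bA (n2 * c0) x m0 n0 * (n1 + n2 * c1) ^ m1 * E‖ ≤
      R ^ N0 * (2 * N0 * B) ^ (2 * M) * Real.exp (2 * N1 * B * R) := by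
  have hn0' : (n0 : ℝ) ≤ N0 := by exact_mod_cast hn0
  have hn1' : (n1 : ℝ) ≤ N0 := by exact_mod_cast hn1.trans hN
  have hn2' : (n2 : ℝ) ≤ N0 := by exact_mod_cast hn2.trans hN
  have hN0' : (1 : ℝ) ≤ N0 := by exact_mod_cast hN0
  have hc : ∀ c : ℂ, ‖c‖ ≤ B → ‖(n2 : ℂ) * c‖ ≤ N0 * B := by
    intro c hc
    rw [norm_mul, Complex.norm_natCast]
    gcongr
  have hNB : (N0 : ℝ) ≤ N0 * B := by nlinarith
  have hge : 1 ≤ 2 * N0 * B := by nlinarith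
  rw [norm_mul, norm_mul, norm_pow, two_mul M, pow_add, ← mul_assoc]
  have hA := bA_norm ((n2 : ℂ) * c0) x R (N0 * B) hR hx (hc c0 h0) m0 n0
  have hA' : ‖bA ((n2 : ℂ) * c0) x m0 n0‖ ≤ R ^ N0 * (2 * N0 * B) ^ M := by
    refine hA.trans ?_
    gcongr
    · calc (n0 + N0 * B) ^ m0 ≤ (2 * N0 * B) ^ m0 := by gcongr; linarith
        _ ≤ _ := by gcongr
  have hP : ‖(n1 : ℂ) + n2 * c1‖ ^ m1 ≤ (2 * N0 * B) ^ M := by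
    calc _ ≤ (2 * N0 * B) ^ m1 := by
          gcongr
          refine (norm_add_le _ _).trans ?_
          rw [Complex.norm_natCast]
          linarith [hc c1 h1]
      _ ≤ _ := by gcongr
  gcongr

theorem bF_bound (b0 b1 Lg u : ℂ) (N0 N1 M : ℕ)
    (p : Fin N0 × Fin N1 × Fin N1 → ℂ) (m0 m1 : ℕ) (z : ℂ) (R B P : ℝ) (hR : 1 ≤ R) (hB : 1 ≤ B)
    (hz : ‖z‖ ≤ R) (h0 : ‖b0‖ ≤ B) (h1 : ‖b1‖ ≤ B) (hL : ‖Lg‖ ≤ B) (hu : ‖u‖ ≤ B)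
    (hp : ∀ q, ‖p q‖ ≤ P) (hN : N1 ≤ N0) (hN0 : 1 ≤ N0) (hm0 : m0 ≤ M) (hm1 : m1 ≤ M) :
    ‖bF b0 b1 Lg u N0 N1 p m0 m1 z‖ ≤ (N0 * (N1 * N1) : ℕ) *
      (P * (R ^ N0 * (2 * N0 * B) ^ (2 * M) * Real.exp (2 * N1 * B * R))) := by
  unfold bF
  refine (norm_sum_le _ _).trans ?_
  have : ∀ q ∈ (Finset.univ : Finset (Fin N0 × Fin N1 × Fin N1)), ‖p q *
      (bA ((q.2.2 : ℕ) * b0) z m0 (q.1 : ℕ) * ((q.2.1 : ℕ) + (q.2.2 : ℕ) * b1) ^ m1 *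
      Complex.exp (((q.2.1 : ℕ) * Lg + (q.2.2 : ℕ) * u) * z))‖ ≤
      P * (R ^ N0 * (2 * N0 * B) ^ (2 * M) * Real.exp (2 * N1 * B * R)) := by
    intro q _
    rw [norm_mul]
    have hP : 0 ≤ P := (norm_nonneg _).trans (hp q)
    refine mul_le_mul (hp q) ?_ (norm_nonneg _) hP
    refine term_bound b0 b1 z _ R B hR hB hz h0 h1 N0 N1 M _ _ _ m0 m1 q.1.2.le q.2.1.2.le
      q.2.2.2.le hN hN0 hm0 hm1 ?_
    refine (Complex.norm_exp_le_exp_norm _).trans (Real.exp_le_exp.mpr ?_)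
    rw [norm_mul]
    refine mul_le_mul ?_ hz (norm_nonneg _) (by positivity)
    refine (norm_add_le _ _).trans ?_
    rw [norm_mul, norm_mul, Complex.norm_natCast, Complex.norm_natCast]
    have e1 : (((q.2.1 : ℕ) : ℝ)) ≤ N1 := by exact_mod_cast q.2.1.2.le
    have e2 : (((q.2.2 : ℕ) : ℝ)) ≤ N1 := by exact_mod_cast q.2.2.2.le
    have : (((q.2.1 : ℕ) : ℝ)) * ‖Lg‖ ≤ N1 * B := by gcongr
    have : (((q.2.2 : ℕ) : ℝ)) * ‖u‖ ≤ N1 * B := by gcongr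
    linarith
  refine (Finset.sum_le_card_nsmul _ _ _ this).trans ?_
  simp
open NumberField in
theorem siegel_simple (K : Type*) [Field K] [NumberField K] : ∃ C : ℝ, 1 ≤ C ∧
    ∀ (α β : Type) [Fintype α] [Fintype β] (a : Matrix α β (𝓞 K)) (A : ℝ), 1 ≤ A →
      0 < Fintype.card α → 2 * Fintype.card α ≤ Fintype.card β →
      (∀ k l, house ((algebraMap (𝓞 K) K) (a k l)) ≤ A) →
      ∃ ξ : β → 𝓞 K, ξ ≠ 0 ∧ a.mulVec ξ = 0 ∧
        ∀ l, house ((ξ l : K)) ≤ C * (Fintype.card β * A) := by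
  classical
  have key : ∃ c : ℝ,
    ∀ (α β : Type) [Fintype α] [Fintype β] (a : Matrix α β (𝓞 K)) (A : ℝ), a ≠ 0 →
      0 < Fintype.card α → Fintype.card α < Fintype.card β →
      (∀ k l, house ((algebraMap (𝓞 K) K) (a k l)) ≤ A) →
      ∃ ξ : β → 𝓞 K, ξ ≠ 0 ∧ a.mulVec ξ = 0 ∧
        ∀ l, house ((ξ l : K)) ≤ c * ((c * (Fintype.card β : ℕ) * A) ^
          (((Fintype.card α : ℕ) : ℝ) / ((Fintype.card β : ℕ) - (Fintype.card α : ℕ)))) :=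
    ⟨_, fun α β _ _ a A ha h0 h1 h2 =>
      house.exists_ne_zero_int_vec_house_le K a ha h0 h1 rfl h2 rfl⟩
  obtain ⟨c, hc⟩ := key
  set C : ℝ := max 1 |c| with hC
  have hC1 : 1 ≤ C := le_max_left _ _
  have hcC : |c| ≤ C := le_max_right _ _
  refine ⟨C * C, by nlinarith, ?_⟩
  intro α β _ _ a A hA h0 h1 h2
  have hq : (1 : ℝ) ≤ Fintype.card β := by
    have : 1 ≤ Fintype.card β := by omega
    exact_mod_cast this
  have hqA : 1 ≤ (Fintype.card β : ℝ) * A := by nlinarith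
  by_cases ha : a = 0
  · refine ⟨1, ?_, by simp [ha], ?_⟩
    · intro h
      have : Nonempty β := by
        rw [← Fintype.card_pos_iff]; omega
      have h3 := congrFun h (Classical.arbitrary β)
      simp at h3
    · intro l
      have : house (((1 : β → 𝓞 K) l : 𝓞 K) : K) = 1 := by
        have := house_intCast (K := K) 1
        simpa using this
      rw [this]
      nlinarith
  · obtain ⟨ξ, h3, h4, h5⟩ := hc α β a A ha h0 (by omega) h2
    refine ⟨ξ, h3, h4, fun l => (h5 l).trans ?_⟩
    set ρ : ℝ := ((Fintype.card α : ℕ) : ℝ) / ((Fintype.card β : ℕ) - (Fintype.card α : ℕ))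
    have hα : (0 : ℝ) < Fintype.card α := by exact_mod_cast h0
    have hαβ : 2 * (Fintype.card α : ℝ) ≤ Fintype.card β := by exact_mod_cast h1
    have hρ0 : 0 ≤ ρ := div_nonneg hα.le (by linarith)
    have hρ1 : ρ ≤ 1 := by
      rw [div_le_one (by linarith)]
      linarith
    have hX : |c * (Fintype.card β : ℕ) * A| ≤ C * (Fintype.card β * A) := by
      rw [abs_mul, abs_mul, mul_assoc, Nat.abs_cast, abs_of_nonneg (by linarith : 0 ≤ A)]
      gcongr
    have hX1 : 1 ≤ C * (Fintype.card β * A) := by nlinarith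
    calc _ ≤ |c * ((c * (Fintype.card β : ℕ) * A) ^ ρ)| := le_abs_self _
      _ = |c| * |((c * (Fintype.card β : ℕ) * A) ^ ρ)| := abs_mul _ _
      _ ≤ C * (C * (Fintype.card β * A)) := by
        refine mul_le_mul hcC ?_ (abs_nonneg _) (by linarith)
        calc _ ≤ |(c * (Fintype.card β : ℕ) * A)| ^ ρ := Real.abs_rpow_le_abs_rpow _ _
          _ ≤ (C * (Fintype.card β * A)) ^ ρ := Real.rpow_le_rpow (abs_nonneg _) hX hρ0
          _ ≤ (C * (Fintype.card β * A)) ^ (1 : ℝ) := Real.rpow_le_rpow_of_exponent_le hX1 hρ1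
          _ = _ := Real.rpow_one _
      _ = _ := by ring

open NumberField in
theorem liouville_ineq (K : Type*) [Field K] [NumberField K] (σ : K →+* ℂ) (v : 𝓞 K) (hv : v ≠ 0)
    (Y : ℝ) (hY : ∀ τ : K →+* ℂ, ‖τ (v : K)‖ ≤ Y) :
    1 ≤ ‖σ (v : K)‖ * Y ^ (Module.finrank ℚ K - 1) := by
  have h1 := norm_norm_le_norm_mul_house_pow (v : K) σ
  have h2 : (1 : ℝ) ≤ ‖Algebra.norm ℚ (v : K)‖ := by
    have h3 : Algebra.norm ℤ v ≠ 0 := Algebra.norm_ne_zero_iff.mpr hv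
    rw [← Algebra.coe_norm_int]
    have h5 : (1 : ℤ) ≤ |Algebra.norm ℤ v| := Int.one_le_abs h3
    have h6 : ‖((Algebra.norm ℤ v : ℤ) : ℚ)‖ = ((|Algebra.norm ℤ v| : ℤ) : ℝ) := by
      simp [← Rat.norm_cast_real]
    rw [h6]
    exact_mod_cast h5
  have h4 : house (v : K) ≤ Y := (canonicalEmbedding.norm_le_iff _ _).mpr hY
  refine h2.trans (h1.trans ?_)
  gcongr
  exact house_nonneg _

/-- The algebraic value of a single term at an integer point. -/
def bT {R : Type*} [CommRing R] (b0 b1 : R) (d n0 n1 n2 m0 m1 l : ℕ) : R :=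
  bA ((n2 : R) * b0) (l : R) m0 n0 * ((n1 : R) + (n2 : R) * b1) ^ m1 * (d : R) ^ (n1 * l)

theorem bT_map {R S : Type*} [CommRing R] [CommRing S] (f : R →+* S) (b0 b1 : R)
    (d n0 n1 n2 m0 m1 l : ℕ) :
    f (bT b0 b1 d n0 n1 n2 m0 m1 l) = bT (f b0) (f b1) d n0 n1 n2 m0 m1 l := by
  simp [bT, bA_map]

open Polynomial in
theorem zero_est {F : Type*} [Field F] [CharZero F] (b0 b1 : F) (hb : b0 ≠ 0 ∨ b1 ≠ 0) (d : ℕ)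
    (hd : 2 ≤ d) (N0 N1 H M : ℕ) (hH : N1 * N0 = H) (hM : N1 ≤ M)
    (p : Fin N0 × Fin N1 × Fin N1 → F)
    (hV : ∀ m0 m1 l, m0 + m1 < M → l < H →
      ∑ q, bT b0 b1 d (q.1 : ℕ) (q.2.1 : ℕ) (q.2.2 : ℕ) m0 m1 l * p q = 0) : p = 0 := by
  classical
  by_contra hp
  obtain ⟨q0, hq0⟩ : ∃ q, p q ≠ 0 := by
    by_contra! h
    exact hp (funext h)
  obtain ⟨n, hn, hmax⟩ := Finset.exists_maximal (s := Finset.univ.filter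
    fun n : Fin N0 => ∃ n1 n2, p (n, n1, n2) ≠ 0) ⟨q0.1, by simpa using ⟨q0.2.1, q0.2.2, hq0⟩⟩
  have hgt : ∀ n', n < n' → ∀ n1 n2, p (n', n1, n2) = 0 := by
    intro n' hn' n1 n2
    by_contra h
    have := hmax (y := n') (by simpa using ⟨n1, n2, h⟩) hn'.le
    exact absurd hn' (not_lt.mpr this)
  obtain ⟨n1, n2, hne⟩ : ∃ n1 n2, p (n, n1, n2) ≠ 0 := by simpa using hn
  have key : ∀ m0 m1, m0 + m1 < M →
      ∑ k : Fin N1, p (n, n1, k) *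
        ((((k : ℕ) : F) * b0) ^ m0 * (((n1 : ℕ) : F) + ((k : ℕ) : F) * b1) ^ m1) = 0 := by
    intro m0 m1 hm
    let P : Fin N1 → F[X] := fun n1 => ∑ n0 : Fin N0, ∑ k : Fin N1,
      C (p (n0, n1, k) * (((n1 : ℕ) : F) + ((k : ℕ) : F) * b1) ^ m1) *
        bA (C (((k : ℕ) : F) * b0)) X m0 (n0 : ℕ)
    have hP : ∀ j, P j = 0 := by
      refine exp_poly_zero (fun j : Fin N1 => (d : F) ^ (j : ℕ)) ?_ ?_ H (fun _ => N0) P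
        (by simpa using hH) ?_ ?_
      · intro i j hij
        have : d ^ (i : ℕ) = d ^ (j : ℕ) := by
          have hij' : (d : F) ^ (i : ℕ) = (d : F) ^ (j : ℕ) := hij
          exact_mod_cast hij'
        exact Fin.ext (Nat.pow_right_injective hd this)
      · intro j
        apply pow_ne_zero
        have : d ≠ 0 := by omega
        exact_mod_cast this
      · intro j
        rw [← mem_degreeLT]
        refine Submodule.sum_mem _ fun n0 _ => Submodule.sum_mem _ fun k _ => ?_
        rw [← smul_eq_C_mul]
        refine Submodule.smul_mem _ _ ?_
        rw [mem_degreeLT]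
        refine lt_of_le_of_lt degree_le_natDegree ?_
        have := (bA_poly (((k : ℕ) : F) * b0) m0 (n0 : ℕ)).1
        exact_mod_cast lt_of_le_of_lt this n0.2
      · intro l hl
        rw [← hV m0 m1 l hm hl, Fintype.sum_prod_type]
        simp_rw [Fintype.sum_prod_type]
        rw [Finset.sum_comm]
        refine Finset.sum_congr rfl fun j _ => ?_
        simp only [P, eval_finsetSum, Finset.sum_mul]
        refine Finset.sum_congr rfl fun n0 _ => Finset.sum_congr rfl fun k _ => ?_
        have := bA_map (evalRingHom (l : F)) (C (((k : ℕ) : F) * b0)) X m0 (n0 : ℕ)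
        simp only [coe_evalRingHom, eval_C, eval_X] at this
        rw [eval_mul, eval_C, this, bT, pow_mul]
        ring
    have hc := congrArg (fun q => q.coeff (n : ℕ)) (hP n1)
    simp only [P, finsetSum_coeff, coeff_C_mul, coeff_zero] at hc
    rw [Finset.sum_eq_single n] at hc
    · rw [← hc]
      refine Finset.sum_congr rfl fun k _ => ?_
      rw [(bA_poly (((k : ℕ) : F) * b0) m0 (n : ℕ)).2]
      ring
    · intro n' _ hn'
      refine Finset.sum_eq_zero fun k _ => ?_
      rcases lt_or_gt_of_ne hn' with h | h
      · rw [coeff_eq_zero_of_natDegree_lt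
          (lt_of_le_of_lt (bA_poly (((k : ℕ) : F) * b0) m0 (n' : ℕ)).1 h), mul_zero]
      · rw [hgt n' h]
        simp
    · simp
  have hv : (fun k : Fin N1 => p (n, n1, k)) = 0 := by
    rcases hb with hb | hb
    · refine Matrix.eq_zero_of_forall_pow_sum_mul_pow_eq_zero
        (f := fun k : Fin N1 => ((k : ℕ) : F) * b0) ?_ ?_
      · intro i j hij
        have := mul_right_cancel₀ hb hij
        exact Fin.ext (by exact_mod_cast this)
      · intro i
        simpa using key i 0 (by omega)
    · refine Matrix.eq_zero_of_forall_pow_sum_mul_pow_eq_zero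
        (f := fun k : Fin N1 => ((n1 : ℕ) : F) + ((k : ℕ) : F) * b1) ?_ ?_
      · intro i j hij
        have := mul_right_cancel₀ hb (add_left_cancel hij)
        exact Fin.ext (by exact_mod_cast this)
      · intro i
        simpa using key 0 i (by omega)
  exact hne (congrFun hv n2)

theorem est_E (B : ℝ) (hB : 1 ≤ B) (T j : ℕ) (hT : 1 ≤ T) (hj : j ≤ 13) :
    ((T : ℝ) ^ (4 + j)) ^ (T ^ 9) * (2 * ((T ^ 9 : ℕ) : ℝ) * B) ^ (2 * (14 * T ^ 9)) *
      Real.exp (2 * ((T ^ 6 : ℕ) : ℝ) * B * (T : ℝ) ^ (4 + j)) ≤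
      Real.exp ((17 + 28 * (11 + B) + 2 * B) * (T : ℝ) ^ (10 + j)) := by
  have hT' : (1 : ℝ) ≤ T := by exact_mod_cast hT
  have hTe : (T : ℝ) ≤ Real.exp T := by linarith [Real.add_one_le_exp (T : ℝ)]
  have h10 : (T : ℝ) ^ 10 ≤ (T : ℝ) ^ (10 + j) := pow_le_pow_right₀ hT' (by omega)
  have h1 : ((T : ℝ) ^ (4 + j)) ^ (T ^ 9) ≤ Real.exp (17 * (T : ℝ) ^ (10 + j)) := by
    calc ((T : ℝ) ^ (4 + j)) ^ (T ^ 9) ≤ (Real.exp T ^ 17) ^ (T ^ 9) := by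
          refine pow_le_pow_left₀ (by positivity) ?_ _
          calc (T : ℝ) ^ (4 + j) ≤ (T : ℝ) ^ 17 := pow_le_pow_right₀ hT' (by omega)
            _ ≤ _ := pow_le_pow_left₀ (by positivity) hTe _
      _ = Real.exp (17 * (T : ℝ) ^ 10) := by
          rw [← Real.exp_nat_mul, ← Real.exp_nat_mul]
          congr 1
          push_cast
          ring
      _ ≤ _ := by
          apply Real.exp_le_exp.mpr
          linarith
  have h2 : (2 * ((T ^ 9 : ℕ) : ℝ) * B) ^ (2 * (14 * T ^ 9)) ≤
      Real.exp (28 * (11 + B) * (T : ℝ) ^ (10 + j)) := by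
    have hb : 2 * ((T ^ 9 : ℕ) : ℝ) * B ≤ Real.exp ((11 + B) * T) := by
      have e1 : (2 : ℝ) ≤ Real.exp (2 * T) := by linarith [Real.add_one_le_exp (2 * T : ℝ)]
      have e2 : ((T ^ 9 : ℕ) : ℝ) ≤ Real.exp (9 * T) := by
        push_cast
        calc (T : ℝ) ^ 9 ≤ Real.exp T ^ 9 := pow_le_pow_left₀ (by positivity) hTe _
          _ = _ := by rw [← Real.exp_nat_mul]; norm_num
      have e3 : B ≤ Real.exp (B * T) := by nlinarith [Real.add_one_le_exp (B * T : ℝ)]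
      calc _ ≤ Real.exp (2 * T) * Real.exp (9 * T) * Real.exp (B * T) := by gcongr
        _ = _ := by rw [← Real.exp_add, ← Real.exp_add]; congr 1; ring
    calc _ ≤ (Real.exp ((11 + B) * T)) ^ (2 * (14 * T ^ 9)) :=
          pow_le_pow_left₀ (by positivity) hb _
      _ = Real.exp (28 * (11 + B) * (T : ℝ) ^ 10) := by
          rw [← Real.exp_nat_mul]
          congr 1
          push_cast
          ring
      _ ≤ _ := by
          apply Real.exp_le_exp.mpr
          gcongr
  have h3 : 2 * ((T ^ 6 : ℕ) : ℝ) * B * (T : ℝ) ^ (4 + j) = 2 * B * (T : ℝ) ^ (10 + j) := by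
    push_cast
    ring
  rw [h3]
  calc _ ≤ Real.exp (17 * (T : ℝ) ^ (10 + j)) * Real.exp (28 * (11 + B) * (T : ℝ) ^ (10 + j)) *
        Real.exp (2 * B * (T : ℝ) ^ (10 + j)) := by gcongr
    _ = _ := by rw [← Real.exp_add, ← Real.exp_add]; congr 1; ring

open NumberField in
theorem core_false (K : Type*) [Field K] [NumberField K] (σ : K →+* ℂ) (b0 b1 : 𝓞 K)
    (hb : b0 ≠ 0 ∨ b1 ≠ 0) (d : ℕ) (hd : 2 ≤ d) (Lg u : ℂ) (hL : Complex.exp Lg = d)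
    (hu : u = σ b0 + σ b1 * Lg) (hexp : Complex.exp u = 1) : False := by
  classical
  obtain ⟨Cs, hCs1, hsiegel⟩ := siegel_simple K
  obtain ⟨B, hB1, hB0, hBb1, hBL, hBu⟩ : ∃ B : ℝ, 1 ≤ B ∧ (∀ τ : K →+* ℂ, ‖τ b0‖ ≤ B) ∧
      (∀ τ : K →+* ℂ, ‖τ b1‖ ≤ B) ∧ ‖Lg‖ ≤ B ∧ ‖u‖ ≤ B := by
    have h0 := house_nonneg (b0 : K)
    have h1 := house_nonneg (b1 : K)
    have h2 := norm_nonneg Lg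
    have h3 := norm_nonneg u
    refine ⟨1 + house (b0 : K) + house (b1 : K) + ‖Lg‖ + ‖u‖, by linarith, fun τ => ?_, fun τ => ?_,
      by linarith, by linarith⟩
    · linarith [norm_embedding_le_house (b0 : K) τ]
    · linarith [norm_embedding_le_house (b1 : K) τ]
  set C0 : ℝ := 17 + 28 * (11 + B) + 2 * B with hC0
  set C1 : ℝ := Cs + 21 + C0 with hC1
  set C2 : ℝ := 21 + C1 + C0 with hC2
  set D : ℕ := Module.finrank ℚ K with hD
  have hD1 : 1 ≤ D := Module.finrank_pos
  obtain ⟨T, hT⟩ := exists_nat_gt (max 392 (C2 * D))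
  have hT392 : 392 < T := by
    have := lt_of_le_of_lt (le_max_left _ _) hT
    exact_mod_cast this
  have hTD : C2 * D < T := lt_of_le_of_lt (le_max_right _ _) hT
  have hT1 : (1 : ℝ) ≤ T := by
    have : 1 ≤ T := by omega
    exact_mod_cast this
  have hT6 : (6 : ℝ) ≤ T := by
    have : 6 ≤ T := by omega
    exact_mod_cast this
  -- bound for the algebraic terms
  have hterm : ∀ (j : ℕ), j ≤ 13 → ∀ (τ : K →+* ℂ) (q : Fin (T ^ 9) × Fin (T ^ 6) × Fin (T ^ 6))
      (m0 m1 l : ℕ), m0 ≤ 14 * T ^ 9 → m1 ≤ 14 * T ^ 9 → l ≤ T ^ (4 + j) →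
      ‖τ ((bT b0 b1 d (q.1 : ℕ) (q.2.1 : ℕ) (q.2.2 : ℕ) m0 m1 l : 𝓞 K) : K)‖ ≤
        Real.exp (C0 * (T : ℝ) ^ (10 + j)) := by
    intro j hj τ q m0 m1 l hm0 hm1 hl
    have hl' : (l : ℝ) ≤ (T : ℝ) ^ (4 + j) := by exact_mod_cast hl
    have hmap := bT_map (τ.comp (algebraMap (𝓞 K) K)) b0 b1 d (q.1 : ℕ) (q.2.1 : ℕ) (q.2.2 : ℕ)
      m0 m1 l
    have hmap' : τ ((bT b0 b1 d (q.1 : ℕ) (q.2.1 : ℕ) (q.2.2 : ℕ) m0 m1 l : 𝓞 K) : K) =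
      bT (τ b0) (τ b1) d (q.1 : ℕ) (q.2.1 : ℕ) (q.2.2 : ℕ) m0 m1 l := hmap
    rw [hmap', bT]
    refine (term_bound (τ b0) (τ b1) (l : ℂ) _ ((T : ℝ) ^ (4 + j)) B (one_le_pow₀ hT1) hB1
      (by simpa using hl') (hB0 τ) (hBb1 τ) (T ^ 9) (T ^ 6) (14 * T ^ 9) _ _ _ m0 m1 q.1.2.le
      q.2.1.2.le q.2.2.2.le (Nat.pow_le_pow_right (by omega) (by omega))
      (Nat.one_le_pow _ _ (by omega)) hm0 hm1 ?_).trans (est_E B hB1 T j (by omega) hj)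
    have hdB : ‖(d : ℂ)‖ ≤ Real.exp B := by
      rw [← hL]
      exact (Complex.norm_exp_le_exp_norm _).trans (Real.exp_le_exp.mpr hBL)
    rw [norm_pow]
    refine (pow_le_pow_left₀ (norm_nonneg _) hdB _).trans ?_
    rw [← Real.exp_nat_mul]
    apply Real.exp_le_exp.mpr
    have e1 : ((q.2.1 : ℕ) : ℝ) ≤ ((T ^ 6 : ℕ) : ℝ) := by exact_mod_cast q.2.1.2.le
    push_cast at e1 ⊢
    have : ((q.2.1 : ℕ) : ℝ) * (l : ℝ) * B ≤ (T : ℝ) ^ 6 * (T : ℝ) ^ (4 + j) * B := by gcongr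
    have h0 : 0 ≤ (T : ℝ) ^ 6 * (T : ℝ) ^ (4 + j) * B := by positivity
    linarith
  -- the Siegel lemma
  obtain ⟨ξ, hξ0, hξV, hξb⟩ := hsiegel (Fin (14 * T ^ 9) × Fin (14 * T ^ 9) × Fin (T ^ 2))
    (Fin (T ^ 9) × Fin (T ^ 6) × Fin (T ^ 6))
    (fun k q => bT b0 b1 d (q.1 : ℕ) (q.2.1 : ℕ) (q.2.2 : ℕ) (k.1 : ℕ) (k.2.1 : ℕ) (k.2.2 : ℕ))
    (Real.exp (C0 * (T : ℝ) ^ 10))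
    (Real.one_le_exp (by positivity))
    (by simp only [Fintype.card_prod, Fintype.card_fin]; positivity)
    (by
      simp only [Fintype.card_prod, Fintype.card_fin]
      calc 2 * (14 * T ^ 9 * (14 * T ^ 9 * T ^ 2)) = 392 * T ^ 20 := by ring
        _ ≤ T * T ^ 20 := Nat.mul_le_mul_right _ hT392.le
        _ = _ := by ring)
    (by
      intro k q
      refine (canonicalEmbedding.norm_le_iff _ _).mpr fun τ => ?_
      refine hterm 0 (by omega) τ q _ _ _ k.1.2.le k.2.1.2.le ?_
      exact k.2.2.2.le.trans (Nat.pow_le_pow_right (by omega) (by omega)))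
  set P : ℝ := Real.exp (C1 * (T : ℝ) ^ 10) with hP
  have hT21 : ((T ^ 9 * (T ^ 6 * T ^ 6) : ℕ) : ℝ) ≤ Real.exp (21 * T) := by
    push_cast
    calc (T : ℝ) ^ 9 * (T ^ 6 * T ^ 6) = (T : ℝ) ^ 21 := by ring
      _ ≤ Real.exp T ^ 21 := by
        refine pow_le_pow_left₀ (by positivity) ?_ _
        linarith [Real.add_one_le_exp (T : ℝ)]
      _ = _ := by rw [← Real.exp_nat_mul]; norm_num
  have hTpow : ∀ j : ℕ, (T : ℝ) ≤ (T : ℝ) ^ (10 + j) := fun j => le_self_pow₀ hT1 (by omega)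
  have hξP : ∀ q (τ : K →+* ℂ), ‖τ (ξ q)‖ ≤ P := by
    intro q τ
    refine (norm_embedding_le_house _ τ).trans ((hξb q).trans ?_)
    have e1 : Cs ≤ Real.exp (Cs * T) := by nlinarith [Real.add_one_le_exp (Cs * T : ℝ)]
    simp only [Fintype.card_prod, Fintype.card_fin]
    calc _ ≤ Real.exp (Cs * T) * (Real.exp (21 * T) * Real.exp (C0 * (T : ℝ) ^ 10)) := by gcongr
      _ = Real.exp ((Cs + 21) * T + C0 * (T : ℝ) ^ 10) := by
        rw [← Real.exp_add, ← Real.exp_add]; congr 1; ring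
      _ ≤ P := by
        apply Real.exp_le_exp.mpr
        have := mul_le_mul_of_nonneg_left (hTpow 0) (by linarith : 0 ≤ Cs + 21)
        rw [hC1]
        simp only [add_zero] at this
        linarith
  have hC0pos : 0 ≤ C0 := by linarith
  have hC1pos : 0 ≤ C1 := by linarith
  have hYexp : ∀ j : ℕ, ((T ^ 9 * (T ^ 6 * T ^ 6) : ℕ) : ℝ) *
      (P * Real.exp (C0 * (T : ℝ) ^ (10 + j))) ≤ Real.exp (C2 * (T : ℝ) ^ (10 + j)) := by
    intro j
    calc _ ≤ Real.exp (21 * T) * (P * Real.exp (C0 * (T : ℝ) ^ (10 + j))) := by gcongr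
      _ = Real.exp (21 * T + (C1 * (T : ℝ) ^ 10 + C0 * (T : ℝ) ^ (10 + j))) := by
        rw [hP, ← Real.exp_add, ← Real.exp_add]
      _ ≤ _ := by
        apply Real.exp_le_exp.mpr
        have h1 := hTpow j
        have h2 : (T : ℝ) ^ 10 ≤ (T : ℝ) ^ (10 + j) := pow_le_pow_right₀ hT1 (by omega)
        have h3 := mul_le_mul_of_nonneg_left h2 hC1pos
        rw [hC2]
        linarith
  let V : ℕ → ℕ → ℕ → 𝓞 K := fun m0 m1 l =>
    ∑ q : Fin (T ^ 9) × Fin (T ^ 6) × Fin (T ^ 6),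
      bT b0 b1 d (q.1 : ℕ) (q.2.1 : ℕ) (q.2.2 : ℕ) m0 m1 l * ξ q
  have hVbound : ∀ (j : ℕ), j ≤ 13 → ∀ (τ : K →+* ℂ) (m0 m1 l : ℕ), m0 ≤ 14 * T ^ 9 →
      m1 ≤ 14 * T ^ 9 → l ≤ T ^ (4 + j) → ‖τ (V m0 m1 l)‖ ≤ Real.exp (C2 * (T : ℝ) ^ (10 + j)) := by
    intro j hj τ m0 m1 l hm0 hm1 hl
    refine le_trans ?_ (hYexp j)
    simp only [V, map_sum, map_mul]
    refine (norm_sum_le _ _).trans ((Finset.sum_le_card_nsmul _ _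
      (P * Real.exp (C0 * (T : ℝ) ^ (10 + j))) fun q _ => ?_).trans ?_)
    · rw [norm_mul, mul_comm]
      exact mul_le_mul (hξP q τ) (hterm j hj τ q m0 m1 l hm0 hm1 hl) (norm_nonneg _)
        (Real.exp_pos _).le
    · simp
  let F : ℕ → ℕ → ℂ → ℂ := bF (σ b0) (σ b1) Lg u (T ^ 9) (T ^ 6) (fun q => σ (ξ q))
  have hFV : ∀ m0 m1 l : ℕ, F m0 m1 (l : ℂ) = σ (V m0 m1 l) := by
    intro m0 m1 l
    simp only [F, bF, V, map_sum, map_mul]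
    refine Finset.sum_congr rfl fun q _ => ?_
    have hmap : σ ((bT b0 b1 d (q.1 : ℕ) (q.2.1 : ℕ) (q.2.2 : ℕ) m0 m1 l : 𝓞 K) : K) =
      bT (σ b0) (σ b1) d (q.1 : ℕ) (q.2.1 : ℕ) (q.2.2 : ℕ) m0 m1 l :=
      bT_map (σ.comp (algebraMap (𝓞 K) K)) b0 b1 d (q.1 : ℕ) (q.2.1 : ℕ) (q.2.2 : ℕ) m0 m1 l
    have he : Complex.exp ((((q.2.1 : ℕ) : ℂ) * Lg + ((q.2.2 : ℕ) : ℂ) * u) * l) =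
        (d : ℂ) ^ ((q.2.1 : ℕ) * l) := by
      have : (((q.2.1 : ℕ) : ℂ) * Lg + ((q.2.2 : ℕ) : ℂ) * u) * l =
          (((q.2.1 : ℕ) * l : ℕ) : ℂ) * Lg + (((q.2.2 : ℕ) * l : ℕ) : ℂ) * u := by
        push_cast; ring
      rw [this, Complex.exp_add, Complex.exp_nat_mul, Complex.exp_nat_mul, hL, hexp]
      simp
    rw [he, hmap, bT]
    ring
  -- extrapolation
  have hmain : ∀ j : ℕ, j ≤ 13 → ∀ m0 m1 l : ℕ, m0 + m1 < (14 - j) * T ^ 9 → l < T ^ (2 + j) →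
      V m0 m1 l = 0 := by
    intro j
    induction j with
    | zero =>
      intro _ m0 m1 l hm hl
      have := congrFun hξV (⟨m0, by omega⟩, ⟨m1, by omega⟩, ⟨l, hl⟩)
      exact this
    | succ j ih =>
      intro hj m0 m1 l hm hl
      have ih' := ih (by omega)
      have hsub : (14 - j) * T ^ 9 = (14 - (j + 1)) * T ^ 9 + T ^ 9 := by
        have : 14 - j = (14 - (j + 1)) + 1 := by omega
        rw [this]
        ring
      have hle14 : (14 - (j + 1)) * T ^ 9 ≤ 14 * T ^ 9 := Nat.mul_le_mul_right _ (by omega)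
      by_contra hne
      have hord : ∀ l' < T ^ (2 + j), ((T ^ 9 : ℕ) : ℕ∞) ≤ analyticOrderAt (F m0 m1) (l' : ℂ) := by
        intro l' hl'
        refine bF_order (σ b0) (σ b1) Lg u hu _ _ _ (l' : ℂ) ((14 - j) * T ^ 9) ?_ _ m0 m1
          (by omega)
        intro k0 k1 hk
        have h1 := hFV k0 k1 l'
        rw [ih' k0 k1 l' hk hl'] at h1
        simpa [F] using h1
      set Y : ℝ := Real.exp (C2 * (T : ℝ) ^ (10 + j)) with hY
      have hFb : ∀ z : ℂ, ‖z‖ ≤ (T : ℝ) ^ (4 + j) → ‖F m0 m1 z‖ ≤ Y := by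
        intro z hz
        refine le_trans ?_ (hYexp j)
        refine (bF_bound (σ b0) (σ b1) Lg u (T ^ 9) (T ^ 6) (14 * T ^ 9) _ m0 m1 z
          ((T : ℝ) ^ (4 + j)) B P (one_le_pow₀ hT1) hB1 hz (hB0 σ) (hBb1 σ) hBL hBu
          (fun q => hξP q σ) (Nat.pow_le_pow_right (by omega) (by omega))
          (Nat.one_le_pow _ _ (by omega)) (by omega) (by omega)).trans ?_
        have := est_E B hB1 T j (by omega) (by omega)
        gcongr
      have hsch := schwarz_multi (F m0 m1) (bF_differentiable (σ b0) (σ b1) Lg u hu _ _ _ m0 m1)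
        (T ^ 9) (T ^ (2 + j)) hord ((T : ℝ) ^ (3 + j)) ((T : ℝ) ^ (4 + j)) Y (by positivity)
        (by
          push_cast
          have : (T : ℝ) ^ (4 + j) = T * T * (T : ℝ) ^ (2 + j) := by ring
          rw [this]
          have h0 : (0 : ℝ) < (T : ℝ) ^ (2 + j) := by positivity
          have h2 : (2 : ℝ) ≤ T * T := by nlinarith
          nlinarith)
        (pow_le_pow_right₀ hT1 (by omega))
        (by push_cast; exact pow_le_pow_right₀ hT1 (by omega)) hFb l
        (by
          have : l ≤ T ^ (3 + j) := by
            have h1 : 2 + (j + 1) = 3 + j := by omega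
            rw [h1] at hl
            exact hl.le
          exact_mod_cast this)
      have hratio : (2 * (T : ℝ) ^ (3 + j) / (T : ℝ) ^ (4 + j)) ^ (T ^ 9 * T ^ (2 + j)) ≤
          Real.exp (-(T : ℝ) ^ (11 + j)) := by
        have h1 : 2 * (T : ℝ) ^ (3 + j) / (T : ℝ) ^ (4 + j) = 2 / T := by
          have : (T : ℝ) ^ (4 + j) = T * (T : ℝ) ^ (3 + j) := by ring
          rw [this]
          field_simp
        have h2 : 2 / (T : ℝ) ≤ Real.exp (-1) := by
          rw [Real.exp_neg, ← one_div, div_le_div_iff₀ (by positivity) (Real.exp_pos _)]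
          linarith [Real.exp_one_lt_d9]
        rw [h1]
        calc _ ≤ Real.exp (-1) ^ (T ^ 9 * T ^ (2 + j)) := by gcongr
          _ = _ := by
            rw [← Real.exp_nat_mul]
            congr 1
            push_cast
            ring
      have hlio := liouville_ineq K σ (V m0 m1 l) hne Y (fun τ => hVbound j (by omega) τ m0 m1 l
        (by omega) (by omega) (hl.le.trans (Nat.pow_le_pow_right (by omega) (by omega))))
      rw [← hFV] at hlio
      have hY0 : 0 < Y := Real.exp_pos _
      have hfin : (1 : ℝ) ≤ Real.exp ((C2 * D - T) * (T : ℝ) ^ (10 + j)) := by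
        calc (1 : ℝ) ≤ ‖F m0 m1 l‖ * Y ^ (D - 1) := hlio
          _ ≤ (Y * Real.exp (-(T : ℝ) ^ (11 + j))) * Y ^ (D - 1) := by
            refine mul_le_mul_of_nonneg_right (hsch.trans ?_) (by positivity)
            exact mul_le_mul_of_nonneg_left hratio hY0.le
          _ = Y ^ D * Real.exp (-(T : ℝ) ^ (11 + j)) := by
            obtain ⟨D', hD'⟩ : ∃ D', D = D' + 1 := ⟨D - 1, by omega⟩
            rw [hD', Nat.add_sub_cancel]
            ring
          _ = _ := by
            rw [hY, ← Real.exp_nat_mul, ← Real.exp_add]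
            congr 1
            ring
      rw [Real.one_le_exp_iff] at hfin
      have : (C2 * D - T) * (T : ℝ) ^ (10 + j) < 0 :=
        mul_neg_of_neg_of_pos (by linarith) (by positivity)
      linarith
  have hz := zero_est (b0 : K) (b1 : K)
    (hb.imp (fun h => by simpa using h) (fun h => by simpa using h)) d hd
    (T ^ 9) (T ^ 6) (T ^ 15) (T ^ 9) (by ring) (Nat.pow_le_pow_right (by omega) (by omega))
    (fun q => (ξ q : K)) (by
      intro m0 m1 l hm hl
      have h1 := hmain 13 le_rfl m0 m1 l (by omega) hl
      have h2 := congrArg (algebraMap (𝓞 K) K) h1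
      simp only [V, map_sum, map_mul, bT_map, map_zero] at h2
      exact h2)
  apply hξ0
  funext q
  have := congrFun hz q
  simpa using this

open NumberField in
theorem core_complex (c0 c1 : ℂ) (h0 : IsIntegral ℤ c0) (h1 : IsIntegral ℤ c1)
    (hc : c0 ≠ 0 ∨ c1 ≠ 0) (d : ℕ) (hd : 2 ≤ d)
    (hexp : Complex.exp (c0 + c1 * (Real.log d : ℂ)) = 1) : False := by
  let S : Set ℂ := {c0, c1}
  let K := IntermediateField.adjoin ℚ S
  have hfin : FiniteDimensional ℚ K := by
    have : Finite S := Set.Finite.to_subtype (by simp [S])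
    refine IntermediateField.finiteDimensional_adjoin fun x hx => ?_
    rcases hx with rfl | rfl
    · exact h0.tower_top
    · exact h1.tower_top
  have hNF : NumberField K := { to_charZero := inferInstance, to_finiteDimensional := hfin }
  have m0 : c0 ∈ K := IntermediateField.subset_adjoin ℚ S (by simp [S])
  have m1 : c1 ∈ K := IntermediateField.subset_adjoin ℚ S (by simp [S])
  have i0 : IsIntegral ℤ (⟨c0, m0⟩ : K) := by
    refine (isIntegral_algHom_iff (K.val.restrictScalars ℤ) ?_).mp h0
    exact K.val.injective
  have i1 : IsIntegral ℤ (⟨c1, m1⟩ : K) := by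
    refine (isIntegral_algHom_iff (K.val.restrictScalars ℤ) ?_).mp h1
    exact K.val.injective
  refine core_false K (algebraMap K ℂ) (⟨⟨c0, m0⟩, i0⟩ : 𝓞 K) (⟨⟨c1, m1⟩, i1⟩ : 𝓞 K) ?_ d hd
    (Real.log d : ℂ) _ ?_ rfl ?_
  · refine hc.imp (fun h h' => h ?_) (fun h h' => h ?_)
    · have h2 := congrArg (fun x : 𝓞 K => ((x : K) : ℂ)) h'
      have h3 : c0 = (((0 : 𝓞 K) : K) : ℂ) := h2
      simpa using h3
    · have h2 := congrArg (fun x : 𝓞 K => ((x : K) : ℂ)) h'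
      have h3 : c1 = (((0 : 𝓞 K) : K) : ℂ) := h2
      simpa using h3
  · rw [← Complex.ofReal_exp, Real.exp_log (by positivity)]
    simp
  · exact hexp

/-- The key transcendence statement for `r π / 4 - (log d) / 2`. -/
theorem transcendental_aux (r d : ℕ) (hd : 1 ≤ d) (hrd : d = 1 → 1 ≤ r) :
    Transcendental ℚ ((r : ℝ) * (Real.pi / 4) - (1 / 2) * Real.log d) := by
  intro hx
  set x : ℝ := (r : ℝ) * (Real.pi / 4) - (1 / 2) * Real.log d with hxdef
  have hxC : IsAlgebraic ℚ (x : ℂ) := hx.algebraMap (A := ℂ)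
  have hI : IsIntegral ℤ Complex.I :=
    ⟨Polynomial.X ^ 2 + 1, by monicity!, by simp⟩
  have hIQ : IsAlgebraic ℚ Complex.I := (hI.tower_top (A := ℚ)).isAlgebraic
  have h8 : IsAlgebraic ℚ (8 * Complex.I * x : ℂ) :=
    ((by simpa using isAlgebraic_algebraMap (R := ℚ) (A := ℂ) 8 : IsAlgebraic ℚ (8 : ℂ)).mul hIQ).mul hxC
  have h8Z : IsAlgebraic ℤ (8 * Complex.I * x : ℂ) := (IsFractionRing.isAlgebraic_iff ℤ ℚ ℂ).mpr h8
  obtain ⟨N, hN, hNmul⟩ := h8Z.exists_integral_multiple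
  have hNC : (N : ℂ) ≠ 0 := by exact_mod_cast hN
  rw [zsmul_eq_mul] at hNmul
  have hi1 : IsIntegral ℤ ((N : ℂ) * (4 * Complex.I)) := by
    have e : ((N : ℂ) * (4 * Complex.I)) = ((N * 4 : ℤ) : ℂ) * Complex.I := by push_cast; ring
    rw [e]
    exact (isIntegral_algebraMap (R := ℤ) (A := ℂ) (x := N * 4)).mul hI
  have hkey : (N : ℂ) * (8 * Complex.I * x) + (N : ℂ) * (4 * Complex.I) * (Real.log d : ℂ) =
      ((N * r : ℤ) : ℂ) * (2 * Real.pi * Complex.I) := by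
    rw [hxdef]
    push_cast
    ring
  rcases Nat.lt_or_ge d 2 with h | h
  · have hd1 : d = 1 := by omega
    have hr := hrd hd1
    rw [hd1] at hkey
    simp only [Nat.cast_one, Real.log_one, Complex.ofReal_zero, mul_zero, add_zero] at hkey
    refine core_complex _ 0 hNmul isIntegral_zero (Or.inl ?_) 2 le_rfl ?_
    · rw [hkey]
      have hr' : (r : ℂ) ≠ 0 := by
        have : r ≠ 0 := by omega
        exact_mod_cast this
      have hpi : (Real.pi : ℂ) ≠ 0 := by exact_mod_cast Real.pi_ne_zero
      push_cast
      simp [hNC, hr', hpi]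
    · rw [zero_mul, add_zero, hkey]
      exact Complex.exp_int_mul_two_pi_mul_I _
  · refine core_complex _ _ hNmul hi1 (Or.inr ?_) d h ?_
    · simp [hNC]
    · rw [hkey]
      exact Complex.exp_int_mul_two_pi_mul_I _

/-- **Key step of the second part of Corollary 7.** For every number field `K`, the real
number `r₁(K)·π/4 − (1/2)·log|d_K|` is transcendental. -/
theorem transcendental_r1_pi_quarter_sub_half_log_discr
    (K : Type*) [Field K] [NumberField K] :
    Transcendental ℚ ((NumberField.InfinitePlace.nrRealPlaces K : ℝ) * (Real.pi / 4) -
      (1 / 2) * Real.log |(NumberField.discr K : ℝ)|) := by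
  have h := transcendental_aux (NumberField.InfinitePlace.nrRealPlaces K)
    (NumberField.discr K).natAbs (Int.natAbs_pos.mpr (NumberField.discr_ne_zero K)) ?_
  · rw [Nat.cast_natAbs, Int.cast_abs] at h
    exact h
  · intro hd
    have hfr : ¬ 1 < Module.finrank ℚ K := by
      intro h1
      have := NumberField.abs_discr_gt_two h1
      rw [Int.abs_eq_natAbs] at this
      omega
    have hpos : 0 < Module.finrank ℚ K := Module.finrank_pos
    have := NumberField.InfinitePlace.card_add_two_mul_card_eq_rank K
    omega
end

section
/- Let N > 1 and let χ be a primitive quadratic Dirichlet character of modulus N (so χ² is trivial and χ is nontrivial). Set ε := 2 if χ(−1) = 1 and ε := 0 if χ(−1) = −1. Then the derivative at s = 1/2 of the function s ↦ ζ(s)·L(s,χ) equals −(1/2)·(log N − ε·π/2 − 2·(log(8π)+γ))·ζ(1/2)·L(1/2,χ). (This is the specialization to quadratic fields of equations (2) and (3): for K the quadratic field of discriminant d with |d| = N one has ζ_K(s) = ζ(s)L(s,χ) and ζ_K'(1/2) = −(1/2)A_K'(1/2)ζ_K(1/2).) -/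
section AuxFacts

open Complex Filter Topology

lemma aux_cpow (w : ℂ) (r : ℝ) (hw : w ≠ 0) (hr : 0 < r) :
    (w * r) ^ (1 / 2 : ℂ) = w ^ (1 / 2 : ℂ) * (r : ℂ) ^ (1 / 2 : ℂ) := by
  have hr' : (r : ℂ) ≠ 0 := by exact_mod_cast hr.ne'
  rw [cpow_def_of_ne_zero (mul_ne_zero hw hr'), cpow_def_of_ne_zero hw, cpow_def_of_ne_zero hr',
    Complex.log_mul_ofReal r hr w hw, ← Complex.exp_add, Complex.ofReal_log hr.le]
  congr 1; ring

lemma aux_summable (z : ℂ) (hz : 0 < z.re) :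
    Summable fun n : ℤ => ‖cexp (-Real.pi * z * n ^ 2)‖ := by
  have := (hasSum_jacobiTheta₂_term 0 (τ := I * z) (by simpa using hz)).summable.norm
  refine this.congr fun n => ?_
  rw [jacobiTheta₂_term]
  congr 2
  linear_combination (Real.pi * n ^ 2 * z : ℂ) * I_mul_I

/-- Asymptotics of theta series with periodic coefficients. -/
lemma aux_theta_asymp {M : ℕ} [NeZero M] (c : ZMod M → ℂ) {ι : Type*} (l : Filter ι)
    (a : ι → ℂ) (ha : Tendsto (fun i => (a i).re) l atTop) :
    Tendsto (fun i => ((a i) ^ (1 / 2 : ℂ))⁻¹ *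
      ∑' n : ℤ, c n * cexp (-Real.pi * (1 / (M ^ 2 * a i)) * n ^ 2)) l (𝓝 (∑ r, c r)) := by
  have hM : (M : ℂ) ≠ 0 := NeZero.ne _
  -- inner limits
  have hin : ∀ b : ℝ, Tendsto (fun i => ∑' n : ℤ,
      cexp (-Real.pi * a i * n ^ 2 + 2 * Real.pi * (-I * b) * n)) l (𝓝 1) := by
    intro b
    have hnorm : ∀ i (n : ℤ), ‖cexp (-Real.pi * a i * n ^ 2 + 2 * Real.pi * (-I * b) * n)‖
        = Real.exp (-Real.pi * (a i).re * n ^ 2) := by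
      intro i n
      rw [Complex.norm_exp]
      congr 1
      have : (-Real.pi * a i * n ^ 2 + 2 * Real.pi * (-I * b) * n : ℂ)
        = ((-Real.pi * n ^ 2 : ℝ) : ℂ) * a i + ((-2 * Real.pi * b * n : ℝ) : ℂ) * I := by
        push_cast; ring
      rw [this, add_re, re_ofReal_mul, re_ofReal_mul]
      simp; ring
    have h1 : (∑' n : ℤ, if n = 0 then (1 : ℂ) else 0) = 1 := by
      rw [tsum_ite_eq]
    rw [← h1]
    refine tendsto_tsum_of_dominated_convergence (bound := fun n : ℤ => Real.exp (-Real.pi * n ^ 2))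
      ?_ ?_ ?_
    · have := aux_summable 1 (by simp)
      refine this.congr fun n => ?_
      rw [Complex.norm_exp]
      congr 1
      rw [show (-Real.pi * 1 * n ^ 2 : ℂ) = ((-Real.pi * n ^ 2 : ℝ) : ℂ) by push_cast; ring,
        ofReal_re]
    · intro n
      by_cases hn : n = 0
      · simp [hn, tendsto_const_nhds]
      · simp only [hn, if_false]
        rw [tendsto_zero_iff_norm_tendsto_zero]
        simp_rw [hnorm]
        refine Real.tendsto_exp_atBot.comp ?_
        have hneg : -Real.pi * (n : ℝ) ^ 2 < 0 := by
          have : (0 : ℝ) < (n : ℝ) ^ 2 := by positivity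
          nlinarith [Real.pi_pos]
        exact (ha.const_mul_atTop_of_neg hneg).congr fun i => by ring
    · filter_upwards [ha.eventually_ge_atTop 1] with i hi n
      rw [hnorm]
      refine Real.exp_le_exp.2 ?_
      have : 0 ≤ Real.pi * (n : ℝ) ^ 2 := by positivity
      nlinarith
  have hlim : Tendsto (fun i => ∑ r : Fin M, c ((r : ℕ) : ZMod M) * ∑' n : ℤ,
      cexp (-Real.pi * a i * n ^ 2 + 2 * Real.pi * (-I * ((r : ℕ) / M : ℝ)) * n)) l
      (𝓝 (∑ r : Fin M, c ((r : ℕ) : ZMod M) * 1)) :=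
    tendsto_finsetSum _ fun r _ => (hin _).const_mul _
  have hsum : ∑ r : Fin M, c ((r : ℕ) : ZMod M) * 1 = ∑ r, c r := by
    simp_rw [mul_one]
    refine Fintype.sum_equiv (ZMod.finEquiv M).toEquiv _ _ fun r => ?_
    congr 1
    obtain ⟨m, rfl⟩ := Nat.exists_eq_succ_of_ne_zero (NeZero.ne M)
    exact ZMod.natCast_zmod_val (n := m + 1) r
  rw [hsum] at hlim
  refine hlim.congr' ?_
  filter_upwards [ha.eventually_gt_atTop 0] with i hi
  have hai : a i ≠ 0 := fun h => by simp [h] at hi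
  set z : ℂ := 1 / (M ^ 2 * a i) with hz
  have hzre : 0 < z.re := by
    rw [hz, one_div, mul_inv, show ((M : ℂ) ^ 2)⁻¹ = (((M : ℝ) ^ 2)⁻¹ : ℝ) by push_cast; rfl,
      re_ofReal_mul, inv_re]
    have : (0 : ℝ) < M := by exact_mod_cast NeZero.pos M
    have h2 : 0 < normSq (a i) := normSq_pos.2 hai
    positivity
  have hS : Summable fun n : ℤ => c n * cexp (-Real.pi * z * n ^ 2) := by
    refine Summable.of_norm_bounded ((aux_summable z hzre).mul_left (∑ r, ‖c r‖)) fun n => ?_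
    rw [norm_mul]
    gcongr
    exact Finset.single_le_sum (f := fun r => ‖c r‖) (fun _ _ => norm_nonneg _) (Finset.mem_univ _)
  have hS2 := ((Int.divModEquiv M).symm.summable_iff).2 hS
  have hS4 := (Int.divModEquiv M).symm.tsum_eq fun n : ℤ => c n * cexp (-Real.pi * z * n ^ 2)
  rw [← hS4]
  change _ = _ * ∑' p, ((fun n : ℤ => c n * cexp (-Real.pi * z * n ^ 2)) ∘
    (Int.divModEquiv M).symm) p
  rw [hS2.tsum_prod' (fun q => Summable.of_finite)]
  have hS3 : ∀ r : Fin M, Summable fun q : ℤ =>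
      ((fun n : ℤ => c n * cexp (-Real.pi * z * n ^ 2)) ∘ (Int.divModEquiv M).symm) (q, r) :=
    fun r => hS2.comp_injective (fun x y h => by simpa using h : 
      Function.Injective fun q : ℤ => (q, r))
  simp_rw [tsum_fintype]
  rw [Summable.tsum_finsetSum (fun r _ => hS3 r), Finset.mul_sum]
  refine Finset.sum_congr rfl fun r _ => ?_
  rw [tsum_exp_neg_quadratic hi]
  have ha2 : a i ^ (1 / 2 : ℂ) ≠ 0 := by simp [cpow_eq_zero_iff, hai]
  rw [mul_left_comm, one_div, ← tsum_mul_left]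
  congr 1
  refine tsum_congr fun q => ?_
  have hq : (Int.divModEquiv M).symm (q, r) = q * (M : ℤ) + ((r : ℕ) : ℤ) := rfl
  simp only [Function.comp_apply, hq]
  push_cast
  rw [ZMod.natCast_self, mul_zero, zero_add]
  congr 2
  rw [hz]
  field_simp
  rw [I_sq]
  ring

/-- Landsberg and Schaar type reciprocity. -/
lemma aux_LS (N p : ℕ) [NeZero N] [NeZero p] :
    ∑ x : ZMod N, ZMod.stdAddChar ((p : ZMod N) * x ^ 2) =
      (N : ℂ) ^ (1 / 2 : ℂ) * (1 / (2 * (-I * (2 * p)) ^ (1 / 2 : ℂ))) *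
        ∑ x : ZMod (4 * p), ZMod.stdAddChar (-(N : ZMod (4 * p)) * x ^ 2) := by
  have hN : (N : ℂ) ≠ 0 := NeZero.ne _
  have hp : (p : ℂ) ≠ 0 := NeZero.ne _
  have hNr : (0 : ℝ) < N := by exact_mod_cast NeZero.pos N
  have hpr : (0 : ℝ) < p := by exact_mod_cast NeZero.pos p
  let τ : ℝ → ℂ := fun A => 2 * p / N + I / (N ^ 2 * A)
  have hτim : ∀ A : ℝ, 0 < A → 0 < (τ A).im := by
    intro A hA
    have : τ A = ((2 * p / N : ℝ) : ℂ) + ((1 / (N ^ 2 * A) : ℝ) : ℂ) * I := by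
      simp only [τ]; push_cast; ring
    rw [this]
    simp only [add_im, ofReal_im, im_ofReal_mul, I_im]
    simp
    positivity
  have hτlim : Tendsto τ atTop (𝓝 (2 * p / N)) := by
    have h1 : Tendsto (fun A : ℝ => ((A⁻¹ : ℝ) : ℂ)) atTop (𝓝 ((0 : ℝ) : ℂ)) :=
      (continuous_ofReal.tendsto 0).comp tendsto_inv_atTop_zero
    have h2 := (h1.const_mul (I / N ^ 2 : ℂ)).const_add (2 * p / N : ℂ)
    simp only [ofReal_zero, mul_zero, add_zero] at h2
    refine h2.congr fun A => ?_
    simp only [τ]; push_cast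
    rw [div_mul_eq_mul_div, ← div_eq_mul_inv, div_div, mul_comm (A : ℂ)]
  let a' : ℝ → ℂ := fun A => τ A * ((N / (8 * p) : ℝ) : ℂ) * (A : ℝ)
  -- first asymptotics
  have hA : Tendsto (fun A : ℝ => ((A : ℂ) ^ (1 / 2 : ℂ))⁻¹ * jacobiTheta₂ 0 (τ A)) atTop
      (𝓝 (∑ x : ZMod N, ZMod.stdAddChar ((p : ZMod N) * x ^ 2))) := by
    refine (aux_theta_asymp (fun x : ZMod N => ZMod.stdAddChar ((p : ZMod N) * x ^ 2)) atTop
      (fun A : ℝ => (A : ℂ)) (by simp only [ofReal_re]; exact tendsto_id)).congr' ?_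
    filter_upwards [eventually_gt_atTop 0] with A hA
    have hA' : (A : ℂ) ≠ 0 := by exact_mod_cast hA.ne'
    congr 1
    refine tsum_congr fun n => ?_
    rw [jacobiTheta₂_term, show ((p : ZMod N) * (n : ZMod N) ^ 2) = ((p * n ^ 2 : ℤ) : ZMod N) by
      push_cast; ring, ZMod.stdAddChar_coe, ← Complex.exp_add]
    congr 1
    simp only [τ]
    push_cast
    field_simp
    linear_combination (-n ^ 2 : ℂ) * I_sq
  -- second asymptotics
  have hB : Tendsto (fun A : ℝ => ((a' A) ^ (1 / 2 : ℂ))⁻¹ * jacobiTheta₂ 0 (-1 / τ A)) atTop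
      (𝓝 (∑ x : ZMod (4 * p), ZMod.stdAddChar (-(N : ZMod (4 * p)) * x ^ 2))) := by
    have hre : Tendsto (fun A => (a' A).re) atTop atTop := by
      have : ∀ᶠ A : ℝ in atTop, (1 / 4 : ℝ) * A = (a' A).re := by
        filter_upwards [eventually_gt_atTop 0] with A hA
        have hA' : (A : ℂ) ≠ 0 := by exact_mod_cast hA.ne'
        have : a' A = ((1 / 4 * A : ℝ) : ℂ) + ((1 / (8 * p * N) : ℝ) : ℂ) * I := by
          simp only [a', τ]; push_cast; field_simp; ring
        rw [this]; simp
      exact (tendsto_id.const_mul_atTop (by norm_num : (0 : ℝ) < 1 / 4)).congr' this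
    refine (aux_theta_asymp (fun x : ZMod (4 * p) => 
      ZMod.stdAddChar (-(N : ZMod (4 * p)) * x ^ 2)) atTop a' hre).congr' ?_
    filter_upwards [eventually_gt_atTop 0] with A hA
    have hA' : (A : ℂ) ≠ 0 := by exact_mod_cast hA.ne'
    have hτ0 : τ A ≠ 0 := fun h => by have := hτim A hA; simp [h] at this
    congr 1
    refine tsum_congr fun n => ?_
    rw [jacobiTheta₂_term, show (-(N : ZMod (4 * p)) * (n : ZMod (4 * p)) ^ 2)
      = ((-N * n ^ 2 : ℤ) : ZMod (4 * p)) by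
      push_cast; ring, ZMod.stdAddChar_coe, ← Complex.exp_add]
    congr 1
    have hτN : τ A * (N ^ 2 * A) = 2 * p * N * A + I := by
      simp only [τ]; field_simp
    simp only [a']
    push_cast
    generalize τ A = t at hτN hτ0
    field_simp
    linear_combination (-8 * I * n ^ 2 : ℂ) * hτN - (8 * n ^ 2 : ℂ) * I_sq
  have hC : Tendsto (fun A : ℝ => 1 / (-I * τ A) ^ (1 / 2 : ℂ) *
      (τ A * ((N / (8 * p) : ℝ) : ℂ)) ^ (1 / 2 : ℂ)) atTop
      (𝓝 (1 / (-I * (2 * p / N)) ^ (1 / 2 : ℂ) *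
        ((2 * p / N : ℂ) * ((N / (8 * p) : ℝ) : ℂ)) ^ (1 / 2 : ℂ))) := by
    have hne : (-I * (2 * p / N) : ℂ) ≠ 0 := by simp [hN, hp]
    refine Tendsto.mul (Tendsto.div tendsto_const_nhds ?_ ?_) ?_
    · refine (hτlim.const_mul (-I)).cpow tendsto_const_nhds (Or.inr ?_)
      have : (-I * (2 * p / N) : ℂ) = ((2 * p / N : ℝ) : ℂ) * (-I) := by push_cast; ring
      rw [this, im_ofReal_mul]
      simp [hNr.ne', hpr.ne']
    · simp [cpow_eq_zero_iff, hN, hp]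
    · refine (hτlim.mul_const _).cpow tendsto_const_nhds (Or.inl ?_)
      have : ((2 * p / N : ℂ) * ((N / (8 * p) : ℝ) : ℂ)) = ((1 / 4 : ℝ) : ℂ) := by
        push_cast; field_simp; norm_num
      rw [this]; norm_num
  have hfin := tendsto_nhds_unique hA ((hC.mul hB).congr' ?_)
  · rw [hfin]
    have e1 : ((2 * p / N : ℂ) * ((N / (8 * p) : ℝ) : ℂ)) ^ (1 / 2 : ℂ) = 1 / 2 := by
      have : ((2 * p / N : ℂ) * ((N / (8 * p) : ℝ) : ℂ)) = ((1 / 4 : ℝ) : ℂ) := by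
        push_cast; field_simp; norm_num
      rw [this, show (1 / 2 : ℂ) = ((1 / 2 : ℝ) : ℂ) by push_cast; rfl,
        ← ofReal_cpow (by norm_num), ← Real.sqrt_eq_rpow,
        show (1 / 4 : ℝ) = (1 / 2) ^ 2 by norm_num, Real.sqrt_sq (by norm_num)]
    have e2 : (-I * (2 * p) : ℂ) ^ (1 / 2 : ℂ) =
        (-I * (2 * p / N)) ^ (1 / 2 : ℂ) * (N : ℂ) ^ (1 / 2 : ℂ) := by
      have := aux_cpow (-I * (2 * p / N)) N (by simp [hN, hp]) hNr
      rw [ofReal_natCast] at this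
      rw [← this]
      congr 1
      field_simp
    have hN2 : (N : ℂ) ^ (1 / 2 : ℂ) ≠ 0 := by simp [cpow_eq_zero_iff, hN]
    rw [e1, e2]
    field_simp
  · filter_upwards [eventually_gt_atTop 0] with A hA
    have hA' : (A : ℂ) ≠ 0 := by exact_mod_cast hA.ne'
    have hτ0 : τ A ≠ 0 := fun h => by have := hτim A hA; simp [h] at this
    have h8 : ((N / (8 * p) : ℝ) : ℂ) ≠ 0 := by
      push_cast; exact div_ne_zero hN (mul_ne_zero (by norm_num) hp)
    have e := aux_cpow (τ A * ((N / (8 * p) : ℝ) : ℂ)) A (mul_ne_zero hτ0 h8) hA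
    have hw : (τ A * ((N / (8 * p) : ℝ) : ℂ)) ^ (1 / 2 : ℂ) ≠ 0 := by
      rw [Ne, cpow_eq_zero_iff]; exact fun h => mul_ne_zero hτ0 h8 h.1
    have hfe := jacobiTheta₂_functional_equation 0 (τ A)
    simp only [zero_div, ne_eq, OfNat.ofNat_ne_zero, not_false_eq_true, zero_pow, mul_zero,
      Complex.exp_zero, mul_one] at hfe
    rw [hfe]
    simp only [a']
    rw [e, mul_inv]
    field_simp

lemma aux_quad_sum {p : ℕ} [Fact p.Prime] (hp2 : p ≠ 2) {a : ZMod p} (ha : a ≠ 0) :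
    ∑ x : ZMod p, ZMod.stdAddChar (a * x ^ 2) =
      (quadraticChar (ZMod p) a : ℂ) * ∑ x : ZMod p, ZMod.stdAddChar (x ^ 2) := by
  classical
  have hF : ringChar (ZMod p) ≠ 2 := by rw [ZMod.ringChar_zmod_n]; exact hp2
  let χ : MulChar (ZMod p) ℂ := (quadraticChar (ZMod p)).ringHomComp (Int.castRingHom ℂ)
  have hχ : ∀ y, χ y = (quadraticChar (ZMod p) y : ℂ) := fun _ => rfl
  have key : ∀ b : ZMod p, b ≠ 0 → ∑ x : ZMod p, ZMod.stdAddChar (b * x ^ 2) =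
      gaussSum χ ((ZMod.stdAddChar (N := p)).mulShift b) := by
    intro b hb
    have h0 : ∑ y : ZMod p, ZMod.stdAddChar (y * b) = 0 := by
      rw [AddChar.sum_mulShift b (ZMod.isPrimitive_stdAddChar p), if_neg hb]
      simp
    calc ∑ x : ZMod p, ZMod.stdAddChar (b * x ^ 2)
        = ∑ y : ZMod p, ∑ x : ZMod p with x ^ 2 = y, ZMod.stdAddChar (b * x ^ 2) :=
          (Finset.sum_fiberwise _ _ _).symm
      _ = ∑ y : ZMod p, ((quadraticChar (ZMod p) y : ℂ) + 1) * ZMod.stdAddChar (b * y) := by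
          refine Finset.sum_congr rfl fun y _ => ?_
          rw [Finset.sum_congr rfl (g := fun _ => ZMod.stdAddChar (b * y))
            (fun x hx => by rw [(Finset.mem_filter.1 hx).2])]
          rw [Finset.sum_const, nsmul_eq_mul]
          congr 1
          have := quadraticChar_card_sqrts hF y
          rw [show (Finset.univ.filter fun x : ZMod p => x ^ 2 = y) = {x : ZMod p | x ^ 2 = y}.toFinset
            by ext; simp]
          exact_mod_cast congrArg (Int.cast : ℤ → ℂ) this
      _ = _ := by
          simp_rw [add_mul, one_mul, Finset.sum_add_distrib]
          rw [show ∑ y : ZMod p, ZMod.stdAddChar (b * y) = 0 by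
            rw [← h0]; simp_rw [mul_comm]]
          rw [add_zero, gaussSum]
          rfl
  have h1 := key 1 one_ne_zero
  simp only [one_mul] at h1
  rw [key a ha, h1, AddChar.mulShift_one]
  have := gaussSum_mulShift χ (ZMod.stdAddChar (N := p)) (Units.mk0 a ha)
  rw [Units.val_mk0, hχ] at this
  have hsq : ((quadraticChar (ZMod p) a : ℂ)) * (quadraticChar (ZMod p) a : ℂ) = 1 := by
    have := quadraticChar_sq_one ha
    rw [sq] at this
    exact_mod_cast congrArg (Int.cast : ℤ → ℂ) this
  rw [← this, ← mul_assoc, hsq, one_mul]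

lemma aux_std4 (k : ℕ) : ZMod.stdAddChar (k : ZMod 4) = I ^ k := by
  have h1 : ZMod.stdAddChar ((1 : ℤ) : ZMod 4) = I := by
    rw [ZMod.stdAddChar_coe, show (2 * Real.pi * I * (1 : ℤ) / (4 : ℕ) : ℂ) = Real.pi / 2 * I by
      push_cast; ring, Complex.exp_mul_I, Complex.cos_pi_div_two, Complex.sin_pi_div_two]
    simp
  rw [← nsmul_one, AddChar.map_nsmul_eq_pow]
  congr 1

lemma aux_H {p : ℕ} [Fact p.Prime] (hp2 : p ≠ 2) : ∃ g : ℂ, ∀ N : ℕ, p.Coprime N →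
    ∑ x : ZMod (4 * p), ZMod.stdAddChar (-(N : ZMod (4 * p)) * x ^ 2) =
      (quadraticChar (ZMod p) N : ℂ) * g * (1 + I ^ (3 * p * N)) := by
  have hpp : p.Prime := Fact.out
  have hodd : Odd p := hpp.odd_of_ne_two hp2
  have hcop : Nat.Coprime 4 p := by
    have : Nat.Coprime 2 p := (Nat.coprime_primes Nat.prime_two hpp).2 hp2.symm
    exact Nat.Coprime.pow_left 2 this
  obtain ⟨u, v, huv⟩ : ∃ u v : ℤ, u * p + v * 4 = 1 := by
    have : IsCoprime (p : ℤ) (4 : ℤ) := by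
      exact_mod_cast (Nat.isCoprime_iff_coprime.2 hcop.symm)
    obtain ⟨u, v, h⟩ := this
    exact ⟨u, v, h⟩
  let e := ZMod.chineseRemainder hcop
  have hsplit : ∀ y : ZMod (4 * p), ZMod.stdAddChar y =
      ZMod.stdAddChar ((u : ZMod 4) * (e y).1) * ZMod.stdAddChar ((v : ZMod p) * (e y).2) := by
    intro y
    obtain ⟨j, rfl⟩ := ZMod.intCast_surjective y
    have he : e (j : ZMod (4 * p)) = (j : ZMod 4 × ZMod p) := map_intCast e j
    rw [he, Prod.fst_intCast, Prod.snd_intCast, ← Int.cast_mul, ← Int.cast_mul,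
      ZMod.stdAddChar_coe, ZMod.stdAddChar_coe, ZMod.stdAddChar_coe, ← Complex.exp_add]
    congr 1
    have hp0 : (p : ℂ) ≠ 0 := NeZero.ne _
    have : (u * p + v * 4 : ℂ) = 1 := by exact_mod_cast congrArg (Int.cast : ℤ → ℂ) huv
    push_cast
    field_simp
    linear_combination (-(j : ℂ)) * this
  have hv0 : (v : ZMod p) ≠ 0 := by
    intro h
    have := congrArg (Int.cast : ℤ → ZMod p) huv
    push_cast at this
    rw [h] at this
    simp at this
  have hu4 : (u : ZMod 4) = (p : ZMod 4) := by
    have := congrArg (Int.cast : ℤ → ZMod 4) huv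
    push_cast at this
    rw [show (4 : ZMod 4) = 0 from rfl, mul_zero, add_zero] at this
    have hpsq : (p : ZMod 4) * p = 1 := by
      obtain ⟨k, rfl⟩ := hodd
      push_cast
      generalize (k : ZMod 4) = z
      revert z; decide
    linear_combination (p : ZMod 4) * this - (u : ZMod 4) * hpsq
  refine ⟨2 * ((quadraticChar (ZMod p) (-v) : ℂ) * ∑ x : ZMod p, ZMod.stdAddChar (x ^ 2)),
    fun N hN => ?_⟩
  have hN0 : (N : ZMod p) ≠ 0 := by
    rw [Ne, ZMod.natCast_eq_zero_iff]
    exact (Nat.Prime.coprime_iff_not_dvd hpp).1 hN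
  calc ∑ x : ZMod (4 * p), ZMod.stdAddChar (-(N : ZMod (4 * p)) * x ^ 2)
      = ∑ x : ZMod (4 * p), ZMod.stdAddChar ((u : ZMod 4) * (-(N : ZMod 4) * (e x).1 ^ 2)) *
          ZMod.stdAddChar ((v : ZMod p) * (-(N : ZMod p) * (e x).2 ^ 2)) := by
        refine Finset.sum_congr rfl fun x _ => ?_
        rw [hsplit]
        simp
    _ = ∑ y : ZMod 4 × ZMod p, ZMod.stdAddChar ((u : ZMod 4) * (-(N : ZMod 4) * y.1 ^ 2)) *
          ZMod.stdAddChar ((v : ZMod p) * (-(N : ZMod p) * y.2 ^ 2)) :=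
        Fintype.sum_equiv e.toEquiv _ _ fun x => rfl
    _ = (∑ y : ZMod 4, ZMod.stdAddChar ((u : ZMod 4) * (-(N : ZMod 4) * y ^ 2))) *
          ∑ z : ZMod p, ZMod.stdAddChar ((v : ZMod p) * (-(N : ZMod p) * z ^ 2)) := by
        rw [Fintype.sum_prod_type, Finset.sum_mul_sum]
    _ = _ := by
        have e1 : ∑ y : ZMod 4, ZMod.stdAddChar ((u : ZMod 4) * (-(N : ZMod 4) * y ^ 2)) =
            2 * (1 + I ^ (3 * p * N)) := by
          have hh : ∀ y : ZMod 4, ZMod.stdAddChar ((u : ZMod 4) * (-(N : ZMod 4) * y ^ 2)) =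
              ZMod.stdAddChar (((3 * p * N : ℕ) : ZMod 4) * y ^ 2) := by
            intro y
            congr 1
            rw [hu4]; push_cast
            rw [show (3 : ZMod 4) = -1 from rfl]; ring
          simp_rw [hh]
          rw [← aux_std4]
          generalize ((3 * p * N : ℕ) : ZMod 4) = w
          have : ∀ f : ZMod 4 → ℂ, ∑ y, f y = f 0 + f 1 + f 2 + f 3 := fun f => Fin.sum_univ_four f
          rw [this, show w * 0 ^ 2 = 0 by ring, show w * 1 ^ 2 = w by ring,
            show w * 2 ^ 2 = 0 by rw [show (2 : ZMod 4) ^ 2 = 0 from rfl, mul_zero],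
            show w * 3 ^ 2 = w by rw [show (3 : ZMod 4) ^ 2 = 1 from rfl, mul_one],
            AddChar.map_zero_eq_one]
          ring
        have e2 : ∑ z : ZMod p, ZMod.stdAddChar ((v : ZMod p) * (-(N : ZMod p) * z ^ 2)) =
            (quadraticChar (ZMod p) N : ℂ) * ((quadraticChar (ZMod p) (-v) : ℂ) *
              ∑ x : ZMod p, ZMod.stdAddChar (x ^ 2)) := by
          have : ∀ z : ZMod p, (v : ZMod p) * (-(N : ZMod p) * z ^ 2) = ((N : ZMod p) * (-v)) * z ^ 2 :=
            fun z => by ring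
          simp_rw [this]
          rw [aux_quad_sum hp2 (mul_ne_zero hN0 (neg_ne_zero.2 hv0)), map_mul]
          push_cast
          ring
        rw [e1, e2]
        ring

/-- Evaluation of the quadratic Gauss sum `∑ e(p x² / N)`. -/
lemma aux_G {p N : ℕ} [NeZero N] [Fact p.Prime] (hp2 : p ≠ 2) (hpN : p.Coprime N) :
    (∑ x : ZMod N, ZMod.stdAddChar ((p : ZMod N) * x ^ 2)) * (1 + I ^ (3 * p)) =
      (N : ℂ) ^ (1 / 2 : ℂ) * (quadraticChar (ZMod p) N : ℂ) * (1 + I ^ (3 * p * N)) := by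
  obtain ⟨g, hg⟩ := aux_H hp2
  have h1 := aux_LS 1 p
  have hs : ∑ x : ZMod 1, ZMod.stdAddChar ((p : ZMod 1) * x ^ 2) = 1 := by
    have : ∀ x : ZMod 1, ZMod.stdAddChar ((p : ZMod 1) * x ^ 2) = 1 := fun x => by
      rw [Subsingleton.elim ((p : ZMod 1) * x ^ 2) 0, AddChar.map_zero_eq_one]
    simp_rw [this]
    simp
  rw [hs, hg 1 (Nat.coprime_one_right p)] at h1
  simp only [Nat.cast_one, map_one, Int.cast_one, one_cpow, one_mul, mul_one] at h1
  rw [aux_LS N p, hg N hpN]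
  linear_combination (-(N : ℂ) ^ (1 / 2 : ℂ) * (quadraticChar (ZMod p) N : ℂ)
    * (1 + I ^ (3 * p * N))) * h1
open Complex

/-- Square of the Gauss sum of a primitive quadratic character. -/
lemma aux_gaussSum_sq {N : ℕ} [NeZero N] {R : Type*} [CommRing R] [IsDomain R]
    {χ : DirichletCharacter R N} (hχ : χ.IsPrimitive) (hq : χ⁻¹ = χ)
    {ψ : AddChar (ZMod N) R} (hψ : ψ.IsPrimitive) :
    gaussSum χ ψ ^ 2 = χ (-1) * Fintype.card (ZMod N) := by
  have h1 : ∀ a, χ a * gaussSum χ ψ = gaussSum χ (ψ.mulShift a) := fun a => by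
    rw [gaussSum_mulShift_of_isPrimitive ψ hχ, hq]
  calc gaussSum χ ψ ^ 2 = ∑ a, ψ a * (χ a * gaussSum χ ψ) := by
        rw [sq]; nth_rewrite 1 [gaussSum]; rw [Finset.sum_mul]
        exact Finset.sum_congr rfl fun a _ => by ring
    _ = ∑ a, ∑ b, χ b * ψ (a * (1 + b)) := by
        refine Finset.sum_congr rfl fun a _ => ?_
        rw [h1, gaussSum, Finset.mul_sum]
        refine Finset.sum_congr rfl fun b _ => ?_
        rw [AddChar.mulShift_apply, mul_add, AddChar.map_add_eq_mul, mul_one]; ring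
    _ = ∑ b, χ b * ∑ a, ψ (a * (1 + b)) := by
        rw [Finset.sum_comm]
        exact Finset.sum_congr rfl fun b _ => by rw [Finset.mul_sum]
    _ = _ := by
        simp_rw [AddChar.sum_mulShift _ hψ]
        rw [Finset.sum_eq_single (-1)]
        · simp
        · intro b _ hb
          have : 1 + b ≠ 0 := fun h => hb (by linear_combination h)
          simp [this]
        · simp

/-- An integral version of a quadratic character. -/
lemma aux_exists_int {N : ℕ} [NeZero N] {χ : DirichletCharacter ℂ N} (hq : χ.IsQuadratic) :
    ∃ χ' : MulChar (ZMod N) ℤ, χ'.IsQuadratic ∧ ∀ a, χ a = (χ' a : ℂ) := by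
  classical
  have hex : ∀ a, ∃ k : ℤ, (k = 0 ∨ k = 1 ∨ k = -1) ∧ χ a = k := by
    intro a
    rcases hq a with h | h | h
    · exact ⟨0, by simp, by simp [h]⟩
    · exact ⟨1, by simp, by simp [h]⟩
    · exact ⟨-1, by simp, by simp [h]⟩
  choose f hf hf' using hex
  have key : ∀ {m n : ℤ}, (m : ℂ) = n → m = n := fun h => by exact_mod_cast h
  refine ⟨{ toFun := f, map_one' := key (by rw [← hf']; simp),
            map_mul' := fun a b => key (by push_cast; rw [← hf', ← hf', ← hf', map_mul]),
            map_nonunit' := fun a ha => key (by rw [← hf', MulChar.map_nonunit _ ha]; simp) },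
          fun a => hf a, fun a => hf' a⟩

lemma aux_prim {N : ℕ} [NeZero N] {χ : DirichletCharacter ℂ N} (hprim : χ.IsPrimitive)
    {F : Type*} [Field F] {χ' : DirichletCharacter F N}
    (h : ∀ a, χ' a = 1 ↔ χ a = 1) : χ'.IsPrimitive := by
  have : χ'.conductorSet = χ.conductorSet := by
    ext d
    by_cases hd : d ∣ N
    · rw [DirichletCharacter.mem_conductorSet_iff, DirichletCharacter.mem_conductorSet_iff,
        DirichletCharacter.factorsThrough_iff_ker_unitsMap hd,
        DirichletCharacter.factorsThrough_iff_ker_unitsMap hd]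
      have : χ'.toUnitHom.ker = χ.toUnitHom.ker := by
        ext u
        simp only [MonoidHom.mem_ker, Units.ext_iff, MulChar.coe_toUnitHom, Units.val_one]
        exact h _
      rw [this]
    · exact ⟨fun h => absurd (DirichletCharacter.mem_conductorSet_dvd _ h) hd,
        fun h => absurd (DirichletCharacter.mem_conductorSet_dvd _ h) hd⟩
  rw [DirichletCharacter.isPrimitive_def, DirichletCharacter.conductor, this]
  exact hprim

/-- Reciprocity: `χ p = (χ(-1) N / p)`, written multiplicatively. -/
lemma aux_recip {N : ℕ} [NeZero N] {χ : DirichletCharacter ℂ N} (hprim : χ.IsPrimitive)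
    (hq : χ.IsQuadratic) {p : ℕ} [Fact p.Prime] (hp2 : p ≠ 2) (hpN : p.Coprime N) :
    χ p = (if χ (-1) = 1 then 1 else (quadraticChar (ZMod p) (-1) : ℂ)) *
      (quadraticChar (ZMod p) N : ℂ) := by
  obtain ⟨χ₀, hχ₀, hval⟩ := aux_exists_int hq
  let F := AlgebraicClosure (ZMod p)
  have : CharP F p := inferInstance
  have hF2 : (ringChar F) ≠ 2 := by rw [ringChar.eq F p]; exact hp2
  have h11 : (-1 : F) ≠ 1 := Ring.neg_one_ne_one_of_char_ne_two hF2
  let χ' : DirichletCharacter F N := χ₀.ringHomComp (Int.castRingHom F)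
  have hχ'v : ∀ a, χ' a = (χ₀ a : F) := fun a => rfl
  have hχ'q : χ'.IsQuadratic := hχ₀.comp _
  have hprim' : χ'.IsPrimitive := by
    refine aux_prim hprim fun a => ?_
    rw [hχ'v, hval]
    rcases hχ₀ a with h | h | h <;> simp [h, h11]
    norm_num
  have hNF : (N : F) ≠ 0 := by
    rw [Ne, CharP.cast_eq_zero_iff F p]
    intro h
    exact (Fact.out : p.Prime).one_lt.ne' (Nat.Coprime.eq_one_of_dvd hpN h)
  have : NeZero (N : F) := ⟨hNF⟩
  obtain ⟨ζ, hζ⟩ : ∃ ζ : F, IsPrimitiveRoot ζ N := HasEnoughRootsOfUnity.exists_primitiveRoot F N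
  have hψ := AddChar.zmodChar_primitive_of_primitive_root N hζ
  have hpu : IsUnit (p : ZMod N) := (ZMod.isUnit_iff_coprime p N).2 hpN
  have hsq := aux_gaussSum_sq hprim' hχ'q.inv hψ
  have key := Char.card_pow_char_pow hχ'q _ p 1 hpu hp2 hsq
  rw [pow_one, pow_one, ZMod.card, hχ'v, hχ'v] at key
  -- transfer to `quadraticChar`
  have hquadInt : quadraticChar (ZMod p) ((χ₀ (-1) * N : ℤ) : ZMod p) = χ₀ p := by
    have e1 := quadraticChar_eq_pow_of_char_ne_two' (F := ZMod p)
      (by rw [ZMod.ringChar_zmod_n]; exact hp2) ((χ₀ (-1) * N : ℤ) : ZMod p)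
    have e2 : ((quadraticChar (ZMod p) ((χ₀ (-1) * N : ℤ) : ZMod p) : ℤ) : F) = (χ₀ p : F) := by
      rw [← key]
      have := congrArg (algebraMap (ZMod p) F) e1
      rw [ZMod.card] at this
      simpa using this
    exact (quadraticChar_isQuadratic (ZMod p)).eq_of_eq_coe hχ₀ hF2 e2
  rw [hval, hval, ← hquadInt]
  push_cast
  rw [map_mul]
  rcases hχ₀ (-1) with h | h | h
  · exfalso
    have : IsUnit (χ₀ (-1)) := (isUnit_one.neg).map χ₀
    rw [h] at this; simp at this
  · simp [h]
  · simp [h]; norm_num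

lemma aux_f1 {N : ℕ} [NeZero N] (χ : DirichletCharacter ℂ N) (hprim : χ.IsPrimitive)
    (hq : χ.IsQuadratic) {p : ℕ} [Fact p.Prime] (hp2 : p ≠ 2) (hpN : p.Coprime N) :
    (p % 4 = 1 → χ p * (∑ x : ZMod N, ZMod.stdAddChar ((p : ZMod N) * x ^ 2)) * (1 + I ^ 3) =
      (N : ℂ) ^ (1 / 2 : ℂ) * (1 + I ^ (3 * N))) ∧
    (p % 4 = 3 → χ p * (∑ x : ZMod N, ZMod.stdAddChar ((p : ZMod N) * x ^ 2)) * (1 + I) =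
      (N : ℂ) ^ (1 / 2 : ℂ) * (χ (-1) * (1 + I ^ N))) := by
  have hpp : p.Prime := Fact.out
  have hF : ringChar (ZMod p) ≠ 2 := by rw [ZMod.ringChar_zmod_n]; exact hp2
  have hr := aux_recip hprim hq hp2 hpN
  have hG := aux_G hp2 hpN
  have hN0 : (N : ZMod p) ≠ 0 := by
    rw [Ne, ZMod.natCast_eq_zero_iff]
    exact (Nat.Prime.coprime_iff_not_dvd hpp).1 hpN
  have hsq : ((quadraticChar (ZMod p) N : ℂ)) * (quadraticChar (ZMod p) N : ℂ) = 1 := by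
    have := quadraticChar_sq_one hN0
    rw [sq] at this
    exact_mod_cast congrArg (Int.cast : ℤ → ℂ) this
  have hneg := quadraticChar_neg_one hF
  rw [ZMod.card] at hneg
  have hI : ∀ k : ℕ, I ^ (4 * k) = 1 := fun k => by rw [pow_mul, I_pow_four, one_pow]
  constructor
  · intro hp
    have hI3 : I ^ (3 * p) = I ^ 3 := by
      rw [show 3 * p = 4 * (3 * (p / 4)) + 3 by omega, pow_add, hI, one_mul]
    rw [ZMod.χ₄_nat_one_mod_four hp] at hneg
    rw [hneg, Int.cast_one, ite_self, one_mul] at hr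
    rw [pow_mul I (3 * p) N, hI3, ← pow_mul] at hG
    rw [hr]
    linear_combination (quadraticChar (ZMod p) N : ℂ) * hG +
      (N : ℂ) ^ (1 / 2 : ℂ) * (1 + I ^ (3 * N)) * hsq
  · intro hp
    have hI3 : I ^ (3 * p) = I := by
      rw [show 3 * p = 4 * (3 * (p / 4) + 2) + 1 by omega, pow_add, hI, one_mul, pow_one]
    rw [ZMod.χ₄_nat_three_mod_four hp] at hneg
    have ht : (if χ (-1) = 1 then (1 : ℂ) else (quadraticChar (ZMod p) (-1) : ℂ)) = χ (-1) := by
      rcases χ.even_or_odd with h | h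
      · have h' : χ (-1) = 1 := h
        rw [if_pos h', h']
      · have h' : χ (-1) = -1 := h
        rw [h', if_neg (by norm_num), hneg]; simp
    rw [ht] at hr
    rw [pow_mul I (3 * p) N, hI3] at hG
    rw [hr]
    linear_combination (quadraticChar (ZMod p) N : ℂ) * χ (-1) * hG +
      (N : ℂ) ^ (1 / 2 : ℂ) * χ (-1) * (1 + I ^ N) * hsq

lemma aux_prime {N : ℕ} [NeZero N] (b : (ZMod (4 * N))ˣ) : ∃ p : ℕ, p.Prime ∧ p ≠ 2 ∧
    p.Coprime N ∧ (p : ZMod (4 * N)) = b := by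
  obtain ⟨p, hgt, hp, hb⟩ := Nat.forall_exists_prime_gt_and_eq_mod b.isUnit (4 * N)
  have hN : 0 < N := Nat.pos_of_ne_zero (NeZero.ne N)
  refine ⟨p, hp, by omega, ?_, hb⟩
  rw [Nat.Prime.coprime_iff_not_dvd hp]
  intro h
  have := Nat.le_of_dvd hN h
  omega

lemma aux_f {N : ℕ} [NeZero N] (χ : DirichletCharacter ℂ N) (hprim : χ.IsPrimitive)
    (hq : χ.IsQuadratic) (a : (ZMod N)ˣ) :
    χ a * (∑ x : ZMod N, ZMod.stdAddChar ((a : ZMod N) * x ^ 2)) +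
      χ (-a) * (∑ x : ZMod N, ZMod.stdAddChar (-(a : ZMod N) * x ^ 2)) =
      (N : ℂ) ^ (1 / 2 : ℂ) * ((1 + I ^ (3 * N)) / (1 + I ^ 3) + χ (-1) * (1 + I ^ N) / (1 + I)) := by
  obtain ⟨b, hb⟩ := ZMod.unitsMap_surjective (show N ∣ 4 * N from Dvd.intro_left 4 rfl) a
  have hba : ((b : ZMod (4 * N)).cast : ZMod N) = a := by
    rw [← hb]; rfl
  obtain ⟨p, hp, hp2, hpN, hpb⟩ := aux_prime b
  obtain ⟨q, hq', hq2, hqN, hqb⟩ := aux_prime (-b)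
  have : Fact p.Prime := ⟨hp⟩
  have : Fact q.Prime := ⟨hq'⟩
  have hpa : (p : ZMod N) = a := by
    rw [← hba, ← hpb, ZMod.cast_natCast (Dvd.intro_left 4 rfl)]
  have hsum : 4 * N ∣ p + q := by
    rw [← ZMod.natCast_eq_zero_iff]
    push_cast
    rw [hpb, hqb]; simp
  have hqa : (q : ZMod N) = -a := by
    have : ((p + q : ℕ) : ZMod N) = 0 := by
      rw [ZMod.natCast_eq_zero_iff]
      exact (Dvd.intro_left 4 rfl).trans hsum
    push_cast at this
    rw [hpa] at this
    linear_combination this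
  have h4 : (p + q) % 4 = 0 := Nat.mod_eq_zero_of_dvd ((Dvd.intro N rfl).trans hsum)
  have hpo := hp.eq_two_or_odd
  have hI1 : (1 + I : ℂ) ≠ 0 := by
    intro h; simpa using congrArg Complex.re h
  have hI3 : (1 + I ^ 3 : ℂ) ≠ 0 := by
    intro h; rw [I_pow_three] at h; simpa using congrArg Complex.re h
  have Hp := aux_f1 χ hprim hq hp2 hpN
  have Hq := aux_f1 χ hprim hq hq2 hqN
  rw [hpa] at Hp
  rw [hqa] at Hq
  rw [mul_add, mul_div_assoc', mul_div_assoc']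
  rcases (show (p % 4 = 1 ∧ q % 4 = 3) ∨ (p % 4 = 3 ∧ q % 4 = 1) by omega) with ⟨h1, h2⟩ | ⟨h1, h2⟩
  · rw [← Hp.1 h1, ← Hq.2 h2, mul_div_cancel_right₀ _ hI3, mul_div_cancel_right₀ _ hI1]
  · rw [← Hp.2 h1, ← Hq.1 h2, mul_div_cancel_right₀ _ hI3, mul_div_cancel_right₀ _ hI1, add_comm]

lemma aux_tau {N : ℕ} [NeZero N] (χ : DirichletCharacter ℂ N) (hprim : χ.IsPrimitive)
    (hq : χ.IsQuadratic) :
    2 * gaussSum χ (ZMod.stdAddChar (N := N)) =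
      (N : ℂ) ^ (1 / 2 : ℂ) * ((1 + I ^ (3 * N)) / (1 + I ^ 3) + χ (-1) * (1 + I ^ N) / (1 + I)) := by
  classical
  set K := (N : ℂ) ^ (1 / 2 : ℂ) *
    ((1 + I ^ (3 * N)) / (1 + I ^ 3) + χ (-1) * (1 + I ^ N) / (1 + I)) with hK
  let G : ZMod N → ℂ := fun a => ∑ x : ZMod N, ZMod.stdAddChar (a * x ^ 2)
  have hS : ∑ x : ZMod N, (1 : DirichletCharacter ℂ N) x ≠ 0 := by
    rw [MulChar.sum_one_eq_card_units]
    exact_mod_cast Fintype.card_ne_zero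
  have hsq : ∀ x, χ (x ^ 2) = (1 : DirichletCharacter ℂ N) x := by
    intro x
    rw [← hq.sq_eq_one, MulChar.pow_apply' _ two_ne_zero, map_pow]
  have h1 : ∑ a, χ a * G a = gaussSum χ (ZMod.stdAddChar (N := N)) *
      ∑ x : ZMod N, (1 : DirichletCharacter ℂ N) x := by
    simp only [G, Finset.mul_sum]
    rw [Finset.sum_comm]
    refine Finset.sum_congr rfl fun x _ => ?_
    have := gaussSum_mulShift_of_isPrimitive (ZMod.stdAddChar (N := N)) hprim (x ^ 2)
    rw [hq.inv, hsq] at this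
    rw [mul_comm, ← this, gaussSum]
    refine Finset.sum_congr rfl fun a _ => ?_
    rw [AddChar.mulShift_apply, mul_comm a]
  have h2 : ∑ a, χ (-a) * G (-a) = ∑ a, χ a * G a :=
    Fintype.sum_equiv (Equiv.neg _) _ _ fun a => rfl
  have h3 : ∑ a, (χ a * G a + χ (-a) * G (-a)) = K * ∑ x : ZMod N, (1 : DirichletCharacter ℂ N) x := by
    rw [Finset.mul_sum]
    refine Finset.sum_congr rfl fun a _ => ?_
    by_cases ha : IsUnit a
    · obtain ⟨u, rfl⟩ := ha
      rw [MulChar.one_apply_coe, mul_one, hK]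
      exact aux_f χ hprim hq u
    · have ha' : ¬ IsUnit (-a) := by rwa [IsUnit.neg_iff]
      rw [MulChar.map_nonunit _ ha, MulChar.map_nonunit _ ha', MulChar.map_nonunit _ ha]
      ring
  rw [Finset.sum_add_distrib, h2, h1] at h3
  apply mul_right_cancel₀ hS
  linear_combination h3

lemma aux_root {N : ℕ} [NeZero N] (χ : DirichletCharacter ℂ N) (hprim : χ.IsPrimitive)
    (hquad : χ ^ 2 = 1) : χ.rootNumber = 1 := by
  have hq : χ.IsQuadratic := MulChar.isQuadratic_iff_sq_eq_one.2 hquad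
  have ht := aux_tau χ hprim hq
  have hsq := aux_gaussSum_sq hprim hq.inv (ZMod.isPrimitive_stdAddChar N)
  have hNC : (N : ℂ) ≠ 0 := NeZero.ne _
  have hN2 : (N : ℂ) ^ (1 / 2 : ℂ) ≠ 0 := by
    rw [Ne, cpow_eq_zero_iff]; tauto
  have hτ : gaussSum χ (ZMod.stdAddChar (N := N)) ≠ 0 := by
    intro h
    rw [h, ZMod.card] at hsq
    rcases χ.even_or_odd with h | h
    · have h' : χ (-1) = 1 := h
      rw [h'] at hsq; exact hNC (by linear_combination -hsq)
    · have h' : χ (-1) = -1 := h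
      rw [h'] at hsq; exact hNC (by linear_combination hsq)
  have hI1 : (1 + I : ℂ) ≠ 0 := by
    intro h; simpa using congrArg Complex.re h
  have hI3 : (1 + -I : ℂ) ≠ 0 := by
    intro h; simpa using congrArg Complex.re h
  have hI4 : ∀ k : ℕ, I ^ (4 * k) = 1 := fun k => by rw [pow_mul, I_pow_four, one_pow]
  have hIN : I ^ N = I ^ (N % 4) := by
    conv_lhs => rw [← Nat.div_add_mod N 4, pow_add, hI4, one_mul]
  have hI2 := I_mul_I
  rw [mul_comm 3 N, pow_mul I N 3, hIN, I_pow_three] at ht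
  have i1 : (1 + I : ℂ)⁻¹ = (1 - I) / 2 := by
    apply inv_eq_of_mul_eq_one_left
    linear_combination (-1 / 2 : ℂ) * hI2
  have i2 : (1 + -I : ℂ)⁻¹ = (1 + I) / 2 := by
    apply inv_eq_of_mul_eq_one_left
    linear_combination (-1 / 2 : ℂ) * hI2
  have hnI : (-I) ^ 3 = I := by
    rw [neg_pow, I_pow_three]; ring
  rw [div_eq_mul_inv _ (1 + I), div_eq_mul_inv _ (1 + -I), i1, i2] at ht
  have hmod : N % 4 < 4 := Nat.mod_lt _ (by norm_num)
  rw [DirichletCharacter.rootNumber]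
  rcases χ.even_or_odd with h | h
  · have h' : χ (-1) = 1 := h
    rw [if_pos h, pow_zero, div_one, div_eq_one_iff_eq hN2]
    rw [h'] at ht
    generalize N % 4 = r at ht hmod
    interval_cases r
    · simp only [pow_zero, pow_one, one_pow, I_sq, I_pow_three, hnI] at ht
      linear_combination ht / 2
    · simp only [pow_zero, pow_one, one_pow, I_sq, I_pow_three, hnI] at ht
      linear_combination ht / 2 - (N : ℂ) ^ (1 / 2 : ℂ) / 2 * hI2
    · simp only [pow_zero, pow_one, one_pow, I_sq, I_pow_three, hnI] at ht
      exact absurd (by linear_combination ht / 2) hτ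
    · simp only [pow_zero, pow_one, one_pow, I_sq, I_pow_three, hnI] at ht
      exact absurd (by linear_combination ht / 2 + (N : ℂ) ^ (1 / 2 : ℂ) / 2 * hI2) hτ
  · have h' : χ (-1) = -1 := h
    have hne : ¬ χ.Even := by
      intro he; have : χ (-1) = 1 := he
      rw [h'] at this; norm_num at this
    rw [if_neg hne, pow_one, div_div, div_eq_one_iff_eq (mul_ne_zero I_ne_zero hN2)]
    rw [h'] at ht
    generalize N % 4 = r at ht hmod
    interval_cases r
    · simp only [pow_zero, pow_one, one_pow, I_sq, I_pow_three, hnI] at ht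
      linear_combination ht / 2
    · simp only [pow_zero, pow_one, one_pow, I_sq, I_pow_three, hnI] at ht
      exact absurd (by linear_combination ht / 2) hτ
    · simp only [pow_zero, pow_one, one_pow, I_sq, I_pow_three, hnI] at ht
      exact absurd (by linear_combination ht / 2) hτ
    · simp only [pow_zero, pow_one, one_pow, I_sq, I_pow_three, hnI] at ht
      linear_combination ht / 2

open Complex

lemma aux_final {N : ℕ} [NeZero N] (hN : 1 < N)
    (χ : DirichletCharacter ℂ N) (hprim : χ.IsPrimitive)
    (hquad : χ ^ 2 = 1) (hnontriv : χ ≠ 1) (hroot : χ.rootNumber = 1)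
    (ε : ℝ) (hε : (χ (-1) = 1 ∧ ε = 2) ∨ (χ (-1) = -1 ∧ ε = 0)) :
    deriv (fun s : ℂ => riemannZeta s * DirichletCharacter.LFunction χ s) (1 / 2) =
      -(1 / 2) * ((Real.log N - ε * (Real.pi / 2) -
          2 * (Real.log (8 * Real.pi) + Real.eulerMascheroniConstant) : ℝ) : ℂ) *
        (riemannZeta (1 / 2) * DirichletCharacter.LFunction χ (1 / 2)) := by
  have hinv : χ⁻¹ = χ := by
    rw [inv_eq_iff_mul_eq_one, ← sq, hquad]
  have h120 : (1 / 2 : ℂ) ≠ 0 := by norm_num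
  have h121 : (1 / 2 : ℂ) ≠ 1 := by norm_num
  have hsubd : HasDerivAt (fun s : ℂ => 1 - s) (-1) (1 / 2) := by
    simpa using (hasDerivAt_id (1 / 2 : ℂ)).const_sub 1
  have hhalf : (1 : ℂ) - 1 / 2 = 1 / 2 := by norm_num
  -- completed zeta
  obtain ⟨z', hz⟩ : ∃ z', HasDerivAt completedRiemannZeta z' (1 / 2) :=
    ⟨_, (differentiableAt_completedZeta h120 h121).hasDerivAt⟩
  have hz0 : z' = 0 := by
    have hz1 : HasDerivAt (fun s => completedRiemannZeta (1 - s)) (z' * -1) (1 / 2) :=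
      HasDerivAt.comp (1 / 2 : ℂ) (by rwa [hhalf]) hsubd
    simp_rw [completedRiemannZeta_one_sub] at hz1
    have := hz.unique hz1
    linear_combination this / 2
  -- completed L
  obtain ⟨l', hl⟩ : ∃ l', HasDerivAt χ.completedLFunction l' (1 / 2) :=
    ⟨_, (DirichletCharacter.differentiable_completedLFunction hnontriv _).hasDerivAt⟩
  have hNc : (N : ℂ) ≠ 0 := NeZero.ne _
  have hl0 : l' = -(1 / 2) * Complex.log N * χ.completedLFunction (1 / 2) := by
    have hl1 : HasDerivAt (fun s => χ.completedLFunction (1 - s)) (l' * -1) (1 / 2) :=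
      HasDerivAt.comp (1 / 2 : ℂ) (by rwa [hhalf]) hsubd
    simp_rw [hprim.completedLFunction_one_sub, hroot, hinv, mul_one] at hl1
    have hl2 := ((((hasDerivAt_id (1 / 2 : ℂ)).sub_const (1 / 2)).const_cpow
      (c := (N : ℂ)) (Or.inl hNc)).mul hl).unique hl1
    simp at hl2
    simp
    linear_combination (1 / 2) * hl2
  -- Gamma factors
  have hpi : (Real.pi : ℂ) ≠ 0 := by exact_mod_cast Real.pi_ne_zero
  have hgd : ∀ s : ℂ, 0 < s.re → DifferentiableAt ℂ Gammaℝ s := fun s hs => by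
    have := (differentiable_Gammaℝ_inv s).inv (inv_ne_zero (Gammaℝ_ne_zero_of_re_pos hs))
    rwa [show (fun s => (Gammaℝ s)⁻¹)⁻¹ = Gammaℝ from funext fun s => inv_inv _] at this
  have hg1 : Gammaℝ (1 / 2) ≠ 0 := Gammaℝ_ne_zero_of_re_pos (by norm_num)
  have hg3 : Gammaℝ (1 / 2 + 1) ≠ 0 := Gammaℝ_ne_zero_of_re_pos (by norm_num)
  obtain ⟨g', hg⟩ : ∃ g', HasDerivAt Gammaℝ g' (1 / 2) := ⟨_, (hgd _ (by norm_num)).hasDerivAt⟩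
  obtain ⟨k', hk⟩ : ∃ k', HasDerivAt (fun s => Gammaℝ (s + 1)) k' (1 / 2) := by
    have := (hgd (1 / 2 + 1) (by norm_num)).hasDerivAt
    exact ⟨_, this.comp_add_const (1 / 2) 1⟩
  set C : ℂ := ((Real.log (8 * Real.pi) + Real.eulerMascheroniConstant : ℝ) : ℂ) with hC
  have hGC0 : Gammaℂ (1 / 2) ≠ 0 := by
    rw [← Gammaℝ_mul_Gammaℝ_add_one]; exact mul_ne_zero hg1 hg3
  have hGC : HasDerivAt Gammaℂ (-C * Gammaℂ (1 / 2)) (1 / 2) := by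
    have h2pi : (2 * Real.pi : ℂ) ≠ 0 := mul_ne_zero two_ne_zero hpi
    have h1 := (((hasDerivAt_neg' (1 / 2 : ℂ)).const_cpow (c := 2 * Real.pi) (Or.inl h2pi)).const_mul
      2).mul hasDerivAt_Gamma_one_half
    refine h1.congr_deriv ?_
    have hlog : C = Complex.log (2 * Real.pi) + 2 * Complex.log 2
        + Real.eulerMascheroniConstant := by
      have hr : Real.log (8 * Real.pi) = Real.log (2 * Real.pi) + 2 * Real.log 2 := by
        rw [show (8 * Real.pi : ℝ) = (2 * Real.pi) * (2 * 2) by ring,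
          Real.log_mul (by positivity) (by norm_num),
          Real.log_mul (x := 2) (y := 2) (by norm_num) (by norm_num)]
        ring
      have h1 : ((Real.log (2 * Real.pi) : ℝ) : ℂ) = Complex.log (2 * Real.pi) := by
        rw [Complex.ofReal_log Real.two_pi_pos.le]; push_cast; rfl
      have h2 : ((Real.log 2 : ℝ) : ℂ) = Complex.log 2 := by
        rw [Complex.ofReal_log (by norm_num)]; push_cast; rfl
      rw [hC, hr, ofReal_add, ofReal_add, ofReal_mul, h1, h2]
      push_cast
      ring
    rw [Gammaℂ_def, hlog, Complex.Gamma_one_half_eq, Real.sqrt_eq_rpow,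
      ofReal_cpow Real.pi_pos.le]
    push_cast
    ring
  have hodd : g' * Gammaℝ (1 / 2 + 1) + Gammaℝ (1 / 2) * k' =
      -C * (Gammaℝ (1 / 2) * Gammaℝ (1 / 2 + 1)) := by
    have := hg.mul hk
    rw [show (Gammaℝ * fun s => Gammaℝ (s + 1)) = Gammaℂ from
      funext fun s => Gammaℝ_mul_Gammaℝ_add_one s] at this
    rw [this.unique hGC, Gammaℝ_mul_Gammaℝ_add_one]
  have heven : 2 * g' = (-C - Real.pi / 2) * Gammaℝ (1 / 2) := by
    have h1 : HasDerivAt (fun s => Gammaℝ (1 - s)) (g' * -1) (1 / 2) :=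
      HasDerivAt.comp (h₂ := Gammaℝ) (1 / 2 : ℂ) (by rwa [hhalf]) hsubd
    have hcos : HasDerivAt (fun s : ℂ => Complex.cos (Real.pi * s / 2))
        (-Complex.sin (Real.pi * (1 / 2) / 2) * (Real.pi / 2)) (1 / 2) := by
      have : HasDerivAt (fun s : ℂ => Real.pi * s / 2) (Real.pi / 2 : ℂ) (1 / 2) := by
        simpa using ((hasDerivAt_id (1 / 2 : ℂ)).const_mul (Real.pi : ℂ)).div_const 2
      exact this.ccos
    have h2 := hg.div h1 (by rwa [hhalf])
    have h3 := hGC.mul hcos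
    have heq : (Gammaℝ / fun s => Gammaℝ (1 - s)) =ᶠ[nhds (1 / 2 : ℂ)]
        (Gammaℂ * fun s : ℂ => Complex.cos (Real.pi * s / 2)) := by
      have : ∀ᶠ s : ℂ in nhds (1 / 2), 0 < s.re :=
        (continuous_re.isOpen_preimage _ isOpen_Ioi).mem_nhds (by norm_num)
      filter_upwards [this] with s hs
      refine Gammaℝ_div_Gammaℝ_one_sub fun n h => ?_
      rw [h] at hs
      simp at hs
      linarith [(Nat.cast_nonneg n : (0 : ℝ) ≤ n)]
    have h4 := (h2.congr_of_eventuallyEq heq.symm).unique h3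
    have h5 := heq.self_of_nhds
    simp only [Pi.div_apply, Pi.mul_apply, hhalf, div_self hg1] at h5
    have hsc : Complex.sin (Real.pi * (1 / 2) / 2) = Complex.cos (Real.pi * (1 / 2) / 2) := by
      rw [show (Real.pi * (1 / 2) / 2 : ℂ) = ((Real.pi / 4 : ℝ) : ℂ) by push_cast; ring,
        ← ofReal_sin, ← ofReal_cos, Real.sin_pi_div_four, Real.cos_pi_div_four]
    rw [hhalf, hsc] at h4
    have h6 : (g' * Gammaℝ (1 / 2) - Gammaℝ (1 / 2) * (g' * -1)) / Gammaℝ (1 / 2) ^ 2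
      = -C - Real.pi / 2 := by
      rw [h4]; linear_combination (C + Real.pi / 2) * h5
    field_simp at h6
    linear_combination h6 / 2
  -- zeta and L
  have hzeta : HasDerivAt riemannZeta (-(g' / Gammaℝ (1 / 2)) * riemannZeta (1 / 2)) (1 / 2) := by
    have h1 := hz.div hg hg1
    have : riemannZeta =ᶠ[nhds (1 / 2 : ℂ)] (completedRiemannZeta / Gammaℝ) := by
      filter_upwards [isOpen_ne.mem_nhds h120] with s hs
      exact riemannZeta_def_of_ne_zero hs
    refine (h1.congr_of_eventuallyEq this).congr_deriv ?_
    rw [this.self_of_nhds, Pi.div_apply, hz0]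
    field_simp
    ring
  have hLgen : ∀ (f : ℂ → ℂ) (f' : ℂ), HasDerivAt f f' (1 / 2) → f (1 / 2) ≠ 0 →
      (∀ s, χ.gammaFactor s = f s) → HasDerivAt χ.LFunction
      ((-(1 / 2) * Complex.log N - f' / f (1 / 2)) * χ.LFunction (1 / 2)) (1 / 2) := by
    intro f f' hf hf0 hfg
    have h1 := hl.div hf hf0
    have h2 : χ.LFunction = χ.completedLFunction / f := by
      funext s
      rw [χ.LFunction_eq_completed_div_gammaFactor s (Or.inr hN.ne'), hfg]; rfl
    rw [← h2] at h1
    refine h1.congr_deriv ?_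
    rw [h2, Pi.div_apply, hl0]
    field_simp
  have hlogN : ((Real.log N : ℝ) : ℂ) = Complex.log N := by
    rw [Complex.ofReal_log (Nat.cast_nonneg _)]; simp
  rcases hε with ⟨hpar, rfl⟩ | ⟨hpar, rfl⟩
  · have hE : χ.Even := hpar
    have hL := hLgen Gammaℝ g' hg hg1 hE.gammaFactor_def
    have := (hzeta.mul hL).deriv
    change deriv (riemannZeta * χ.LFunction) (1 / 2) = _
    rw [this]
    have e : g' / Gammaℝ (1 / 2) = (-C - Real.pi / 2) / 2 := by
      rw [div_eq_iff hg1]; linear_combination heven / 2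
    rw [e]
    push_cast [hlogN]
    push_cast at hC
    rw [hC]
    ring
  · have hO : χ.Odd := hpar
    have hL := hLgen (fun s => Gammaℝ (s + 1)) k' hk hg3 hO.gammaFactor_def
    have := (hzeta.mul hL).deriv
    change deriv (riemannZeta * χ.LFunction) (1 / 2) = _
    rw [this]
    have e : k' / Gammaℝ (1 / 2 + 1) = -C - g' / Gammaℝ (1 / 2) := by
      have : ∀ a b : ℂ, a ≠ 0 → b ≠ 0 → g' * b + a * k' = -C * (a * b) →
          k' / b = -C - g' / a := by
        intro a b ha hb h
        field_simp
        linear_combination h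
      exact this _ _ hg1 hg3 hodd
    rw [e]
    push_cast [hlogN]
    push_cast at hC
    rw [hC]
    ring

end AuxFacts

/-- **Specialization of equations (2) and (3) to quadratic fields.** For a primitive
quadratic Dirichlet character `χ` of modulus `N > 1`, with `ε = 2` if `χ(−1) = 1` and
`ε = 0` if `χ(−1) = −1`, the derivative at `s = 1/2` of `s ↦ ζ(s)·L(s,χ)` equals
`−(1/2)(log N − ε·π/2 − 2(log(8π)+γ))·ζ(1/2)·L(1/2,χ)`. -/
theorem deriv_zeta_mul_LFunction_at_half {N : ℕ} [NeZero N] (hN : 1 < N)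
    (χ : DirichletCharacter ℂ N) (hprim : χ.IsPrimitive)
    (hquad : χ ^ 2 = 1) (hnontriv : χ ≠ 1)
    (ε : ℝ) (hε : (χ (-1) = 1 ∧ ε = 2) ∨ (χ (-1) = -1 ∧ ε = 0)) :
    deriv (fun s : ℂ => riemannZeta s * DirichletCharacter.LFunction χ s) (1 / 2) =
      -(1 / 2) * ((Real.log N - ε * (Real.pi / 2) -
          2 * (Real.log (8 * Real.pi) + Real.eulerMascheroniConstant) : ℝ) : ℂ) *
        (riemannZeta (1 / 2) * DirichletCharacter.LFunction χ (1 / 2)) := by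
  exact aux_final hN χ hprim hquad hnontriv (aux_root χ hprim hquad) ε hε
end
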